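/- Let Ω₁ and Ω₂ be bounded domains in ℂⁿ (n ≥ 2) with C^k (k ≥ 3)-smooth boundaries. If ∂Ω₁ and ∂Ω₂ are CR-equivalent (i.e., there exists a CR-diffeomorphism f : ∂Ω₁ → ∂Ω₂), then DF(Ω₁) = DF(Ω₂). -/

import Mathlib

open Complex
open scoped ComplexOrder

noncomputable section

/-- Points of ℂⁿ. -/
abbrev Pt (n : ℕ) := Fin n → ℂ

/-- Wirtinger derivative ∂f/∂z_j at z (junk value if f is not differentiable). -/
def dZ (n : ℕ) (f : Pt n → ℂ) (j : Fin n) (z : Pt n) : ℂ :=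
  (1 / 2 : ℂ) * (fderiv ℝ f z (Pi.single j 1) - Complex.I * fderiv ℝ f z (Pi.single j Complex.I))

/-- Wirtinger derivative ∂f/∂z̄_j at z. -/
def dZb (n : ℕ) (f : Pt n → ℂ) (j : Fin n) (z : Pt n) : ℂ :=
  (1 / 2 : ℂ) * (fderiv ℝ f z (Pi.single j 1) + Complex.I * fderiv ℝ f z (Pi.single j Complex.I))

/-- Complexification of a real-valued function. -/
def cR (n : ℕ) (ρ : Pt n → ℝ) : Pt n → ℂ := fun z => (ρ z : ℂ)

/-- Levi form of ρ at z: Levi_ρ(X,Y) = Σ_{j,k} ∂²ρ/∂z_j∂z̄_k X_j conj(Y_k), where X, Y are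
(1,0)-vectors given by their coefficient tuples. -/
def levi (n : ℕ) (ρ : Pt n → ℝ) (z : Pt n) (X Y : Fin n → ℂ) : ℂ :=
  ∑ j, ∑ k, dZ n (fun w => dZb n (cR n ρ) k w) j z * X j * (starRingEnd ℂ) (Y k)

/-- Holomorphic tangent space T^{1,0}_p(∂Ω) (for boundary points p), described via a defining
function: (1,0)-vectors X with Σ_j X_j ∂ρ/∂z_j(p) = 0. -/
def T10 (n : ℕ) (ρ : Pt n → ℝ) (p : Pt n) : Set (Fin n → ℂ) :=
  {X | ∑ j, X j * dZ n (cR n ρ) j p = 0}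

/-- Null space of the Levi form inside T^{1,0}_p(∂Ω). -/
def nullSp (n : ℕ) (ρ : Pt n → ℝ) (p : Pt n) : Set (Fin n → ℂ) :=
  {X | X ∈ T10 n ρ p ∧ ∀ Y ∈ T10 n ρ p, levi n ρ p X Y = 0}

/-- ρ is a C^s defining function of Ω on the neighborhood V of the closure of Ω. -/
def IsDefining (n : ℕ) (s : ℕ∞) (Ω : Set (Pt n)) (ρ : Pt n → ℝ) (V : Set (Pt n)) : Prop :=
  IsOpen V ∧ closure Ω ⊆ V ∧ ContDiffOn ℝ s ρ V ∧
    Ω = {z | z ∈ V ∧ ρ z < 0} ∧ ∀ z ∈ frontier Ω, fderiv ℝ ρ z ≠ 0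

/-- Strict plurisubharmonicity on a set, via positivity of the Levi form. -/
def StrictPSHOn (n : ℕ) (f : Pt n → ℝ) (s : Set (Pt n)) : Prop :=
  ∀ z ∈ s, ∀ X : Fin n → ℂ, X ≠ 0 → 0 < (levi n f z X X).re

/-- Diederich–Fornaess exponent of a defining function ρ (0 if the defining set is empty). -/
def DFexp (n : ℕ) (ρ : Pt n → ℝ) (Ω : Set (Pt n)) : ℝ :=
  sSup {η : ℝ | 0 < η ∧ η < 1 ∧ StrictPSHOn n (fun z => -((-ρ z) ^ η)) Ω}

/-- Diederich–Fornaess index of Ω: supremum over all (C¹) defining functions. -/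
def DFindex (n : ℕ) (Ω : Set (Pt n)) : ℝ :=
  sSup {e : ℝ | ∃ ρ V, IsDefining n 1 Ω ρ V ∧ e = DFexp n ρ Ω}

/-- Steinness exponent of a defining function ρ (⊤ = ∞ if the defining set is empty). -/
def Sexp (n : ℕ) (ρ : Pt n → ℝ) (Ω : Set (Pt n)) : EReal :=
  sInf {e : EReal | ∃ η : ℝ, 1 < η ∧
    (∃ U : Set (Pt n), IsOpen U ∧ frontier Ω ⊆ U ∧
      StrictPSHOn n (fun z => ρ z ^ η) ((closure Ω)ᶜ ∩ U)) ∧ e = (η : EReal)}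

/-- Steinness index of Ω: infimum over all (C¹) defining functions. -/
def Sindex (n : ℕ) (Ω : Set (Pt n)) : EReal :=
  sInf {e : EReal | ∃ ρ V, IsDefining n 1 Ω ρ V ∧ e = Sexp n ρ Ω}

/-- A complex vector field Σ_j a_j ∂/∂z_j + Σ_j b_j ∂/∂z̄_j on ℂⁿ, recorded by its
coefficient functions. -/
structure VF (n : ℕ) where
  a : Pt n → Fin n → ℂ
  b : Pt n → Fin n → ℂ

/-- Action of a complex vector field on a function. -/
def VF.app {n : ℕ} (V : VF n) (f : Pt n → ℂ) (z : Pt n) : ℂ :=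
  ∑ j, V.a z j * dZ n f j z + ∑ j, V.b z j * dZb n f j z

/-- The value of a vector field at a point, as a pair ((1,0)-part, (0,1)-part). -/
def VF.atPt {n : ℕ} (V : VF n) (p : Pt n) : (Fin n → ℂ) × (Fin n → ℂ) := (V.a p, V.b p)

/-- A complex 1-form Σ_j w_j dz_j + Σ_j t_j dz̄_j on ℂⁿ. -/
structure Form1 (n : ℕ) where
  w : Pt n → Fin n → ℂ
  t : Pt n → Fin n → ℂ

/-- Value of a 1-form at a point on a complex tangent vector (pair of (1,0) and (0,1) parts). -/
def Form1.eval {n : ℕ} (η : Form1 n) (z : Pt n) (X : (Fin n → ℂ) × (Fin n → ℂ)) : ℂ :=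
  ∑ j, η.w z j * X.1 j + ∑ j, η.t z j * X.2 j

/-- Pairing of a 1-form with a vector field. -/
def Form1.app {n : ℕ} (η : Form1 n) (V : VF n) (z : Pt n) : ℂ :=
  η.eval z (V.atPt z)

/-- Lie bracket of complex vector fields. -/
def VF.bracket {n : ℕ} (V W : VF n) : VF n :=
  ⟨fun z j => V.app (fun w => W.a w j) z - W.app (fun w => V.a w j) z,
   fun z j => V.app (fun w => W.b w j) z - W.app (fun w => V.b w j) z⟩

/-- Levi-Civita covariant derivative ∇_V W of the Euclidean metric (componentwise derivative). -/
def covD {n : ℕ} (V W : VF n) : VF n :=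
  ⟨fun z j => V.app (fun w => W.a w j) z, fun z j => V.app (fun w => W.b w j) z⟩

/-- Lie derivative of a 1-form along a vector field, in coordinates. -/
def lieD {n : ℕ} (T : VF n) (η : Form1 n) : Form1 n :=
  ⟨fun z j => T.app (fun w => η.w w j) z + ∑ m, η.w z m * dZ n (fun w => T.a w m) j z
      + ∑ m, η.t z m * dZ n (fun w => T.b w m) j z,
   fun z j => T.app (fun w => η.t w j) z + ∑ m, η.w z m * dZb n (fun w => T.a w m) j z
      + ∑ m, η.t z m * dZb n (fun w => T.b w m) j z⟩

/-- Negation of a 1-form. -/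
def Form1.neg {n : ℕ} (η : Form1 n) : Form1 n := ⟨fun z j => -η.w z j, fun z j => -η.t z j⟩

/-- Σ_j |∂ρ/∂z_j|². -/
def gradSq (n : ℕ) (ρ : Pt n → ℝ) (z : Pt n) : ℝ :=
  ∑ j, Complex.normSq (dZ n (cR n ρ) j z)

/-- Norm of the real gradient of ρ: ‖∇ρ‖ = 2 (Σ_j |∂ρ/∂z_j|²)^{1/2}. -/
def gradNorm (n : ℕ) (ρ : Pt n → ℝ) (z : Pt n) : ℝ := 2 * Real.sqrt (gradSq n ρ z)

/-- The (1,0) field L_n = (Σ|∂ρ/∂z_j|²)⁻¹ Σ_j (∂ρ/∂z̄_j) ∂/∂z_j. -/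
def LnVF (n : ℕ) (ρ : Pt n → ℝ) : VF n :=
  ⟨fun z j => dZb n (cR n ρ) j z / (gradSq n ρ z : ℂ), fun _ _ => 0⟩

/-- The (1,0) field N = (Σ|∂ρ/∂z_j|²)^{-1/2} Σ_j (∂ρ/∂z̄_j) ∂/∂z_j. -/
def NVF (n : ℕ) (ρ : Pt n → ℝ) : VF n :=
  ⟨fun z j => dZb n (cR n ρ) j z / ((Real.sqrt (gradSq n ρ z) : ℝ) : ℂ), fun _ _ => 0⟩

/-- T = L_n − conj(L_n). -/
def TVF (n : ℕ) (ρ : Pt n → ℝ) : VF n :=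
  ⟨fun z j => (LnVF n ρ).a z j, fun z j => -(starRingEnd ℂ) ((LnVF n ρ).a z j)⟩

/-- η = (1/2)(∂ρ − ∂̄ρ). -/
def etaF (n : ℕ) (ρ : Pt n → ℝ) : Form1 n :=
  ⟨fun z j => (1 / 2 : ℂ) * dZ n (cR n ρ) j z,
   fun z j => -(1 / 2 : ℂ) * dZb n (cR n ρ) j z⟩

/-- The D'Angelo 1-form α_ρ = −Lie_T η of a defining function ρ. -/
def dAngelo (n : ℕ) (ρ : Pt n → ℝ) : Form1 n := Form1.neg (lieD (TVF n ρ) (etaF n ρ))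

/-- Evaluation of the (1,0)-part ∂η of the exterior derivative of a 1-form on two
complex tangent vectors. -/
def delEval {n : ℕ} (η : Form1 n) (X Y : (Fin n → ℂ) × (Fin n → ℂ)) (z : Pt n) : ℂ :=
  (∑ m, ∑ l, dZ n (fun w => η.w w l) m z * (X.1 m * Y.1 l - Y.1 m * X.1 l)) +
  (∑ m, ∑ l, dZ n (fun w => η.t w l) m z * (X.1 m * Y.2 l - Y.1 m * X.2 l))

/-- Evaluation of ∂̄η of a 1-form η on two complex tangent vectors. -/
def delbEval {n : ℕ} (η : Form1 n) (X Y : (Fin n → ℂ) × (Fin n → ℂ)) (z : Pt n) : ℂ :=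
  (∑ m, ∑ l, dZb n (fun w => η.w w l) m z * (X.2 m * Y.1 l - Y.2 m * X.1 l)) +
  (∑ m, ∑ l, dZb n (fun w => η.t w l) m z * (X.2 m * Y.2 l - Y.2 m * X.2 l))

/-- Evaluation of dη = ∂η + ∂̄η. -/
def dEval {n : ℕ} (η : Form1 n) (X Y : (Fin n → ℂ) × (Fin n → ℂ)) (z : Pt n) : ℂ :=
  delEval η X Y z + delbEval η X Y z

/-- Evaluation of d^c η = i(∂̄ − ∂)η. -/
def dcEval {n : ℕ} (η : Form1 n) (X Y : (Fin n → ℂ) × (Fin n → ℂ)) (z : Pt n) : ℂ :=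
  Complex.I * (delbEval η X Y z - delEval η X Y z)

/-- Evaluation of ω ∧ ω̄ on two complex tangent vectors, where ω = π_{1,0} η is the
(1,0)-component of the real 1-form η. -/
def omegaWedge {n : ℕ} (η : Form1 n) (X Y : (Fin n → ℂ) × (Fin n → ℂ)) (z : Pt n) : ℂ :=
  (∑ j, η.w z j * X.1 j) * (∑ j, (starRingEnd ℂ) (η.w z j) * Y.2 j) -
  (∑ j, η.w z j * Y.1 j) * (∑ j, (starRingEnd ℂ) (η.w z j) * X.2 j)

/-- Evaluation of ∂̄ω where ω = π_{1,0} η. -/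
def delbOmega {n : ℕ} (η : Form1 n) (X Y : (Fin n → ℂ) × (Fin n → ℂ)) (z : Pt n) : ℂ :=
  delbEval ⟨η.w, fun _ _ => 0⟩ X Y z

/-- The standard Euclidean complex Hermitian metric g on complexified tangent vectors
(so that g(∂/∂z_j, ∂/∂z_j) = 1/2). -/
def gMet {n : ℕ} (X Y : (Fin n → ℂ) × (Fin n → ℂ)) : ℂ :=
  (1 / 2 : ℂ) * (∑ j, X.1 j * (starRingEnd ℂ) (Y.1 j) + ∑ j, X.2 j * (starRingEnd ℂ) (Y.2 j))

/-- The real gradient ∇ρ as a complex vector field: 2Σ_j (∂ρ/∂z̄_j ∂/∂z_j + ∂ρ/∂z_j ∂/∂z̄_j). -/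
def gradVF (n : ℕ) (ρ : Pt n → ℝ) : VF n :=
  ⟨fun z j => 2 * dZb n (cR n ρ) j z, fun z j => 2 * dZ n (cR n ρ) j z⟩

/-- Pseudoconvexity of Ω (w.r.t. the defining function ρ): the Levi form is positive
semidefinite on the holomorphic tangent spaces of the boundary. -/
def LeviPseudoconvex (n : ℕ) (ρ : Pt n → ℝ) (Ω : Set (Pt n)) : Prop :=
  ∀ p ∈ frontier Ω, ∀ X ∈ T10 n ρ p, 0 ≤ (levi n ρ p X X).re

/-- The set Σ of weakly pseudoconvex boundary points. -/
def weakPts (n : ℕ) (ρ : Pt n → ℝ) (Ω : Set (Pt n)) : Set (Pt n) :=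
  {p | p ∈ frontier Ω ∧ ∃ X ∈ T10 n ρ p, X ≠ 0 ∧ levi n ρ p X X = 0}

/-- Action of a complex tangent vector at p on a function. -/
def vecApp (n : ℕ) (X : (Fin n → ℂ) × (Fin n → ℂ)) (f : Pt n → ℂ) (p : Pt n) : ℂ :=
  ∑ j, X.1 j * dZ n f j p + ∑ j, X.2 j * dZb n f j p

/-- Pushforward (complexified differential) of a complex tangent vector at p by a map f. -/
def push (n : ℕ) (f : Pt n → Pt n) (p : Pt n) (X : (Fin n → ℂ) × (Fin n → ℂ)) :
    (Fin n → ℂ) × (Fin n → ℂ) :=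
  (fun l => vecApp n X (fun w => f w l) p,
   fun l => vecApp n X (fun w => (starRingEnd ℂ) (f w l)) p)

/-- Conjugation of a coefficient tuple. -/
def conjVec {n : ℕ} (X : Fin n → ℂ) : Fin n → ℂ := fun j => (starRingEnd ℂ) (X j)

/-- A C^k CR-diffeomorphism between ∂Ω₁ and ∂Ω₂, presented by a C^k map f on a
neighborhood U₁ of ∂Ω₁ together with a C^k local inverse g: f maps ∂Ω₁ onto ∂Ω₂
diffeomorphically and its differential maps T^{1,0}(∂Ω₁) into T^{1,0}(∂Ω₂). -/
def IsCRDiffeo (n : ℕ) (k : ℕ∞) (Ω₁ Ω₂ : Set (Pt n)) (ρ₁ ρ₂ : Pt n → ℝ)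
    (f g : Pt n → Pt n) (U₁ U₂ : Set (Pt n)) : Prop :=
  IsOpen U₁ ∧ IsOpen U₂ ∧ frontier Ω₁ ⊆ U₁ ∧ frontier Ω₂ ⊆ U₂ ∧
  (∀ l, ContDiffOn ℝ k (fun z => f z l) U₁) ∧
  (∀ l, ContDiffOn ℝ k (fun z => g z l) U₂) ∧
  f '' frontier Ω₁ = frontier Ω₂ ∧
  (∀ p ∈ frontier Ω₁, g (f p) = p) ∧ (∀ q ∈ frontier Ω₂, f (g q) = q) ∧
  (∀ p ∈ frontier Ω₁, ∀ L ∈ T10 n ρ₁ p,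
    (push n f p (L, 0)).2 = 0 ∧ (push n f p (L, 0)).1 ∈ T10 n ρ₂ (f p))

/-- The 1-form d^c ψ = i(∂̄ψ − ∂ψ) of a real function ψ. -/
def dcForm (n : ℕ) (ψ : Pt n → ℝ) : Form1 n :=
  ⟨fun z j => -Complex.I * dZ n (cR n ψ) j z, fun z j => Complex.I * dZb n (cR n ψ) j z⟩

end

section

open MeasureTheory Filter Topology Set

/-! ### The Cauchy–Pompeiu formula for compactly supported Lipschitz functions -/

/-- The derivative of a compactly supported Lipschitz function has vanishing integral. -/
theorem integral_fderiv_apply_eq_zero {h : ℂ → ℂ} {C : NNReal} (hL : LipschitzWith C h)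
    (hc : HasCompactSupport h) (v : ℂ) : ∫ ζ, fderiv ℝ h ζ v = 0 := by
  obtain ⟨R, hR⟩ := hc.isCompact.isBounded.subset_closedBall (0 : ℂ)
  have key := hasDerivAt_integral_of_dominated_loc_of_lip (μ := (volume : Measure ℂ)) (𝕜 := ℝ)
    (F := fun t ζ => h (ζ + t • v)) (x₀ := (0 : ℝ)) (s := Metric.ball 0 1)
    (F' := fun ζ => fderiv ℝ h ζ v)
    (bound := (Metric.closedBall (0 : ℂ) (R + ‖v‖)).indicator fun _ => (C * ‖v‖ : ℝ))
    (Metric.ball_mem_nhds _ one_pos) ?_ ?_ ?_ ?_ ?_ ?_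
  · have h2 := key.2
    have : (fun t : ℝ => ∫ ζ, h (ζ + t • v)) = fun _ => ∫ ζ, h ζ := by
      funext t
      exact integral_add_right_eq_self h (t • v)
    rw [this] at h2
    exact h2.unique (hasDerivAt_const _ _)
  · exact Eventually.of_forall fun t =>
      (hL.continuous.comp (by fun_prop)).aestronglyMeasurable
  · simpa using hL.continuous.integrable_of_hasCompactSupport hc
  · exact (measurable_fderiv_apply_const ℝ h v).aestronglyMeasurable
  · refine Eventually.of_forall fun ζ => LipschitzOnWith.of_dist_le_mul fun s hs t ht => ?_
    by_cases hζ : ζ ∈ Metric.closedBall (0 : ℂ) (R + ‖v‖)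
    · rw [indicator_of_mem hζ]
      have := hL.dist_le_mul (ζ + s • v) (ζ + t • v)
      have e : dist (ζ + s • v) (ζ + t • v) = ‖v‖ * dist s t := by
        rw [dist_add_left, dist_eq_norm, ← sub_smul, norm_smul, dist_eq_norm, mul_comm]
      rw [e] at this
      rw [Real.coe_nnabs, abs_of_nonneg (by positivity)]
      linarith
    · have z : ∀ s ∈ Metric.ball (0 : ℝ) 1, h (ζ + s • v) = 0 := by
        intro s hs
        by_contra hne
        have h1 := hR (subset_tsupport _ hne)
        simp only [Metric.mem_closedBall, dist_zero_right, Metric.mem_ball, Real.norm_eq_abs]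
          at h1 hs hζ
        apply hζ
        calc ‖ζ‖ = ‖(ζ + s • v) - s • v‖ := by simp
          _ ≤ ‖ζ + s • v‖ + ‖s • v‖ := norm_sub_le _ _
          _ ≤ R + ‖v‖ := by
            rw [norm_smul, Real.norm_eq_abs]
            nlinarith [norm_nonneg v]
      simp only [z s hs, z t ht, dist_self]
      positivity
  · refine (integrable_indicator_iff Metric.isClosed_closedBall.measurableSet).2 ?_
    exact integrableOn_const measure_closedBall_lt_top.ne enorm_ne_top
  · filter_upwards [hL.ae_differentiableAt (μ := volume)] with ζ hζ
    have h1 : HasFDerivAt h (fderiv ℝ h ζ) (ζ + (0 : ℝ) • v) := by simpa using hζ.hasFDerivAt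
    have h2 : HasDerivAt (fun t : ℝ => ζ + t • v) v 0 := by
      simpa using ((hasDerivAt_id (0 : ℝ)).smul_const v).const_add ζ
    exact h1.comp_hasDerivAt (0 : ℝ) h2

/-- The total mass of `(1 + |w|²)⁻²` on `ℂ`. -/
noncomputable def bubbleMass : ℝ := ∫ w : ℂ, ((1 + ‖w‖ ^ 2) ^ 2)⁻¹

theorem integrable_bubble : Integrable fun w : ℂ => ((1 + ‖w‖ ^ 2) ^ 2)⁻¹ := by
  have := integrable_rpow_neg_one_add_norm_sq (E := ℂ) (μ := volume) (r := 4)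
    (by rw [Complex.finrank_real_complex]; norm_num)
  refine this.congr (Eventually.of_forall fun w => ?_)
  simp only
  rw [show (-4 / 2 : ℝ) = -((2 : ℕ) : ℝ) by norm_num, Real.rpow_neg (by positivity),
    Real.rpow_natCast]

theorem bubbleMass_pos : 0 < bubbleMass := by
  rw [bubbleMass, integral_pos_iff_support_of_nonneg (fun w => by positivity) integrable_bubble]
  have : (Function.support fun w : ℂ => ((1 + ‖w‖ ^ 2) ^ 2)⁻¹) = univ := by
    ext w
    simp only [Function.mem_support, mem_univ, iff_true]
    positivity
  rw [this]
  simp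

/-- A smooth regularisation of the Cauchy kernel `1 / ζ`. -/
noncomputable def regKernel (ε : ℝ) (ζ : ℂ) : ℂ :=
  (starRingEnd ℂ) ζ * ((‖ζ‖ ^ 2 + ε : ℝ) : ℂ)⁻¹

theorem regKernel_lipschitz {ε : ℝ} (hε : 0 < ε) :
    LipschitzWith (Real.toNNReal (1 / ε)) (regKernel ε) := by
  refine LipschitzWith.of_dist_le_mul fun x y => ?_
  rw [Real.coe_toNNReal _ (by positivity), dist_eq_norm, dist_eq_norm]
  have hx : (0 : ℝ) < ‖x‖ ^ 2 + ε := by positivity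
  have hy : (0 : ℝ) < ‖y‖ ^ 2 + ε := by positivity
  have hx' : ((‖x‖ ^ 2 + ε : ℝ) : ℂ) ≠ 0 := by exact_mod_cast hx.ne'
  have hy' : ((‖y‖ ^ 2 + ε : ℝ) : ℂ) ≠ 0 := by exact_mod_cast hy.ne'
  have cx : (starRingEnd ℂ) x * x = ((‖x‖ ^ 2 : ℝ) : ℂ) := by
    rw [mul_comm, Complex.mul_conj, Complex.normSq_eq_norm_sq]
  have cy : (starRingEnd ℂ) y * y = ((‖y‖ ^ 2 : ℝ) : ℂ) := by
    rw [mul_comm, Complex.mul_conj, Complex.normSq_eq_norm_sq]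
  have e : regKernel ε x - regKernel ε y =
      (ε * (starRingEnd ℂ) (x - y) + (starRingEnd ℂ) x * (starRingEnd ℂ) y * (y - x)) *
        (((‖x‖ ^ 2 + ε : ℝ) : ℂ)⁻¹ * ((‖y‖ ^ 2 + ε : ℝ) : ℂ)⁻¹) := by
    unfold regKernel
    field_simp
    push_cast at cx cy ⊢
    rw [← cx, ← cy, map_sub]
    ring
  rw [e, norm_mul, norm_mul, norm_inv, norm_inv, Complex.norm_real, Complex.norm_real,
    Real.norm_of_nonneg hx.le, Real.norm_of_nonneg hy.le, ← mul_inv, ← div_eq_mul_inv,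
    div_le_iff₀ (by positivity)]
  have n1 : ‖(ε * (starRingEnd ℂ) (x - y) + (starRingEnd ℂ) x * (starRingEnd ℂ) y * (y - x) : ℂ)‖
      ≤ (ε + ‖x‖ * ‖y‖) * ‖x - y‖ := by
    refine (norm_add_le _ _).trans_eq ?_
    rw [norm_mul, norm_mul, norm_mul, RCLike.norm_conj, RCLike.norm_conj, RCLike.norm_conj,
      Complex.norm_real, Real.norm_of_nonneg hε.le, norm_sub_rev y x]
    ring
  refine n1.trans ?_
  have n2 : ε + ‖x‖ * ‖y‖ ≤ 1 / ε * ((‖x‖ ^ 2 + ε) * (‖y‖ ^ 2 + ε)) := by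
    rw [one_div, inv_mul_eq_div, le_div_iff₀ hε]
    nlinarith [sq_nonneg (‖x‖ - ‖y‖), norm_nonneg x, norm_nonneg y,
      sq_nonneg (‖x‖ * ‖y‖), mul_nonneg hε.le (mul_nonneg (norm_nonneg x) (norm_nonneg y)),
      mul_nonneg hε.le (sq_nonneg (‖x‖ - ‖y‖)), mul_nonneg hε.le (sq_nonneg (‖x‖)),
      mul_nonneg hε.le (sq_nonneg (‖y‖))]
  calc (ε + ‖x‖ * ‖y‖) * ‖x - y‖ ≤ (1 / ε * ((‖x‖ ^ 2 + ε) * (‖y‖ ^ 2 + ε))) * ‖x - y‖ := by gcongr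
    _ = _ := by ring

theorem regKernel_norm_le {ε : ℝ} (hε : 0 < ε) (ζ : ℂ) : ‖regKernel ε ζ‖ ≤ ‖ζ‖⁻¹ := by
  unfold regKernel
  have h : (0 : ℝ) < ‖ζ‖ ^ 2 + ε := by positivity
  rw [norm_mul, RCLike.norm_conj, norm_inv, Complex.norm_real, Real.norm_of_nonneg h.le]
  rcases eq_or_ne ζ 0 with rfl | hz
  · simp
  · have : 0 < ‖ζ‖ := norm_pos_iff.2 hz
    rw [← div_eq_mul_inv, div_le_iff₀ h, inv_mul_eq_div, le_div_iff₀ this]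
    nlinarith

theorem regKernel_norm_le_const {ε : ℝ} (hε : 0 < ε) (ζ : ℂ) : ‖regKernel ε ζ‖ ≤ 1 + 1 / ε := by
  have h1 := regKernel_norm_le hε ζ
  by_cases hz : 1 ≤ ‖ζ‖
  · have : ‖ζ‖⁻¹ ≤ 1 := inv_le_one_of_one_le₀ hz
    have : 0 < 1 / ε := by positivity
    linarith
  · have := (regKernel_lipschitz hε).dist_le_mul ζ 0
    rw [Real.coe_toNNReal _ (by positivity)] at this
    simp only [regKernel, dist_eq_norm, map_zero, zero_mul, sub_zero] at this ⊢
    have : 0 < 1 / ε := by positivity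
    nlinarith [norm_nonneg ζ]

theorem tendsto_regKernel {e : ℕ → ℝ} (he : Tendsto e atTop (𝓝 0)) (ζ : ℂ) :
    Tendsto (fun m => regKernel (e m) ζ) atTop (𝓝 ζ⁻¹) := by
  rcases eq_or_ne ζ 0 with rfl | hz
  · simp [regKernel]
  · have h0 : ((‖ζ‖ ^ 2 + 0 : ℝ) : ℂ) ≠ 0 := by
      have := norm_pos_iff.2 hz
      exact_mod_cast (by positivity : (‖ζ‖ ^ 2 + 0 : ℝ) ≠ 0)
    have : ζ⁻¹ = (starRingEnd ℂ) ζ * ((‖ζ‖ ^ 2 + 0 : ℝ) : ℂ)⁻¹ := by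
      rw [Complex.inv_def, add_zero, Complex.normSq_eq_norm_sq]
      push_cast; rfl
    rw [this]
    refine Tendsto.const_mul _ (Tendsto.inv₀ ?_ h0)
    exact (Complex.continuous_ofReal.tendsto _).comp (tendsto_const_nhds.add he)

theorem regKernel_dbar {ε : ℝ} (hε : 0 < ε) (ζ : ℂ) :
    fderiv ℝ (regKernel ε) ζ 1 + I * fderiv ℝ (regKernel ε) ζ I =
      ((2 * ε * ((‖ζ‖ ^ 2 + ε) ^ 2)⁻¹ : ℝ) : ℂ) := by
  have h : (0 : ℝ) < ‖ζ‖ ^ 2 + ε := by positivity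
  have h' : ((‖ζ‖ ^ 2 + ε : ℝ) : ℂ) ≠ 0 := by exact_mod_cast h.ne'
  have d1 : HasFDerivAt (fun ζ : ℂ => (starRingEnd ℂ) ζ)
      (Complex.conjCLE : ℂ →L[ℝ] ℂ) ζ := Complex.conjCLE.hasFDerivAt
  have d2 : HasFDerivAt (fun ζ : ℂ => ((‖ζ‖ ^ 2 + ε : ℝ) : ℂ))
      (Complex.ofRealCLM.comp ((2 : ℝ) • innerSL ℝ ζ)) ζ := by
    refine Complex.ofRealCLM.hasFDerivAt.comp ζ ?_
    have := (hasStrictFDerivAt_norm_sq (F := ℂ) ζ).hasFDerivAt.add_const ε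
    rwa [← ofNat_smul_eq_nsmul ℝ 2 (innerSL ℝ ζ)] at this
  have d2' : HasFDerivAt (fun ζ : ℂ => ((‖ζ‖ ^ 2 + ε : ℝ) : ℂ)⁻¹) _ ζ :=
    HasFDerivAt.comp ζ ((hasDerivAt_inv h').hasFDerivAt.restrictScalars ℝ) d2
  have d3 := d1.mul d2'
  have d4 : fderiv ℝ (regKernel ε) ζ = _ := HasFDerivAt.fderiv d3
  have cz : ζ * (starRingEnd ℂ) ζ = ((‖ζ‖ ^ 2 : ℝ) : ℂ) := by
    rw [Complex.mul_conj, Complex.normSq_eq_norm_sq]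
  rw [d4]
  have r : ((inner ℝ ζ 1 : ℝ) : ℂ) + I * ((inner ℝ ζ I : ℝ) : ℂ) = ζ := by
    rw [Complex.inner, Complex.inner]
    apply Complex.ext <;> simp
  simp only [add_apply, smul_apply,
    ContinuousLinearMap.comp_apply, innerSL_apply_apply, Complex.ofRealCLM_apply,
    ContinuousLinearMap.coe_restrictScalars', ContinuousLinearMap.toSpanSingleton_apply,
    smul_eq_mul, ContinuousLinearEquiv.coe_coe, Complex.conjCLE_apply, map_one, Complex.conj_I]
  push_cast at h' cz ⊢
  have hh : ∀ a b : ℂ, a + I * b = ζ →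
      (starRingEnd ℂ) ζ * (2 * a * -(((‖ζ‖ : ℂ) ^ 2 + ε) ^ 2)⁻¹) + ((‖ζ‖ : ℂ) ^ 2 + ε)⁻¹ * 1 +
        I * ((starRingEnd ℂ) ζ * (2 * b * -(((‖ζ‖ : ℂ) ^ 2 + ε) ^ 2)⁻¹) +
          ((‖ζ‖ : ℂ) ^ 2 + ε)⁻¹ * -I) = 2 * ε * (((‖ζ‖ : ℂ) ^ 2 + ε) ^ 2)⁻¹ := by
    intro a b hab
    field_simp
    linear_combination (-2 * (starRingEnd ℂ) ζ) * hab - 2 * cz - (((‖ζ‖ : ℂ) ^ 2 + ε)) * I_sq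
  exact hh _ _ r

theorem integrable_norm_inv_ball (M : ℝ) :
    Integrable ((Metric.closedBall (0 : ℂ) M).indicator fun ζ => ‖ζ‖⁻¹) := by
  have := (integrable_fun_norm_addHaar (E := ℂ) volume (f := (Iic M).indicator fun r : ℝ => r⁻¹)).2
    ?_
  · convert this using 1
    funext ζ
    simp [indicator]
  · rw [Complex.finrank_real_complex]
    have : IntegrableOn ((Iic M).indicator fun _ : ℝ => (1 : ℝ)) (Ioi 0) := by
      rw [integrableOn_indicator_iff measurableSet_Iic]
      exact integrableOn_const (by
        rw [inter_comm, Ioi_inter_Iic]; exact measure_Ioc_lt_top.ne) enorm_ne_top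
    refine this.congr_fun (fun r hr => ?_) measurableSet_Ioi
    have : r ≠ 0 := (mem_Ioi.1 hr).ne'
    by_cases h : r ≤ M <;> simp [indicator, h, this]

theorem regKernel_differentiable {ε : ℝ} (hε : 0 < ε) : Differentiable ℝ (regKernel ε) := by
  intro ζ
  have h : (0 : ℝ) < ‖ζ‖ ^ 2 + ε := by positivity
  have h' : ((‖ζ‖ ^ 2 + ε : ℝ) : ℂ) ≠ 0 := by exact_mod_cast h.ne'
  refine DifferentiableAt.mul Complex.conjCLE.differentiableAt (DifferentiableAt.inv ?_ h')
  exact Complex.ofRealCLM.differentiableAt.comp ζ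
    ((differentiableAt_id.norm_sq ℝ).add_const ε)

theorem integrable_fderiv_apply {h : ℂ → ℂ} {C : NNReal} (hL : LipschitzWith C h)
    (hc : HasCompactSupport h) (v : ℂ) : Integrable fun ζ => fderiv ℝ h ζ v := by
  have hm := (measurable_fderiv_apply_const ℝ h v).aestronglyMeasurable (μ := volume)
  have hb : Integrable ((tsupport h).indicator fun _ : ℂ => (C * ‖v‖ : ℝ)) :=
    (integrable_indicator_iff hc.isCompact.measurableSet).2
      (integrableOn_const hc.isCompact.measure_lt_top.ne enorm_ne_top)
  refine hb.mono' hm (Eventually.of_forall fun ζ => ?_)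
  by_cases hζ : ζ ∈ tsupport h
  · rw [indicator_of_mem hζ]
    exact (ContinuousLinearMap.le_opNorm _ _).trans
      (by gcongr; exact norm_fderiv_le_of_lipschitz ℝ hL)
  · rw [indicator_of_notMem hζ, fderiv_of_notMem_tsupport ℝ hζ]
    simp

theorem integral_dbar_mul_regKernel {g : ℂ → ℂ} {C : NNReal} (hL : LipschitzWith C g)
    (hc : HasCompactSupport g) {ε : ℝ} (hε : 0 < ε) :
    ∫ ζ, (fderiv ℝ g ζ 1 + I * fderiv ℝ g ζ I) * regKernel ε ζ =
      -∫ ζ, g ζ * ((2 * ε * ((‖ζ‖ ^ 2 + ε) ^ 2)⁻¹ : ℝ) : ℂ) := by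
  obtain ⟨B, hB⟩ := hc.exists_bound_of_continuous hL.continuous
  have hB0 : 0 ≤ B := (norm_nonneg _).trans (hB 0)
  set k := regKernel ε with hk
  have hkc : Continuous k := (regKernel_lipschitz hε).continuous
  have hLip : LipschitzWith (Real.toNNReal (B * (1 / ε) + C * (1 + 1 / ε))) (fun ζ => g ζ * k ζ) := by
    refine LipschitzWith.of_dist_le_mul fun x y => ?_
    rw [Real.coe_toNNReal _ (by positivity)]
    have h1 := hL.dist_le_mul x y
    have h2 := (regKernel_lipschitz hε).dist_le_mul x y
    rw [Real.coe_toNNReal _ (by positivity)] at h2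
    have h3 := regKernel_norm_le_const hε y
    rw [dist_eq_norm] at h1 h2 ⊢
    have e : g x * k x - g y * k y = g x * (k x - k y) + (g x - g y) * k y := by ring
    rw [e]
    refine (norm_add_le _ _).trans ?_
    rw [norm_mul, norm_mul, add_mul]
    refine add_le_add ?_ ?_
    · calc ‖g x‖ * ‖k x - k y‖ ≤ B * (1 / ε * dist x y) := by gcongr; exact hB x
        _ = _ := by ring
    · calc ‖g x - g y‖ * ‖k y‖ ≤ (C * dist x y) * (1 + 1 / ε) := by gcongr
        _ = _ := by ring
  have hcs : HasCompactSupport (fun ζ => g ζ * k ζ) := hc.mul_right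
  have i1 := integral_fderiv_apply_eq_zero hLip hcs 1
  have i2 := integral_fderiv_apply_eq_zero hLip hcs I
  have e0 : ∫ ζ, (fderiv ℝ (fun ζ => g ζ * k ζ) ζ 1 + I * fderiv ℝ (fun ζ => g ζ * k ζ) ζ I) = 0 := by
    rw [integral_add (integrable_fderiv_apply hLip hcs 1)
      ((integrable_fderiv_apply hLip hcs I).const_mul I), integral_const_mul, i1, i2]
    simp
  have ig : Integrable fun ζ => g ζ * ((2 * ε * ((‖ζ‖ ^ 2 + ε) ^ 2)⁻¹ : ℝ) : ℂ) := by
    refine Continuous.integrable_of_hasCompactSupport ?_ hc.mul_right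
    refine hL.continuous.mul (Complex.continuous_ofReal.comp ?_)
    refine continuous_const.mul (Continuous.inv₀ (by fun_prop) fun ζ => ?_)
    positivity
  have id1 : Integrable fun ζ => (fderiv ℝ g ζ 1 + I * fderiv ℝ g ζ I) * k ζ :=
    ((integrable_fderiv_apply hL hc 1).add ((integrable_fderiv_apply hL hc I).const_mul I)).mul_bdd
      (c := 1 + 1 / ε) hkc.aestronglyMeasurable
      (Eventually.of_forall fun ζ => regKernel_norm_le_const hε ζ)
  rw [eq_neg_iff_add_eq_zero, ← integral_add id1 ig, ← e0]
  refine integral_congr_ae ?_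
  filter_upwards [hL.ae_differentiableAt (μ := volume)] with ζ hζ
  have hd : fderiv ℝ (fun ζ => g ζ * k ζ) ζ = _ :=
    (hζ.hasFDerivAt.mul (regKernel_differentiable hε ζ).hasFDerivAt).fderiv
  rw [hd, ← regKernel_dbar hε ζ]
  simp only [add_apply, smul_apply, smul_eq_mul]
  ring

/-- Cauchy–Pompeiu formula at the origin. -/
theorem integral_dbar_mul_inv {g : ℂ → ℂ} {C : NNReal} (hL : LipschitzWith C g)
    (hc : HasCompactSupport g) :
    ∫ ζ, (fderiv ℝ g ζ 1 + I * fderiv ℝ g ζ I) * ζ⁻¹ = -(2 * bubbleMass * g 0) := by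
  obtain ⟨B, hB⟩ := hc.exists_bound_of_continuous hL.continuous
  obtain ⟨M, hM⟩ := hc.isCompact.isBounded.subset_closedBall (0 : ℂ)
  let s : ℕ → ℝ := fun m => 1 / ((m : ℝ) + 1)
  have hs : ∀ m, 0 < s m := fun m => by positivity
  have ts : Tendsto s atTop (𝓝 0) := tendsto_one_div_add_atTop_nhds_zero_nat
  have te : Tendsto (fun m => s m ^ 2) atTop (𝓝 0) := by simpa using ts.pow 2
  have L1 : Tendsto (fun m => ∫ ζ, (fderiv ℝ g ζ 1 + I * fderiv ℝ g ζ I) * regKernel (s m ^ 2) ζ)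
      atTop (𝓝 (∫ ζ, (fderiv ℝ g ζ 1 + I * fderiv ℝ g ζ I) * ζ⁻¹)) := by
    refine tendsto_integral_of_dominated_convergence
      (fun ζ => 2 * C * (Metric.closedBall (0 : ℂ) M).indicator (fun ζ => ‖ζ‖⁻¹) ζ) ?_ ?_ ?_ ?_
    · intro m
      refine AEStronglyMeasurable.mul ?_
        (regKernel_lipschitz (pow_pos (hs m) 2)).continuous.aestronglyMeasurable
      exact ((integrable_fderiv_apply hL hc 1).add
        ((integrable_fderiv_apply hL hc I).const_mul I)).aestronglyMeasurable
    · exact (integrable_norm_inv_ball M).const_mul _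
    · refine fun m => Eventually.of_forall fun ζ => ?_
      by_cases hζ : ζ ∈ Metric.closedBall (0 : ℂ) M
      · rw [indicator_of_mem hζ, norm_mul]
        have hn := norm_fderiv_le_of_lipschitz ℝ hL (x₀ := ζ)
        have h1 : ‖fderiv ℝ g ζ 1‖ ≤ C := by
          simpa using (fderiv ℝ g ζ).le_of_opNorm_le hn 1
        have h2 : ‖fderiv ℝ g ζ I‖ ≤ C := by
          simpa using (fderiv ℝ g ζ).le_of_opNorm_le hn I
        have h3 : ‖fderiv ℝ g ζ 1 + I * fderiv ℝ g ζ I‖ ≤ 2 * C := by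
          refine (norm_add_le _ _).trans ?_
          rw [norm_mul, Complex.norm_I]
          linarith
        exact mul_le_mul h3 (regKernel_norm_le (pow_pos (hs m) 2) ζ) (norm_nonneg _) (by positivity)
      · rw [indicator_of_notMem hζ, fderiv_of_notMem_tsupport ℝ (fun h => hζ (hM h))]
        simp
    · exact Eventually.of_forall fun ζ => (tendsto_regKernel te ζ).const_mul _
  have E : ∀ m, ∫ ζ, g ζ * ((2 * s m ^ 2 * ((‖ζ‖ ^ 2 + s m ^ 2) ^ 2)⁻¹ : ℝ) : ℂ) =
      ∫ w, g (s m • w) * ((2 * ((1 + ‖w‖ ^ 2) ^ 2)⁻¹ : ℝ) : ℂ) := by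
    intro m
    have h := Measure.integral_comp_smul (volume : Measure ℂ)
      (fun ζ => g ζ * ((2 * s m ^ 2 * ((‖ζ‖ ^ 2 + s m ^ 2) ^ 2)⁻¹ : ℝ) : ℂ)) (s m)
    rw [Complex.finrank_real_complex, abs_of_pos (inv_pos.2 (pow_pos (hs m) 2)),
      eq_inv_smul_iff₀ (pow_pos (hs m) 2).ne', ← integral_smul] at h
    rw [← h]
    congr 1
    funext w
    have : (2 * s m ^ 2 * ((‖s m • w‖ ^ 2 + s m ^ 2) ^ 2)⁻¹ : ℝ) =
        (s m ^ 2)⁻¹ * (2 * ((1 + ‖w‖ ^ 2) ^ 2)⁻¹) := by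
      rw [norm_smul, Real.norm_of_nonneg (hs m).le]
      have := (hs m).ne'
      have : (1 + ‖w‖ ^ 2) ≠ 0 := by positivity
      have : (s m * ‖w‖) ^ 2 + s m ^ 2 = s m ^ 2 * (1 + ‖w‖ ^ 2) := by ring
      rw [this]
      field_simp
    rw [this, Complex.real_smul]
    have hne : (s m : ℂ) ≠ 0 := by exact_mod_cast (hs m).ne'
    push_cast
    field_simp
  have L2 : Tendsto (fun m => ∫ w, g (s m • w) * ((2 * ((1 + ‖w‖ ^ 2) ^ 2)⁻¹ : ℝ) : ℂ)) atTop
      (𝓝 (∫ w : ℂ, g 0 * ((2 * ((1 + ‖w‖ ^ 2) ^ 2)⁻¹ : ℝ) : ℂ))) := by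
    refine tendsto_integral_of_dominated_convergence
      (fun w => B * (2 * ((1 + ‖w‖ ^ 2) ^ 2)⁻¹)) ?_ ?_ ?_ ?_
    · intro m
      refine AEStronglyMeasurable.mul
        (hL.continuous.comp (by fun_prop)).aestronglyMeasurable ?_
      exact Complex.continuous_ofReal.comp_aestronglyMeasurable
        (integrable_bubble.const_mul 2).aestronglyMeasurable
    · exact (integrable_bubble.const_mul 2).const_mul B
    · refine fun m => Eventually.of_forall fun w => ?_
      rw [norm_mul, Complex.norm_real, Real.norm_of_nonneg (by positivity)]
      gcongr
      exact hB _
    · refine Eventually.of_forall fun w => Tendsto.mul_const _ ?_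
      refine (hL.continuous.tendsto 0).comp ?_
      simpa using ts.smul_const w
  have L3 : (∫ w : ℂ, g 0 * ((2 * ((1 + ‖w‖ ^ 2) ^ 2)⁻¹ : ℝ) : ℂ)) = 2 * bubbleMass * g 0 := by
    rw [integral_const_mul, integral_complex_ofReal, integral_const_mul]
    push_cast [bubbleMass]
    ring
  rw [L3] at L2
  refine tendsto_nhds_unique L1 (L2.neg.congr fun m => ?_)
  rw [integral_dbar_mul_regKernel hL hc (pow_pos (hs m) 2), E m]

/-! ### Solving `∂̄u = 1_Ω ∂̄f` when `∂̄f` vanishes on `∂Ω` -/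

theorem IsPreconnected.exists_mem_frontier {X : Type*} [TopologicalSpace X] {s T : Set X}
    (hs : IsPreconnected s) (h1 : (s ∩ T).Nonempty) (h2 : (s ∩ Tᶜ).Nonempty) :
    ∃ x ∈ s, x ∈ frontier T := by
  by_contra! h
  have hsub : s ⊆ interior T ∪ (closure T)ᶜ := by
    intro x hx
    by_contra hx'
    rw [mem_union, not_or, notMem_compl_iff] at hx'
    exact h x hx ⟨hx'.2, hx'.1⟩
  obtain ⟨x, hx, hxT⟩ := h1
  obtain ⟨y, hy, hyT⟩ := h2
  have hdis : Disjoint (interior T) (closure T)ᶜ :=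
    disjoint_compl_right.mono_left (interior_subset.trans subset_closure)
  have hx' : x ∈ interior T := (hsub hx).resolve_right fun h' => h' (subset_closure hxT)
  have := hs.subset_left_of_subset_union isOpen_interior isClosed_closure.isOpen_compl hdis hsub
    ⟨x, hx, hx'⟩ hy
  exact hyT (interior_subset this)

theorem indicator_eventuallyEq_of_notMem_frontier {E F : Type*} [TopologicalSpace E] [Zero F] {Ω : Set E} (ho : IsOpen Ω) (a : E → F) {z : E}
    (hz : z ∉ frontier Ω) :
    (z ∈ Ω ∧ Ω.indicator a =ᶠ[𝓝 z] a) ∨ (z ∉ Ω ∧ Ω.indicator a =ᶠ[𝓝 z] fun _ => 0) := by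
  by_cases h : z ∈ Ω
  · left
    exact ⟨h, by filter_upwards [ho.mem_nhds h] with w hw using indicator_of_mem hw _⟩
  · right
    have : z ∈ (closure Ω)ᶜ := fun h' => hz ⟨h', by rwa [ho.interior_eq]⟩
    refine ⟨h, ?_⟩
    filter_upwards [isClosed_closure.isOpen_compl.mem_nhds this] with w hw
    exact indicator_of_notMem (fun h => hw (subset_closure h)) _

theorem continuousAt_indicator_of_notMem_frontier {E F : Type*} [TopologicalSpace E]
    [TopologicalSpace F] [Zero F] {Ω : Set E} (ho : IsOpen Ω) {a : E → F}
    (ha : Continuous a) {z : E} (hz : z ∉ frontier Ω) : ContinuousAt (Ω.indicator a) z := by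
  rcases indicator_eventuallyEq_of_notMem_frontier ho a hz with ⟨-, e⟩ | ⟨-, e⟩
  · exact ha.continuousAt.congr e.symm
  · exact continuousAt_const.congr e.symm

section Indicator
variable {E F : Type*} [NormedAddCommGroup E] [NormedSpace ℝ E] [NormedAddCommGroup F]
  [NormedSpace ℝ F]

omit [NormedSpace ℝ F] in
theorem lipschitzWith_indicator {Ω : Set E} {a : E → F} {C : NNReal} (ha : LipschitzWith C a)
    (h0 : ∀ z ∈ frontier Ω, a z = 0) : LipschitzWith C (Ω.indicator a) := by
  have key : ∀ x ∈ Ω, ∀ y ∉ Ω, ‖a x‖ ≤ C * dist x y := by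
    intro x hx y hy
    obtain ⟨w, hw, hwf⟩ := (convex_segment x y).isPreconnected.exists_mem_frontier
      ⟨x, left_mem_segment ℝ x y, hx⟩ ⟨y, right_mem_segment ℝ x y, hy⟩
    have h1 := ha.dist_le_mul x w
    rw [h0 w hwf, dist_zero_right] at h1
    have h2 : dist x w ≤ dist x y := by
      have := dist_add_dist_of_mem_segment hw
      linarith [dist_nonneg (x := w) (y := y)]
    exact h1.trans (by gcongr)
  refine LipschitzWith.of_dist_le_mul fun x y => ?_
  by_cases hx : x ∈ Ω <;> by_cases hy : y ∈ Ω
  · rw [indicator_of_mem hx, indicator_of_mem hy]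
    exact ha.dist_le_mul x y
  · rw [indicator_of_mem hx, indicator_of_notMem hy, dist_zero_right]
    exact key x hx y hy
  · rw [indicator_of_notMem hx, indicator_of_mem hy, dist_zero_left, dist_comm]
    exact key y hy x hx
  · rw [indicator_of_notMem hx, indicator_of_notMem hy, dist_self]
    positivity

theorem hasFDerivAt_indicator {Ω : Set E} (ho : IsOpen Ω) {a : E → F} {a' : E → E →L[ℝ] F}
    (ha : ∀ z, HasFDerivAt a (a' z) z) {z : E} (hz : z ∉ frontier Ω) :
    HasFDerivAt (Ω.indicator a) (Ω.indicator a' z) z := by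
  rcases indicator_eventuallyEq_of_notMem_frontier ho a hz with ⟨h, e⟩ | ⟨h, e⟩
  · rw [indicator_of_mem h]
    exact (ha z).congr_of_eventuallyEq e
  · rw [indicator_of_notMem h]
    exact (hasFDerivAt_const (0 : F) z).congr_of_eventuallyEq e

end Indicator

/-- The hypersurface `{ρ = 0}` is Lebesgue-null where `dρ ≠ 0`. -/
theorem measure_levelSet_eq_zero {E : Type*} [NormedAddCommGroup E] [NormedSpace ℝ E]
    [FiniteDimensional ℝ E] [MeasurableSpace E] [BorelSpace E] (μ : Measure E)
    [μ.IsAddHaarMeasure] {ρ : E → ℝ} {S : Set E} (hS : MeasurableSet S)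
    (h0 : ∀ z ∈ S, ρ z = 0) (hd : ∀ z ∈ S, fderiv ℝ ρ z ≠ 0) : μ S = 0 := by
  rcases subsingleton_or_nontrivial E with hE | hE
  · have : S = ∅ := by
      by_contra h
      obtain ⟨z, hz⟩ := nonempty_iff_ne_empty.2 h
      exact hd z hz (Subsingleton.elim _ _)
    simp [this]
  obtain ⟨e, he⟩ := exists_ne (0 : E)
  have happ : ApproximatesLinearOn (fun z => ρ z • e) (0 : E →L[ℝ] E) S 0 := by
    intro x hx y hy
    simp [h0 x hx, h0 y hy]
  have hdiff : ∀ z ∈ S, DifferentiableAt ℝ ρ z := fun z hz => by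
    by_contra h
    exact hd z hz (fderiv_zero_of_not_differentiableAt h)
  have := happ.norm_fderiv_sub_le μ hS (fun z => (fderiv ℝ ρ z).smulRight e)
    (fun z hz => ((hdiff z hz).hasFDerivAt.smul_const e).hasFDerivWithinAt)
  rw [ae_restrict_iff' hS] at this
  have h2 : ∀ᵐ z ∂μ, z ∉ S := by
    filter_upwards [this] with z hz hzS
    have h3 := hz hzS
    rw [sub_zero, nonpos_iff_eq_zero, nnnorm_eq_zero] at h3
    apply hd z hzS
    ext v
    have := DFunLike.congr_fun h3 v
    simpa [he] using this
  exact measure_eq_zero_iff_ae_notMem.2 h2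

section DbarSolution

variable {n : ℕ}

/-- A ball of directions `v` with `|v i|` bounded below. -/
def dirBall (i : Fin n) : Set (Pt n) := Metric.ball (Pi.single i 1) (1 / 2)

theorem norm_le_of_mem_dirBall {i : Fin n} {v : Pt n} (hv : v ∈ dirBall i) : ‖v‖ ≤ 2 := by
  have h1 : ‖v - Pi.single i 1‖ < 1 / 2 := by simpa [dirBall, dist_eq_norm] using hv
  have h2 : ‖(Pi.single i 1 : Pt n)‖ = 1 := by
    rw [Pi.norm_single, norm_one]
  have := norm_le_norm_add_norm_sub' v (Pi.single i 1)
  linarith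

theorem half_le_of_mem_dirBall {i : Fin n} {v : Pt n} (hv : v ∈ dirBall i) : 1 / 2 ≤ ‖v i‖ := by
  have h1 : ‖v - Pi.single i 1‖ < 1 / 2 := by simpa [dirBall, dist_eq_norm] using hv
  have h2 := norm_le_pi_norm (v - Pi.single i 1) i
  have h3 : (v - Pi.single i 1 : Pt n) i = v i - 1 := by simp
  rw [h3] at h2
  have := norm_le_norm_add_norm_sub' (1 : ℂ) (v i)
  rw [norm_one, norm_sub_rev] at this
  linarith

theorem le_half_of_mem_dirBall {i j : Fin n} (hij : j ≠ i) {v : Pt n} (hv : v ∈ dirBall i) :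
    ‖v j‖ ≤ 1 / 2 := by
  have h1 : ‖v - Pi.single i 1‖ < 1 / 2 := by simpa [dirBall, dist_eq_norm] using hv
  have h2 := norm_le_pi_norm (v - Pi.single i 1) j
  have h3 : (v - Pi.single i 1 : Pt n) j = v j := by simp [hij]
  rw [h3] at h2
  linarith

/-- The product measure on pairs `(ζ, v)` used to average Cauchy transforms. -/
noncomputable def dirMeasure (i : Fin n) : Measure (ℂ × Pt n) :=
  (volume : Measure ℂ).prod ((volume : Measure (Pt n)).restrict (dirBall i))

instance (i : Fin n) : IsFiniteMeasure ((volume : Measure (Pt n)).restrict (dirBall i)) :=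
  ⟨by rw [Measure.restrict_apply_univ]; exact measure_ball_lt_top⟩

theorem ae_dirMeasure_mem (i : Fin n) : ∀ᵐ p ∂dirMeasure i, p.1 ≠ 0 ∧ p.2 ∈ dirBall i := by
  have h1 : ∀ᵐ ζ : ℂ, ζ ≠ 0 := by
    rw [ae_iff]; simp
  have h2 : ∀ᵐ v ∂((volume : Measure (Pt n)).restrict (dirBall i)), v ∈ dirBall i :=
    ae_restrict_mem Metric.isOpen_ball.measurableSet
  exact (Measure.quasiMeasurePreserving_fst.ae h1).and (Measure.quasiMeasurePreserving_snd.ae h2)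

theorem measure_preimage_sub_smul {N : Set (Pt n)} (hN : volume N = 0) (z : Pt n) {ζ : ℂ}
    (hζ : ζ ≠ 0) : volume {v : Pt n | z - ζ • v ∈ N} = 0 := by
  have : {v : Pt n | z - ζ • v ∈ N} ⊆ (fun w => ζ⁻¹ • (z - w)) '' N := by
    intro v hv
    exact ⟨_, hv, by simp [smul_smul, hζ]⟩
  refine measure_mono_null this ?_
  refine addHaar_image_eq_zero_of_differentiableOn_of_addHaar_eq_zero volume ?_ hN
  exact ((differentiable_const z).sub differentiable_id).const_smul ζ⁻¹ |>.differentiableOn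

theorem ae_dirMeasure_notMem {N : Set (Pt n)} (hNc : IsClosed N) (hN : volume N = 0) (i : Fin n)
    (z : Pt n) : ∀ᵐ p ∂dirMeasure i, z - p.1 • p.2 ∉ N := by
  have hm : MeasurableSet {p : ℂ × Pt n | z - p.1 • p.2 ∈ N} :=
    (hNc.preimage (by fun_prop : Continuous fun p : ℂ × Pt n => z - p.1 • p.2)).measurableSet
  rw [ae_iff]
  simp only [not_not]
  rw [dirMeasure, Measure.measure_prod_null hm]
  have h1 : ∀ᵐ ζ : ℂ, ζ ≠ 0 := by
    rw [ae_iff]; simp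
  filter_upwards [h1] with ζ hζ
  exact le_antisymm ((Measure.restrict_apply_le _ _).trans_eq
    (measure_preimage_sub_smul hN z hζ)) zero_le

/-- The averaged Cauchy transform of `A` (a form with values `A z v`). -/
noncomputable def cauchyAvg (i : Fin n) (A : Pt n → Pt n →L[ℝ] ℂ) (z : Pt n) : ℂ :=
  ∫ p, p.1⁻¹ * A (z - p.1 • p.2) p.2 ∂dirMeasure i

theorem apply_sub_smul_eq_zero {G : Type*} [Zero G] {b : Pt n → G} {R : ℝ}
    (hR : ∀ z, R < ‖z‖ → b z = 0) {i : Fin n} {v : Pt n} (hv : v ∈ dirBall i) {z : Pt n} {ζ : ℂ}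
    (hζ : 2 * (‖z i‖ + R) < ‖ζ‖) : b (z - ζ • v) = 0 := by
  apply hR
  have h1 := norm_le_pi_norm (z - ζ • v) i
  have h2 : ‖ζ‖ * ‖v i‖ ≤ ‖z i‖ + ‖(z - ζ • v) i‖ := by
    rw [← norm_mul]
    have : ζ * v i = z i - (z - ζ • v) i := by simp
    rw [this]
    exact norm_sub_le _ _
  have h3 := half_le_of_mem_dirBall hv
  nlinarith [norm_nonneg ζ]

theorem cauchyAvg_eq_zero {A : Pt n → Pt n →L[ℝ] ℂ} {R : ℝ}
    (hR : ∀ z, R < ‖z‖ → A z = 0) {i j : Fin n} (hij : j ≠ i) {z : Pt n}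
    (hz : ‖z i‖ + 2 * R < ‖z j‖) : cauchyAvg i A z = 0 := by
  refine integral_eq_zero_of_ae ?_
  filter_upwards [ae_dirMeasure_mem i] with p hp
  have : A (z - p.1 • p.2) = 0 := by
    by_cases h : 2 * (‖z i‖ + R) < ‖p.1‖
    · exact apply_sub_smul_eq_zero hR hp.2 h
    · apply hR
      have h1 := norm_le_pi_norm (z - p.1 • p.2) j
      have h2 : ‖z j‖ ≤ ‖(z - p.1 • p.2) j‖ + ‖p.1‖ * ‖p.2 j‖ := by
        rw [← norm_mul]
        have : z j = (z - p.1 • p.2) j + p.1 * p.2 j := by simp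
        conv_lhs => rw [this]
        exact norm_add_le _ _
      have h3 := le_half_of_mem_dirBall hij hp.2
      nlinarith [norm_nonneg p.1]
  simp [this]

theorem integrable_kernel_bound (i : Fin n) (K M : ℝ) : Integrable (fun p : ℂ × Pt n =>
    K * (Metric.closedBall (0 : ℂ) M).indicator (fun ζ => ‖ζ‖⁻¹) p.1) (dirMeasure i) :=
  (Integrable.comp_fst (integrable_norm_inv_ball M) _).const_mul K

end DbarSolution

section CauchyAverage

variable {n : ℕ} {Ω : Set (Pt n)} {a : Pt n → Pt n →L[ℝ] ℂ}
  {a' : Pt n → Pt n →L[ℝ] Pt n →L[ℝ] ℂ} {C : NNReal} {R : ℝ}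

/-- The derivative of the averaged Cauchy transform. -/
noncomputable def cauchyAvgDeriv (A' : Pt n → Pt n →L[ℝ] Pt n →L[ℝ] ℂ) (z : Pt n)
    (p : ℂ × Pt n) : Pt n →L[ℝ] ℂ :=
  p.1⁻¹ • (A' (z - p.1 • p.2)).flip p.2

theorem eq_zero_of_hasFDerivAt_of_far (ha : ∀ z, HasFDerivAt a (a' z) z)
    (hR : ∀ z, R < ‖z‖ → a z = 0) {z : Pt n} (hz : R < ‖z‖) : a' z = 0 := by
  refine (ha z).unique ((hasFDerivAt_const (0 : Pt n →L[ℝ] ℂ) z).congr_of_eventuallyEq ?_)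
  filter_upwards [(isOpen_lt continuous_const continuous_norm).mem_nhds hz] with w hw
  exact hR w hw

theorem norm_indicator_deriv_le (ha : ∀ z, HasFDerivAt a (a' z) z) (hL : LipschitzWith C a)
    (z : Pt n) : ‖Ω.indicator a' z‖ ≤ C :=
  (norm_indicator_le_norm_self _ _).trans ((ha z).le_of_lipschitz hL)

theorem aestronglyMeasurable_cauchyAvgDeriv (ho : IsOpen Ω) (ha' : Continuous a') (i : Fin n)
    (z : Pt n) : AEStronglyMeasurable (cauchyAvgDeriv (Ω.indicator a') z) (dirMeasure i) := by
  have h1 : StronglyMeasurable (Ω.indicator a') :=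
    ha'.stronglyMeasurable.indicator ho.measurableSet
  have h2 : StronglyMeasurable fun p : ℂ × Pt n => Ω.indicator a' (z - p.1 • p.2) :=
    h1.comp_measurable (by fun_prop : Continuous fun p : ℂ × Pt n => z - p.1 • p.2).measurable
  have h3 : StronglyMeasurable fun p : ℂ × Pt n => (Ω.indicator a' (z - p.1 • p.2)).flip p.2 :=
    isBoundedBilinearMap_apply.continuous.comp_stronglyMeasurable
      (((ContinuousLinearMap.flipₗᵢ ℝ (Pt n) (Pt n) ℂ).continuous.comp_stronglyMeasurable h2).prodMk
        continuous_snd.stronglyMeasurable)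
  have h4 : StronglyMeasurable fun p : ℂ × Pt n => p.1⁻¹ :=
    (measurable_fst.inv).stronglyMeasurable
  exact (h4.smul h3).aestronglyMeasurable

theorem norm_cauchyAvgDeriv_le (ha : ∀ z, HasFDerivAt a (a' z) z) (hL : LipschitzWith C a)
    (hR : ∀ z, R < ‖z‖ → a z = 0) (i : Fin n) {z₀ z : Pt n} (hz : z ∈ Metric.ball z₀ 1)
    {p : ℂ × Pt n} (hp : p.2 ∈ dirBall i) :
    ‖cauchyAvgDeriv (Ω.indicator a') z p‖ ≤ 2 * C *
      (Metric.closedBall (0 : ℂ) (2 * (‖z₀‖ + 1 + R))).indicator (fun ζ => ‖ζ‖⁻¹) p.1 := by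
  unfold cauchyAvgDeriv
  have hz1 : ‖z i‖ ≤ ‖z₀‖ + 1 := by
    have h1 := norm_le_pi_norm z i
    have h2 : ‖z - z₀‖ < 1 := by simpa [dist_eq_norm] using hz
    have := norm_le_norm_add_norm_sub' z z₀
    linarith
  by_cases h : p.1 ∈ Metric.closedBall (0 : ℂ) (2 * (‖z₀‖ + 1 + R))
  · rw [indicator_of_mem h, norm_smul, norm_inv]
    have h1 : ‖(Ω.indicator a' (z - p.1 • p.2)).flip p.2‖ ≤ C * 2 := by
      refine (ContinuousLinearMap.le_opNorm _ _).trans ?_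
      rw [ContinuousLinearMap.opNorm_flip]
      exact mul_le_mul (norm_indicator_deriv_le ha hL _) (norm_le_of_mem_dirBall hp)
        (norm_nonneg _) (by positivity)
    calc ‖p.1‖⁻¹ * ‖(Ω.indicator a' (z - p.1 • p.2)).flip p.2‖ ≤ ‖p.1‖⁻¹ * (C * 2) := by gcongr
      _ = _ := by ring
  · rw [indicator_of_notMem h]
    have h2 : Ω.indicator a' (z - p.1 • p.2) = 0 := by
      refine apply_sub_smul_eq_zero (R := R) (i := i) (fun w hw => ?_) hp ?_
      · exact indicator_apply_eq_zero.2 fun _ => eq_zero_of_hasFDerivAt_of_far ha hR hw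
      · simp only [Metric.mem_closedBall, dist_zero_right, not_le] at h
        linarith
    rw [h2]
    simp

theorem hasFDerivAt_cauchyAvg (ho : IsOpen Ω) (hN : volume (frontier Ω) = 0)
    (ha : ∀ z, HasFDerivAt a (a' z) z) (ha' : Continuous a') (hL : LipschitzWith C a)
    (h0 : ∀ z ∈ frontier Ω, a z = 0) (hR : ∀ z, R < ‖z‖ → a z = 0) (i : Fin n) (z₀ : Pt n) :
    Integrable (cauchyAvgDeriv (Ω.indicator a') z₀) (dirMeasure i) ∧
      HasFDerivAt (cauchyAvg i (Ω.indicator a))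
        (∫ p, cauchyAvgDeriv (Ω.indicator a') z₀ p ∂dirMeasure i) z₀ := by
  have hLi := lipschitzWith_indicator hL h0
  have hRi : ∀ z, R < ‖z‖ → Ω.indicator a z = 0 := fun z hz =>
    indicator_apply_eq_zero.2 fun _ => hR z hz
  have hmeas : ∀ z, AEStronglyMeasurable
      (fun p : ℂ × Pt n => p.1⁻¹ * Ω.indicator a (z - p.1 • p.2) p.2) (dirMeasure i) := by
    intro z
    refine AEStronglyMeasurable.mul (measurable_fst.inv).aestronglyMeasurable ?_
    refine Continuous.aestronglyMeasurable ?_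
    exact (hLi.continuous.comp (by fun_prop)).clm_apply continuous_snd
  have hbd : ∀ p : ℂ × Pt n, p.2 ∈ dirBall i → ∀ x ∈ Metric.ball z₀ 1,
      p.1 ∉ Metric.closedBall (0 : ℂ) (2 * (‖z₀‖ + 1 + R)) →
      Ω.indicator a (x - p.1 • p.2) = 0 := by
    intro p hp z hz h
    have hz1 : ‖z i‖ ≤ ‖z₀‖ + 1 := by
      have h1 := norm_le_pi_norm z i
      have h2 : ‖z - z₀‖ < 1 := by simpa [dist_eq_norm] using hz
      have := norm_le_norm_add_norm_sub' z z₀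
      linarith
    refine apply_sub_smul_eq_zero hRi hp ?_
    simp only [Metric.mem_closedBall, dist_zero_right, not_le] at h
    linarith
  obtain ⟨K, hK⟩ : ∃ K : ℝ, ∀ w, ‖Ω.indicator a w‖ ≤ K := by
    have hcs : HasCompactSupport (Ω.indicator a) :=
      HasCompactSupport.intro (isCompact_closedBall (0 : Pt n) R) fun x hx =>
        hRi x (by simpa using hx)
    exact hcs.exists_bound_of_continuous hLi.continuous
  refine hasFDerivAt_integral_of_dominated_loc_of_lip (Metric.ball_mem_nhds z₀ one_pos)
    (Eventually.of_forall hmeas) ?_ (aestronglyMeasurable_cauchyAvgDeriv ho ha' i z₀) ?_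
    (integrable_kernel_bound i (2 * C) (2 * (‖z₀‖ + 1 + R))) ?_
  · refine (integrable_kernel_bound i (2 * K) (2 * (‖z₀‖ + 1 + R))).mono' (hmeas z₀) ?_
    filter_upwards [ae_dirMeasure_mem i] with p hp
    by_cases h : p.1 ∈ Metric.closedBall (0 : ℂ) (2 * (‖z₀‖ + 1 + R))
    · rw [indicator_of_mem h, norm_mul, norm_inv]
      have : ‖Ω.indicator a (z₀ - p.1 • p.2) p.2‖ ≤ K * 2 :=
        (ContinuousLinearMap.le_opNorm _ _).trans
          (mul_le_mul (hK _) (norm_le_of_mem_dirBall hp.2) (norm_nonneg _)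
            ((norm_nonneg _).trans (hK 0)))
      calc ‖p.1‖⁻¹ * ‖Ω.indicator a (z₀ - p.1 • p.2) p.2‖ ≤ ‖p.1‖⁻¹ * (K * 2) := by gcongr
        _ = _ := by ring
    · rw [hbd p hp.2 z₀ (Metric.mem_ball_self one_pos) h, indicator_of_notMem h]
      simp
  · filter_upwards [ae_dirMeasure_mem i] with p hp
    refine LipschitzOnWith.of_dist_le_mul fun x hx y hy => ?_
    by_cases h : p.1 ∈ Metric.closedBall (0 : ℂ) (2 * (‖z₀‖ + 1 + R))
    · rw [indicator_of_mem h, Real.coe_nnabs, abs_of_nonneg (by positivity), dist_eq_norm,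
        ← mul_sub, ← sub_apply, norm_mul, norm_inv]
      have h1 := hLi.dist_le_mul (x - p.1 • p.2) (y - p.1 • p.2)
      rw [dist_sub_right, dist_eq_norm] at h1
      have : ‖(Ω.indicator a (x - p.1 • p.2) - Ω.indicator a (y - p.1 • p.2)) p.2‖ ≤
          (C * dist x y) * 2 :=
        (ContinuousLinearMap.le_opNorm _ _).trans
          (mul_le_mul h1 (norm_le_of_mem_dirBall hp.2) (norm_nonneg _) (by positivity))
      calc ‖p.1‖⁻¹ * _ ≤ ‖p.1‖⁻¹ * ((C * dist x y) * 2) := by gcongr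
        _ = _ := by ring
    · rw [hbd p hp.2 x hx h, hbd p hp.2 y hy h, dist_self]
      positivity
  · filter_upwards [ae_dirMeasure_notMem isClosed_frontier hN i z₀] with p hp
    have h1 : HasFDerivAt (fun z => Ω.indicator a (z - p.1 • p.2))
        (Ω.indicator a' (z₀ - p.1 • p.2)) z₀ := by
      have h := HasFDerivAt.comp (g := Ω.indicator a) z₀ (hasFDerivAt_indicator ho ha hp)
        ((hasFDerivAt_id z₀).sub_const (p.1 • p.2))
      rwa [ContinuousLinearMap.comp_id] at h
    exact ((ContinuousLinearMap.apply ℝ ℂ p.2).hasFDerivAt.comp z₀ h1).const_mul p.1⁻¹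

theorem contDiff_cauchyAvg (ho : IsOpen Ω) (hN : volume (frontier Ω) = 0)
    (ha : ∀ z, HasFDerivAt a (a' z) z) (ha' : Continuous a') (hL : LipschitzWith C a)
    (h0 : ∀ z ∈ frontier Ω, a z = 0) (hR : ∀ z, R < ‖z‖ → a z = 0) (i : Fin n) :
    ContDiff ℝ 1 (cauchyAvg i (Ω.indicator a)) := by
  have hd := fun z => (hasFDerivAt_cauchyAvg ho hN ha ha' hL h0 hR i z).2
  rw [contDiff_one_iff_fderiv]
  refine ⟨fun z => (hd z).differentiableAt, ?_⟩
  have : fderiv ℝ (cauchyAvg i (Ω.indicator a)) =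
      fun z => ∫ p, cauchyAvgDeriv (Ω.indicator a') z p ∂dirMeasure i :=
    funext fun z => (hd z).fderiv
  rw [this, continuous_iff_continuousAt]
  intro z₀
  refine continuousAt_of_dominated
    (Eventually.of_forall fun z => aestronglyMeasurable_cauchyAvgDeriv ho ha' i z) ?_
    (integrable_kernel_bound i (2 * C) (2 * (‖z₀‖ + 1 + R))) ?_
  · filter_upwards [Metric.ball_mem_nhds z₀ one_pos] with z hz
    filter_upwards [ae_dirMeasure_mem i] with p hp
    exact norm_cauchyAvgDeriv_le ha hL hR i hz hp.2
  · filter_upwards [ae_dirMeasure_notMem isClosed_frontier hN i z₀] with p hp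
    have h1 := continuousAt_indicator_of_notMem_frontier ho ha' hp
    have h2 : ContinuousAt (fun z => Ω.indicator a' (z - p.1 • p.2)) z₀ :=
      ContinuousAt.comp (g := Ω.indicator a') h1 (by fun_prop)
    refine ContinuousAt.const_smul ?_ p.1⁻¹
    exact (((ContinuousLinearMap.flipₗᵢ ℝ (Pt n) (Pt n) ℂ).continuous.continuousAt.comp h2)).clm_apply
      continuousAt_const

end CauchyAverage

section CauchyAverage

variable {n : ℕ} {Ω : Set (Pt n)} {a : Pt n → Pt n →L[ℝ] ℂ}
  {a' : Pt n → Pt n →L[ℝ] Pt n →L[ℝ] ℂ} {C : NNReal} {R : ℝ}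

theorem integral_cauchy_slice (ho : IsOpen Ω)
    (ha : ∀ z, HasFDerivAt a (a' z) z) (hL : LipschitzWith C a)
    (h0 : ∀ z ∈ frontier Ω, a z = 0) (hR : ∀ z, R < ‖z‖ → a z = 0) {i : Fin n} (z X : Pt n)
    {v : Pt n} (hv : v ∈ dirBall i) (hae : ∀ᵐ ζ : ℂ, z - ζ • v ∉ frontier Ω) :
    ∫ ζ : ℂ, ζ⁻¹ * (Ω.indicator a' (z - ζ • v) v X + I * Ω.indicator a' (z - ζ • v) (I • v) X) =
      2 * bubbleMass * Ω.indicator a z X := by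
  have hLi := lipschitzWith_indicator hL h0
  have hRi : ∀ z, R < ‖z‖ → Ω.indicator a z = 0 := fun z hz =>
    indicator_apply_eq_zero.2 fun _ => hR z hz
  set g : ℂ → ℂ := fun ζ => Ω.indicator a (z - ζ • v) X with hg
  have hgL : LipschitzWith (C * ‖v‖₊ * ‖X‖₊) g := by
    refine LipschitzWith.of_dist_le_mul fun x y => ?_
    have h1 := hLi.dist_le_mul (z - x • v) (z - y • v)
    rw [dist_sub_left, dist_eq_norm, dist_eq_norm, ← sub_smul, norm_smul] at h1
    rw [dist_eq_norm, dist_eq_norm, hg]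
    simp only
    rw [← sub_apply]
    refine (ContinuousLinearMap.le_opNorm _ _).trans ?_
    push_cast
    calc _ ≤ (C * (‖x - y‖ * ‖v‖)) * ‖X‖ := by gcongr
      _ = _ := by ring
  have hgc : HasCompactSupport g := by
    refine HasCompactSupport.intro (isCompact_closedBall (0 : ℂ) (2 * (‖z i‖ + R))) fun x hx => ?_
    have : Ω.indicator a (z - x • v) = 0 :=
      apply_sub_smul_eq_zero hRi hv (by simpa using hx)
    simp [hg, this]
  have hcp := integral_dbar_mul_inv hgL hgc
  have h1 : g 0 = Ω.indicator a z X := by simp [hg]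
  rw [h1] at hcp
  rw [← neg_neg (2 * (bubbleMass : ℂ) * _), ← hcp, ← integral_neg]
  refine integral_congr_ae ?_
  filter_upwards [hae] with ζ hζ
  have e1 := ((hasFDerivAt_id (𝕜 := ℝ) ζ).smul_const v).const_sub z
  have e2 := HasFDerivAt.comp (g := Ω.indicator a) ζ (hasFDerivAt_indicator ho ha hζ) e1
  have e3 : fderiv ℝ g ζ = _ :=
    ((ContinuousLinearMap.apply ℝ ℂ X).hasFDerivAt.comp ζ e2).fderiv
  rw [e3]
  simp
  ring

theorem dbar_cauchyAvg (ho : IsOpen Ω) (hN : volume (frontier Ω) = 0)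
    (ha : ∀ z, HasFDerivAt a (a' z) z) (ha' : Continuous a') (hL : LipschitzWith C a)
    (h0 : ∀ z ∈ frontier Ω, a z = 0) (hR : ∀ z, R < ‖z‖ → a z = 0)
    (hsym : ∀ w X v, a' w X v + I * a' w (I • X) v = a' w v X + I * a' w (I • v) X)
    (i : Fin n) (z X : Pt n) :
    fderiv ℝ (cauchyAvg i (Ω.indicator a)) z X +
      I * fderiv ℝ (cauchyAvg i (Ω.indicator a)) z (I • X) =
      (volume : Measure (Pt n)).real (dirBall i) * (2 * bubbleMass * Ω.indicator a z X) := by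
  obtain ⟨hint, hd⟩ := hasFDerivAt_cauchyAvg ho hN ha ha' hL h0 hR i z
  have hint' : ∀ Y, Integrable (fun p => cauchyAvgDeriv (Ω.indicator a') z p Y) (dirMeasure i) :=
    fun Y => hint.apply_continuousLinearMap Y
  have hI := ((hint' X).add ((hint' (I • X)).const_mul I))
  rw [hd.fderiv, ContinuousLinearMap.integral_apply hint, ContinuousLinearMap.integral_apply hint,
    ← integral_const_mul, ← integral_add (hint' X) ((hint' (I • X)).const_mul I)]
  have e : (fun p => cauchyAvgDeriv (Ω.indicator a') z p X +
      I * cauchyAvgDeriv (Ω.indicator a') z p (I • X)) = fun p : ℂ × Pt n =>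
      p.1⁻¹ * (Ω.indicator a' (z - p.1 • p.2) p.2 X +
        I * Ω.indicator a' (z - p.1 • p.2) (I • p.2) X) := by
    funext p
    have hs : ∀ w, Ω.indicator a' w X p.2 + I * Ω.indicator a' w (I • X) p.2 =
        Ω.indicator a' w p.2 X + I * Ω.indicator a' w (I • p.2) X := by
      intro w
      by_cases hw : w ∈ Ω
      · rw [indicator_of_mem hw, hsym]
      · rw [indicator_of_notMem hw]; simp
    rw [← hs]
    simp only [cauchyAvgDeriv, smul_apply, ContinuousLinearMap.flip_apply, smul_eq_mul]
    ring
  have hI' : Integrable (fun p : ℂ × Pt n =>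
      p.1⁻¹ * (Ω.indicator a' (z - p.1 • p.2) p.2 X +
        I * Ω.indicator a' (z - p.1 • p.2) (I • p.2) X))
      ((volume : Measure ℂ).prod ((volume : Measure (Pt n)).restrict (dirBall i))) := by
    rw [← e]; exact hI
  rw [e, dirMeasure, integral_prod_symm _ hI']
  have hae : ∀ᵐ v ∂((volume : Measure (Pt n)).restrict (dirBall i)), ∀ᵐ ζ : ℂ,
      z - ζ • v ∉ frontier Ω := by
    rw [← Measure.ae_ae_comm]
    · exact Measure.ae_ae_of_ae_prod (ae_dirMeasure_notMem isClosed_frontier hN i z)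
    · exact ((isClosed_frontier.preimage
        (by fun_prop : Continuous fun p : ℂ × Pt n => z - p.1 • p.2)).isOpen_compl).measurableSet
  have hB : ∀ᵐ v ∂((volume : Measure (Pt n)).restrict (dirBall i)), v ∈ dirBall i :=
    ae_restrict_mem Metric.isOpen_ball.measurableSet
  rw [integral_congr_ae (g := fun _ => 2 * bubbleMass * Ω.indicator a z X)]
  · rw [integral_const, measureReal_restrict_apply_univ, Complex.real_smul]
  · filter_upwards [hae, hB] with v h1 h2
    exact integral_cauchy_slice ho ha hL h0 hR z X h2 h1

/-- If `∂̄f` vanishes on `∂Ω`, then `∂̄u = 1_Ω ∂̄f` has a `C¹` solution on `ℂⁿ` which vanishes on an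
open set far away. -/
theorem exists_dbar_solution {i j : Fin n} (hij : j ≠ i) (ho : IsOpen Ω)
    (hN : volume (frontier Ω) = 0) {f : Pt n → ℂ} (hf : ContDiff ℝ 2 f)
    (hc : HasCompactSupport f)
    (h0 : ∀ z ∈ frontier Ω, ∀ X, fderiv ℝ f z X + I * fderiv ℝ f z (I • X) = 0) :
    ∃ u : Pt n → ℂ, ContDiff ℝ 1 u ∧
      (∀ z ∈ Ω, ∀ X, fderiv ℝ u z X + I * fderiv ℝ u z (I • X) =
        fderiv ℝ f z X + I * fderiv ℝ f z (I • X)) ∧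
      (∀ z ∉ Ω, ∀ X, fderiv ℝ u z X + I * fderiv ℝ u z (I • X) = 0) ∧
      ∃ R, ∀ z : Pt n, ‖z i‖ + R < ‖z j‖ → u z = 0 := by
  let J : Pt n →L[ℝ] Pt n := (I : ℂ) • ContinuousLinearMap.id ℝ (Pt n)
  let T : (Pt n →L[ℝ] ℂ) →L[ℝ] (Pt n →L[ℝ] ℂ) :=
    ContinuousLinearMap.id ℝ _ + (I : ℂ) • ((ContinuousLinearMap.compL ℝ (Pt n) (Pt n) ℂ).flip J)
  have hT : ∀ φ X, T φ X = φ X + I * φ (I • X) := fun φ X => by simp [T, J]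
  have hfd : ∀ z, HasFDerivAt f (fderiv ℝ f z) z := fun z =>
    (hf.differentiable (by norm_num) z).hasFDerivAt
  have hf1 : ContDiff ℝ 1 (fderiv ℝ f) := hf.fderiv_right (by norm_num)
  have hfd2 : ∀ z, HasFDerivAt (fderiv ℝ f) (fderiv ℝ (fderiv ℝ f) z) z := fun z =>
    (hf1.differentiable (by norm_num) z).hasFDerivAt
  have hsy : ∀ z v w, fderiv ℝ (fderiv ℝ f) z v w = fderiv ℝ (fderiv ℝ f) z w v := fun z v w =>
    second_derivative_symmetric hfd (hfd2 z) v w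
  set a : Pt n → Pt n →L[ℝ] ℂ := fun z => T (fderiv ℝ f z) with ha_def
  set a' : Pt n → Pt n →L[ℝ] Pt n →L[ℝ] ℂ := fun z => T.comp (fderiv ℝ (fderiv ℝ f) z) with ha'_def
  have ha : ∀ z, HasFDerivAt a (a' z) z := fun z => T.hasFDerivAt.comp z (hfd2 z)
  have hac : ContDiff ℝ 1 a := T.contDiff.comp hf1
  have ha' : Continuous a' :=
    ((ContinuousLinearMap.compL ℝ (Pt n) (Pt n →L[ℝ] ℂ) (Pt n →L[ℝ] ℂ)) T).continuous.comp
      (hf1.continuous_fderiv (by norm_num))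
  have has : HasCompactSupport a := (hc.fderiv ℝ).comp_left (map_zero T)
  obtain ⟨C, hL⟩ := hac.lipschitzWith_of_hasCompactSupport has (by norm_num)
  obtain ⟨R, hR⟩ := has.isCompact.isBounded.subset_closedBall (0 : Pt n)
  have hR' : ∀ z, R < ‖z‖ → a z = 0 := fun z hz => by
    by_contra h
    have := hR (subset_tsupport _ h)
    simp only [Metric.mem_closedBall, dist_zero_right] at this
    linarith
  have h0' : ∀ z ∈ frontier Ω, a z = 0 := fun z hz => by
    ext X
    simp only [ha_def, hT, h0 z hz X, zero_apply]
  have hsym : ∀ w X v, a' w X v + I * a' w (I • X) v = a' w v X + I * a' w (I • v) X := by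
    intro w X v
    simp only [ha'_def, ContinuousLinearMap.comp_apply, hT]
    rw [hsy w v X, hsy w v (I • X), hsy w (I • v) X, hsy w (I • v) (I • X)]
    ring
  have hvol : 0 < (volume : Measure (Pt n)).real (dirBall i) :=
    ENNReal.toReal_pos (Metric.measure_ball_pos _ _ (by norm_num)).ne' measure_ball_lt_top.ne
  set c : ℂ := (volume : Measure (Pt n)).real (dirBall i) * (2 * bubbleMass) with hc_def
  have hc0 : c ≠ 0 := by
    have : ((volume : Measure (Pt n)).real (dirBall i) * (2 * bubbleMass) : ℝ) ≠ 0 :=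
      (mul_pos hvol (mul_pos two_pos bubbleMass_pos)).ne'
    rw [hc_def]; exact_mod_cast this
  have hu := contDiff_cauchyAvg ho hN ha ha' hL h0' hR' i
  have key : ∀ z X, fderiv ℝ (fun z => c⁻¹ * cauchyAvg i (Ω.indicator a) z) z X +
      I * fderiv ℝ (fun z => c⁻¹ * cauchyAvg i (Ω.indicator a) z) z (I • X) =
      Ω.indicator a z X := by
    intro z X
    have hd := ((hu.differentiable (by norm_num) z).hasFDerivAt.const_mul c⁻¹).fderiv
    have := dbar_cauchyAvg ho hN ha ha' hL h0' hR' hsym i z X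
    rw [hd, smul_apply, smul_apply, smul_eq_mul, smul_eq_mul]
    rw [← mul_assoc, ← hc_def] at this
    calc _ = c⁻¹ * (fderiv ℝ (cauchyAvg i (Ω.indicator a)) z X +
          I * fderiv ℝ (cauchyAvg i (Ω.indicator a)) z (I • X)) := by ring
      _ = _ := by rw [this, inv_mul_cancel_left₀ hc0]
  refine ⟨fun z => c⁻¹ * cauchyAvg i (Ω.indicator a) z, contDiff_const.mul hu, ?_, ?_, 2 * R, ?_⟩
  · intro z hz X
    rw [key, indicator_of_mem hz, ha_def, hT]
  · intro z hz X
    rw [key, indicator_of_notMem hz, zero_apply]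
  · intro z hz
    have hv : cauchyAvg i (Ω.indicator a) z = 0 := cauchyAvg_eq_zero (R := R)
      (fun w hw => indicator_apply_eq_zero.2 fun _ => hR' w hw) hij hz
    simp only [hv, mul_zero]

end CauchyAverage

/-! ### Local structure of the boundary -/

section Boundary

variable {n : ℕ} {s : ℕ∞} {Ω V : Set (Pt n)} {ρ : Pt n → ℝ}

theorem IsDefining.isOpen_domain (h : IsDefining n s Ω ρ V) : IsOpen Ω := by
  obtain ⟨hV, -, hc, hΩ, -⟩ := h
  have : Ω = V ∩ ρ ⁻¹' Iio 0 := hΩ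
  rw [this]
  exact hc.continuousOn.isOpen_inter_preimage hV isOpen_Iio

theorem IsDefining.mem_iff (h : IsDefining n s Ω ρ V) {z : Pt n} : z ∈ Ω ↔ z ∈ V ∧ ρ z < 0 := by
  conv_lhs => rw [h.2.2.2.1]
  rfl

theorem IsDefining.continuousAt (h : IsDefining n s Ω ρ V) {z : Pt n} (hz : z ∈ V) :
    ContinuousAt ρ z :=
  h.2.2.1.continuousOn.continuousAt (h.1.mem_nhds hz)

theorem IsDefining.nonpos (h : IsDefining n s Ω ρ V) {z : Pt n} (hz : z ∈ closure Ω) :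
    ρ z ≤ 0 := by
  have hc := h.continuousAt (h.2.1 hz)
  by_contra! hlt
  obtain ⟨w, hw, hwΩ⟩ := mem_closure_iff_nhds.1 hz _ (hc.eventually (lt_mem_nhds hlt))
  exact absurd (h.mem_iff.1 hwΩ).2 (not_lt.2 (le_of_lt hw))

theorem IsDefining.mem_ext (h : IsDefining n s Ω ρ V) {z : Pt n} (hz : 0 < ρ z) :
    z ∈ (closure Ω)ᶜ := fun hc => absurd (h.nonpos hc) (not_le.2 hz)

theorem IsDefining.eq_zero (h : IsDefining n s Ω ρ V) {p : Pt n} (hp : p ∈ frontier Ω) :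
    ρ p = 0 := by
  have h1 := h.nonpos (frontier_subset_closure hp)
  have h2 : p ∉ Ω := by
    have := hp.2
    rwa [h.isOpen_domain.interior_eq] at this
  by_contra hne
  exact h2 (h.mem_iff.2 ⟨h.2.1 (frontier_subset_closure hp), lt_of_le_of_ne h1 hne⟩)

theorem IsDefining.contDiffAt (h : IsDefining n s Ω ρ V) {z : Pt n} (hz : z ∈ V) :
    ContDiffAt ℝ s ρ z :=
  h.2.2.1.contDiffAt (h.1.mem_nhds hz)

theorem IsDefining.exists_normal (h : IsDefining n s Ω ρ V) {p : Pt n} (hp : p ∈ frontier Ω) :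
    ∃ N, 0 < fderiv ℝ ρ p N := by
  have h1 := h.2.2.2.2 p hp
  obtain ⟨v, hv⟩ : ∃ v, fderiv ℝ ρ p v ≠ 0 := by
    by_contra! h'
    exact h1 (ContinuousLinearMap.ext h')
  rcases lt_or_gt_of_ne hv with h' | h'
  · exact ⟨-v, by rw [map_neg]; linarith⟩
  · exact ⟨v, h'⟩

/-- A ball on which a function increases in a direction of positive derivative. -/
theorem exists_ball_strictMono {E : Type*} [NormedAddCommGroup E] [NormedSpace ℝ E] {u : E → ℝ}
    {p N : E} (hu : ContDiffAt ℝ 1 u p) (hN : 0 < fderiv ℝ u p N) {S : Set E} (hS : S ∈ 𝓝 p) :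
    ∃ ε > 0, Metric.ball p ε ⊆ S ∧ ∀ z ∈ Metric.ball p ε, ∀ t : ℝ, 0 < t →
      z + t • N ∈ Metric.ball p ε → u z < u (z + t • N) := by
  have hcd : ContinuousAt (fderiv ℝ u) p :=
    (hu.fderiv_right (m := 0) (by simp)).continuousAt
  have hc : ContinuousAt (fun z => fderiv ℝ u z N) p := hcd.clm_apply continuousAt_const
  have hd : ∀ᶠ z in 𝓝 p, DifferentiableAt ℝ u z :=
    (hu.eventually (by simp)).mono fun z hz => hz.differentiableAt one_ne_zero
  obtain ⟨ε, hε, hb⟩ := Metric.mem_nhds_iff.1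
    (inter_mem (inter_mem hS hd) (hc.eventually (lt_mem_nhds hN)))
  refine ⟨ε, hε, fun z hz => (hb hz).1.1, fun z hz t ht hzt => ?_⟩
  have hmem : ∀ r ∈ Icc (0 : ℝ) t, z + r • N ∈ Metric.ball p ε := by
    intro r hr
    have : z + r • N ∈ segment ℝ z (z + t • N) := by
      refine ⟨1 - r / t, r / t, ?_, div_nonneg hr.1 ht.le, by ring, ?_⟩
      · rw [sub_nonneg, div_le_one ht]; exact hr.2
      · rw [smul_add, smul_smul, div_mul_cancel₀ _ ht.ne', ← add_assoc, ← add_smul]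
        simp
    exact (convex_ball p ε).segment_subset hz hzt this
  have hder : ∀ r ∈ Icc (0 : ℝ) t, HasDerivAt (fun r : ℝ => u (z + r • N))
      (fderiv ℝ u (z + r • N) N) r := by
    intro r hr
    have h1 : DifferentiableAt ℝ u (z + r • N) := (hb (hmem r hr)).1.2
    have h2 : HasDerivAt (fun r : ℝ => z + r • N) N r := by
      simpa using ((hasDerivAt_id r).smul_const N).const_add z
    exact h1.hasFDerivAt.comp_hasDerivAt r h2
  have hmono : StrictMonoOn (fun r : ℝ => u (z + r • N)) (Icc 0 t) := by
    refine strictMonoOn_of_deriv_pos (convex_Icc 0 t)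
      (fun r hr => (hder r hr).continuousAt.continuousWithinAt) fun r hr => ?_
    rw [interior_Icc] at hr
    rw [(hder r (Ioo_subset_Icc_self hr)).deriv]
    exact (hb (hmem r (Ioo_subset_Icc_self hr))).2
  have := hmono (left_mem_Icc.2 ht.le) (right_mem_Icc.2 ht.le) ht
  simpa using this

/-- A ball around a boundary point on which `ρ` increases in the normal direction. -/
theorem IsDefining.exists_ball (h : IsDefining n s Ω ρ V) (hs : 1 ≤ s) {p N : Pt n}
    (hp : p ∈ frontier Ω) (hN : 0 < fderiv ℝ ρ p N) :
    ∃ ε > 0, Metric.ball p ε ⊆ V ∧ ∀ z ∈ Metric.ball p ε, ∀ t : ℝ, 0 < t →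
      z + t • N ∈ Metric.ball p ε → ρ z < ρ (z + t • N) := by
  have hpV := h.2.1 (frontier_subset_closure hp)
  have hs' : (1 : WithTop ℕ∞) ≤ (s : WithTop ℕ∞) := by exact_mod_cast hs
  exact exists_ball_strictMono ((h.contDiffAt hpV).of_le hs') hN (h.1.mem_nhds hpV)

theorem exists_smul_mem_ball {E : Type*} [NormedAddCommGroup E] [NormedSpace ℝ E] {p z : E} {ε : ℝ}
    (hz : z ∈ Metric.ball p ε) (N : E) :
    ∃ τ > (0 : ℝ), ∀ t : ℝ, |t| ≤ τ → z + t • N ∈ Metric.ball p ε := by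
  have hc : ContinuousAt (fun t : ℝ => z + t • N) 0 := by fun_prop
  have h2 : Metric.ball p ε ∈ 𝓝 ((fun t : ℝ => z + t • N) 0) := by
    simpa using Metric.isOpen_ball.mem_nhds hz
  obtain ⟨δ, hδ, hb⟩ := Metric.mem_nhds_iff.1 (hc h2)
  refine ⟨δ / 2, by positivity, fun t ht => hb ?_⟩
  rw [Metric.mem_ball, dist_zero_right, Real.norm_eq_abs]
  linarith

/-- In the ball of `IsDefining.exists_ball`, the closure of the domain is `{ρ ≤ 0}`. -/
theorem IsDefining.mem_closure_of_nonpos (h : IsDefining n s Ω ρ V) {p N : Pt n} {ε : ℝ}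
    (hV : Metric.ball p ε ⊆ V) (hinc : ∀ z ∈ Metric.ball p ε, ∀ t : ℝ, 0 < t →
      z + t • N ∈ Metric.ball p ε → ρ z < ρ (z + t • N)) {z : Pt n} (hz : z ∈ Metric.ball p ε)
    (hz0 : ρ z ≤ 0) : z ∈ closure Ω := by
  obtain ⟨τ, hτ, hball⟩ := exists_smul_mem_ball hz N
  have hc : Tendsto (fun t : ℝ => z + t • N) (𝓝[<] 0) (𝓝 z) := by
    have : ContinuousAt (fun t : ℝ => z + t • N) 0 := by fun_prop
    have h2 := this.tendsto
    simp only [zero_smul, add_zero] at h2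
    exact h2.mono_left nhdsWithin_le_nhds
  refine mem_closure_of_tendsto hc ?_
  filter_upwards [Ioo_mem_nhdsLT (show -τ < 0 by linarith)] with t ht
  have hm := hball t (by rw [abs_of_neg ht.2]; linarith [ht.1])
  have := hinc _ hm (-t) (by linarith [ht.2]) (by simpa [add_assoc, ← add_smul] using hz)
  simp only [add_assoc, ← add_smul, add_neg_cancel, zero_smul, add_zero] at this
  exact h.mem_iff.2 ⟨hV hm, by linarith⟩

/-- Near a boundary point, the exterior is contained in one connected piece of the exterior. -/
theorem IsDefining.exists_preconnected_ext (h : IsDefining n s Ω ρ V) (hs : 1 ≤ s) {p : Pt n}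
    (hp : p ∈ frontier Ω) :
    ∃ T : Set (Pt n), IsPreconnected T ∧ T ⊆ (closure Ω)ᶜ ∧
      p ∈ closure T ∧ ∃ δ > 0, Metric.ball p δ ∩ (closure Ω)ᶜ ⊆ T := by
  obtain ⟨N, hN⟩ := h.exists_normal hp
  obtain ⟨ε, hε, hV, hinc⟩ := h.exists_ball hs hp hN
  obtain ⟨τ, hτ, hball⟩ := exists_smul_mem_ball (Metric.mem_ball_self hε : p ∈ Metric.ball p ε) N
  have hq : p + τ • N ∈ Metric.ball p ε := hball τ (abs_of_pos hτ).le
  have hρq : 0 < ρ (p + τ • N) := by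
    have := hinc p (Metric.mem_ball_self hε) τ hτ hq
    rwa [h.eq_zero hp] at this
  obtain ⟨δ, hδ, hδb⟩ := Metric.mem_nhds_iff.1 (inter_mem (Metric.isOpen_ball.mem_nhds hq)
    ((h.continuousAt (hV hq)).eventually (lt_mem_nhds hρq)))
  have hpos : ∀ z ∈ Metric.ball p ε, z ∈ (closure Ω)ᶜ → 0 < ρ z := fun z hz hze => by
    by_contra! h0
    exact hze (h.mem_closure_of_nonpos hV hinc hz h0)
  set S := Metric.ball p (min ε δ) ∩ (closure Ω)ᶜ with hS
  have hend : ∀ z ∈ S, z + τ • N ∈ Metric.ball (p + τ • N) δ := by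
    intro z hz
    have : dist z p < δ := (Metric.mem_ball.1 hz.1).trans_le (min_le_right _ _)
    simpa [dist_add_right] using this
  have hSε : ∀ z ∈ S, z ∈ Metric.ball p ε := fun z hz =>
    Metric.ball_subset_ball (min_le_left _ _) hz.1
  set T := ⋃ z ∈ S, (Metric.ball (p + τ • N) δ ∪ segment ℝ z (z + τ • N)) with hT
  have hST : S ⊆ T := fun z hz => by
    simp only [hT, mem_iUnion]
    exact ⟨z, hz, Or.inr (left_mem_segment ℝ _ _)⟩
  refine ⟨T, ?_, ?_, ?_, min ε δ, lt_min hε hδ, hST⟩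
  · refine isPreconnected_of_forall_pair ?_
    have hpiece : ∀ z ∈ S, IsPreconnected
        (Metric.ball (p + τ • N) δ ∪ segment ℝ z (z + τ • N)) := fun z hz =>
      (convex_ball _ _).isPreconnected.union (z + τ • N) (hend z hz) (right_mem_segment ℝ _ _)
        (convex_segment _ _).isPreconnected
    intro x hx y hy
    simp only [hT, mem_iUnion] at hx hy
    obtain ⟨z, hz, hxz⟩ := hx
    obtain ⟨w, hw, hyw⟩ := hy
    refine ⟨_, ?_, Or.inl hxz, Or.inr hyw, (hpiece z hz).union (p + τ • N)
      (Or.inl (Metric.mem_ball_self hδ)) (Or.inl (Metric.mem_ball_self hδ)) (hpiece w hw)⟩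
    exact union_subset (fun x hx => mem_biUnion hz hx) (fun x hx => mem_biUnion hw hx)
  · refine iUnion₂_subset fun z hz => union_subset ?_ ?_
    · exact fun w hw => h.mem_ext (hδb hw).2
    · rintro w hw
      rw [segment_eq_image'] at hw
      obtain ⟨t, ht, rfl⟩ := hw
      simp only [add_sub_cancel_left, smul_smul]
      have hzt : z + τ • N ∈ Metric.ball p ε := (hδb (hend z hz)).1
      rcases eq_or_lt_of_le ht.1 with h0 | h0
      · rw [← h0]; simpa using hz.2
      · have hm : z + (t * τ) • N ∈ Metric.ball p ε := by
          refine (convex_ball p ε).segment_subset (hSε z hz) hzt ?_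
          rw [segment_eq_image']
          exact ⟨t, ht, by simp [smul_smul]⟩
        exact h.mem_ext ((hpos z (hSε z hz) hz.2).trans (hinc z (hSε z hz) _ (by positivity) hm))
  · refine closure_mono hST ?_
    rw [Metric.mem_closure_iff]
    intro r hr
    obtain ⟨σ, hσ, hb⟩ := exists_smul_mem_ball
      (Metric.mem_ball_self (lt_min hr (lt_min hε hδ)) : p ∈ Metric.ball p (min r (min ε δ))) N
    have hm := hb σ (abs_of_pos hσ).le
    have hm2 : p + σ • N ∈ Metric.ball p (min ε δ) :=
      Metric.ball_subset_ball (min_le_right _ _) hm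
    refine ⟨p + σ • N, ⟨hm2, h.mem_ext ?_⟩, ?_⟩
    · have := hinc p (Metric.mem_ball_self hε) σ hσ
        (Metric.ball_subset_ball (min_le_left _ _) hm2)
      rwa [h.eq_zero hp] at this
    · rw [dist_comm]; exact (Metric.mem_ball.1 hm).trans_le (min_le_left _ _)

theorem IsDefining.frontier_subset_closure_ext (h : IsDefining n s Ω ρ V) (hs : 1 ≤ s) :
    frontier Ω ⊆ closure (closure Ω)ᶜ := fun _ hp => by
  obtain ⟨T, -, hT, hpT, -⟩ := h.exists_preconnected_ext hs hp
  exact closure_mono hT hpT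

theorem IsDefining.interior_closure (h : IsDefining n s Ω ρ V) (hs : 1 ≤ s) :
    interior (closure Ω) = Ω := by
  refine Subset.antisymm (fun z hz => ?_)
    (interior_maximal subset_closure h.isOpen_domain)
  by_contra hzΩ
  have hp : z ∈ frontier Ω := ⟨interior_subset hz, by rwa [h.isOpen_domain.interior_eq]⟩
  have := h.frontier_subset_closure_ext hs hp
  rw [closure_compl] at this
  exact this hz

end Boundary

/-! ### The identity theorem in several variables -/

section Identity

variable {E : Type*} [NormedAddCommGroup E] [NormedSpace ℂ E]

/-- A holomorphic function on a ball which vanishes near one point vanishes on the ball. -/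
theorem eqOn_zero_ball {u : E → ℂ} {c : E} {r : ℝ} (hu : DifferentiableOn ℂ u (Metric.ball c r))
    {s : E} (hs : s ∈ Metric.ball c r) (h0 : u =ᶠ[𝓝 s] 0) : EqOn u 0 (Metric.ball c r) := by
  intro w hw
  let _ : NormedSpace ℝ E := NormedSpace.restrictScalars ℝ ℂ E
  set ℓ : ℂ → E := fun t => s + t • (w - s) with hℓ
  have hℓd : Differentiable ℂ ℓ := by fun_prop
  have hconv : Convex ℝ (ℓ ⁻¹' Metric.ball c r) := by
    intro x hx y hy a b ha hb hab
    have : ℓ (a • x + b • y) = a • ℓ x + b • ℓ y := by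
      simp only [hℓ, smul_add, add_smul, smul_assoc]
      have : s = a • s + b • s := by rw [← add_smul, hab, one_smul]
      nth_rw 1 [this]
      abel
    show ℓ (a • x + b • y) ∈ Metric.ball c r
    rw [this]
    exact convex_ball c r hx hy ha hb hab
  have hopen : IsOpen (ℓ ⁻¹' Metric.ball c r) := Metric.isOpen_ball.preimage hℓd.continuous
  have hd : DifferentiableOn ℂ (u ∘ ℓ) (ℓ ⁻¹' Metric.ball c r) :=
    hu.comp hℓd.differentiableOn (fun t ht => ht)
  have hl0 : ℓ 0 = s := by simp [hℓ]
  have hz : (u ∘ ℓ) =ᶠ[𝓝 0] 0 := by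
    have : Tendsto ℓ (𝓝 0) (𝓝 s) := by
      have := hℓd.continuous.tendsto 0
      rwa [hl0] at this
    exact this.eventually h0
  have := (hd.analyticOnNhd hopen).eqOn_zero_of_preconnected_of_eventuallyEq_zero
    hconv.isPreconnected (show (0 : ℂ) ∈ ℓ ⁻¹' Metric.ball c r by
      simpa [hl0] using hs) hz (show (1 : ℂ) ∈ ℓ ⁻¹' Metric.ball c r by
      simpa [hℓ] using hw)
  simpa [hℓ] using this

theorem eqOn_zero_of_isPreconnected {u : E → ℂ} {W : Set E} (hW : IsOpen W)
    (hc : IsPreconnected W) (hu : DifferentiableOn ℂ u W) {p : E} (hp : p ∈ W)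
    (h0 : u =ᶠ[𝓝 p] 0) : EqOn u 0 W := by
  have hsub : W ⊆ {z | u =ᶠ[𝓝 z] 0} := by
    refine hc.subset_of_closure_inter_subset isOpen_setOfPred_eventually_nhds ⟨p, hp, h0⟩ ?_
    rintro z ⟨hz, hzW⟩
    obtain ⟨r, hr, hb⟩ := Metric.isOpen_iff.1 hW z hzW
    obtain ⟨s, hs0, hs⟩ := mem_closure_iff_nhds.1 hz _ (Metric.ball_mem_nhds z hr)
    have := eqOn_zero_ball (hu.mono hb) hs0 hs
    exact this.eventuallyEq_of_mem (Metric.ball_mem_nhds z hr)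
  exact fun z hz => (hsub hz).self_of_nhds

end Identity

section ComplexLinear

variable {E F : Type*} [NormedAddCommGroup E] [NormedSpace ℂ E] [NormedAddCommGroup F]
  [NormedSpace ℂ F]

/-- A real linear map commuting with multiplication by `I`, as a complex linear map. -/
noncomputable def ContinuousLinearMap.toComplex (L : E →L[ℝ] F) (h : ∀ X, L (I • X) = I • L X) : E →L[ℂ] F where
  toFun := L
  map_add' := map_add L
  map_smul' c X := by
    have : c • X = (c.re : ℝ) • X + (c.im : ℝ) • (I • X) := by
      conv_lhs => rw [← re_add_im c]
      rw [add_smul, mul_smul, coe_smul, coe_smul]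
    rw [this, map_add, map_smul, map_smul, h]
    conv_rhs => rw [← re_add_im c]
    simp only [RingHom.id_apply]
    rw [add_smul, mul_smul, coe_smul, coe_smul]
  cont := L.continuous

theorem DifferentiableAt.complex_of_real {f : E → F} {z : E} (hf : DifferentiableAt ℝ f z)
    (h : ∀ X, fderiv ℝ f z (I • X) = I • fderiv ℝ f z X) : DifferentiableAt ℂ f z :=
  (differentiableAt_iff_restrictScalars ℝ hf).2 ⟨(fderiv ℝ f z).toComplex h, rfl⟩

theorem DifferentiableAt.fderiv_real_apply {f : E → F} {z : E} (hf : DifferentiableAt ℂ f z)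
    (X : E) : fderiv ℝ f z X = fderiv ℂ f z X := by
  have e := (hf.hasFDerivAt.restrictScalars ℝ).fderiv
  rw [e]; rfl

theorem DifferentiableAt.fderiv_real_smul {f : E → F} {z : E} (hf : DifferentiableAt ℂ f z)
    (c : ℂ) (X : E) : fderiv ℝ f z (c • X) = c • fderiv ℝ f z X := by
  rw [hf.fderiv_real_apply, hf.fderiv_real_apply, map_smul]

theorem eq_I_smul_of_dbar {a b : ℂ} (h : a + I * b = 0) : b = I • a := by
  rw [eq_neg_of_add_eq_zero_left h, smul_eq_mul, mul_neg, ← mul_assoc, I_mul_I]; ring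

end ComplexLinear

/-! ### The Hartogs–Bochner extension theorem -/

section HartogsBochner

variable {n : ℕ} {Ω V U : Set (Pt n)} {ρ : Pt n → ℝ} {f : Pt n → ℂ}

/-- A boundary CR function has `∂̄f` proportional to `∂̄ρ`. -/
theorem exists_dbar_eq_mul {A : Pt n →L[ℝ] ℂ} {B : Pt n →L[ℝ] ℝ} (hB : B ≠ 0)
    (h : ∀ X, B X = 0 → B (I • X) = 0 → A (I • X) = I * A X) :
    ∃ c : ℂ, ∀ X, A X + I * A (I • X) = c * ((B X : ℂ) + I * (B (I • X) : ℂ)) := by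
  set a : Pt n → ℂ := fun X => A X + I * A (I • X) with ha
  set b : Pt n → ℂ := fun X => (B X : ℂ) + I * (B (I • X) : ℂ) with hb
  have hII : ∀ X : Pt n, I • I • X = -X := fun X => by
    rw [smul_smul, I_mul_I, neg_one_smul]
  have hdec : ∀ (c : ℂ) (X : Pt n), c • X = (c.re : ℝ) • X + (c.im : ℝ) • (I • X) := by
    intro c X
    conv_lhs => rw [← re_add_im c]
    rw [add_smul, mul_smul, coe_smul, coe_smul]
  have hcj : ∀ c : ℂ, (starRingEnd ℂ) c = c.re - c.im * I := fun c => by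
    apply Complex.ext <;> simp
  have hasm : ∀ (c : ℂ) X, a (c • X) = (starRingEnd ℂ) c * a X := by
    intro c X
    simp only [ha]
    rw [smul_comm I c X, hdec c X, hdec c (I • X)]
    simp only [map_add, map_smul, hII, map_neg, real_smul, hcj]
    linear_combination ((c.im : ℂ) * A (I • X)) * I_mul_I
  have hbsm : ∀ (c : ℂ) X, b (c • X) = (starRingEnd ℂ) c * b X := by
    intro c X
    simp only [hb]
    rw [smul_comm I c X, hdec c X, hdec c (I • X)]
    simp only [map_add, map_smul, hII, map_neg, hcj, smul_eq_mul]
    push_cast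
    linear_combination ((c.im : ℂ) * B (I • X)) * I_mul_I
  have hasub : ∀ X Y, a (X - Y) = a X - a Y := fun X Y => by
    simp only [ha, smul_sub, map_sub]; ring
  have hbsub : ∀ X Y, b (X - Y) = b X - b Y := fun X Y => by
    simp only [hb, smul_sub, map_sub]; push_cast; ring
  have hker : ∀ X, b X = 0 → a X = 0 := by
    intro X hX
    have h1 := congrArg re hX
    have h2 := congrArg im hX
    simp [hb] at h1 h2
    simp only [ha]
    rw [h X h1 h2, ← mul_assoc, I_mul_I]; ring
  obtain ⟨X₀, hX₀⟩ : ∃ X, B X ≠ 0 := by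
    by_contra! h'
    exact hB (ContinuousLinearMap.ext h')
  have hb0 : b X₀ ≠ 0 := fun h0 => hX₀ (by simpa [hb] using congrArg re h0)
  refine ⟨a X₀ / b X₀, fun X => ?_⟩
  show a X = a X₀ / b X₀ * b X
  have h1 := hker (X - ((starRingEnd ℂ) (b X / b X₀)) • X₀) (by
    rw [hbsub, hbsm, starRingEnd_self_apply]; field_simp; ring)
  rw [hasub, hasm, starRingEnd_self_apply, sub_eq_zero] at h1
  rw [h1]; ring

/-- The complement of the closure of a bounded set contains a conical region at infinity. -/
theorem exists_far_ext (hb : Bornology.IsBounded Ω) {i j : Fin n} (hij : j ≠ i) (R : ℝ) :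
    ∃ z ∈ (closure Ω)ᶜ, ‖z i‖ + R < ‖z j‖ := by
  obtain ⟨M, hM⟩ := (Metric.isBounded_iff_subset_closedBall (0 : Pt n)).1 hb.closure
  set T : ℝ := |M| + |R| + 1 with hT
  have hTpos : 0 < T := by positivity
  have hj : ‖(Pi.single j (T : ℂ) : Pt n) j‖ = T := by
    rw [Pi.single_eq_same, norm_real, Real.norm_of_nonneg hTpos.le]
  refine ⟨Pi.single j (T : ℂ), fun hz => ?_, ?_⟩
  · have h1 := hM hz
    rw [Metric.mem_closedBall, dist_zero_right] at h1
    have h2 := norm_le_pi_norm (Pi.single j (T : ℂ) : Pt n) j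
    rw [hj] at h2
    linarith [le_abs_self M, abs_nonneg R]
  · rw [hj, Pi.single_eq_of_ne hij.symm, norm_zero]
    linarith [le_abs_self R, abs_nonneg M]

/-- A compactly supported modification of a CR function with `∂̄` vanishing on the boundary. -/
theorem IsDefining.exists_dbar_flat (h : IsDefining n 3 Ω ρ V) (hb : Bornology.IsBounded Ω)
    (hU : IsOpen U) (hfU : frontier Ω ⊆ U) (hf : ContDiffOn ℝ 3 f U)
    (hcr : ∀ p ∈ frontier Ω, ∀ X, fderiv ℝ ρ p X = 0 → fderiv ℝ ρ p (I • X) = 0 →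
      fderiv ℝ f p (I • X) = I * fderiv ℝ f p X) :
    ∃ f₁ : Pt n → ℂ, ContDiff ℝ 2 f₁ ∧ HasCompactSupport f₁ ∧ (∀ z ∈ frontier Ω, f₁ z = f z) ∧
      ∀ z ∈ frontier Ω, ∀ X, fderiv ℝ f₁ z X + I * fderiv ℝ f₁ z (I • X) = 0 := by
  have hV := h.1
  have hρ : ContDiffOn ℝ 3 ρ V := h.2.2.1
  have hfV : frontier Ω ⊆ V := frontier_subset_closure.trans h.2.1
  set β : Fin n → Pt n → ℂ := fun j z =>
    fderiv ℝ f z (Pi.single j 1) + I * fderiv ℝ f z (I • Pi.single j 1) with hβ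
  set b : Fin n → Pt n → ℂ := fun j z =>
    (fderiv ℝ ρ z (Pi.single j 1) : ℂ) + I * (fderiv ℝ ρ z (I • Pi.single j 1) : ℂ) with hbdef
  have hDf : ContDiffOn ℝ 2 (fderiv ℝ f) U := hf.fderiv_of_isOpen hU (by norm_num)
  have hDρ : ContDiffOn ℝ 2 (fderiv ℝ ρ) V := hρ.fderiv_of_isOpen hV (by norm_num)
  have hβc : ∀ j, ContDiffOn ℝ 2 (β j) U := fun j =>
    (hDf.clm_apply contDiffOn_const).add (contDiffOn_const.mul (hDf.clm_apply contDiffOn_const))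
  have hofR : ∀ X : Pt n, ContDiffOn ℝ 2 (fun z => (fderiv ℝ ρ z X : ℂ)) V := fun X =>
    ofRealCLM.contDiff.comp_contDiffOn (hDρ.clm_apply contDiffOn_const)
  have hbc : ∀ j, ContDiffOn ℝ 2 (b j) V := fun j =>
    (hofR _).add (contDiffOn_const.mul (hofR _))
  have hbcj : ∀ j, ContDiffOn ℝ 2 (fun z => (starRingEnd ℂ) (b j z)) V := fun j =>
    conjCLE.contDiff.comp_contDiffOn (hbc j)
  set S : Pt n → ℂ := fun z => ∑ j, b j z * (starRingEnd ℂ) (b j z) with hS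
  have hSc : ContDiffOn ℝ 2 S V := ContDiffOn.sum fun j _ => (hbc j).mul (hbcj j)
  set q : Pt n → ℂ := fun z => (∑ j, β j z * (starRingEnd ℂ) (b j z)) / S z with hq
  have hS0 : ∀ p ∈ frontier Ω, S p ≠ 0 := by
    intro p hp h0
    have h1 : S p = ((∑ j, normSq (b j p) : ℝ) : ℂ) := by
      simp only [hS, mul_conj]; push_cast; rfl
    rw [h1, ofReal_eq_zero, Finset.sum_eq_zero_iff_of_nonneg (fun j _ => normSq_nonneg _)] at h0
    have h2 : ∀ j, b j p = 0 := fun j => normSq_eq_zero.1 (h0 j (Finset.mem_univ j))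
    apply h.2.2.2.2 p hp
    ext X
    have hX : X = ∑ j, ((X j).re • (Pi.single j 1 : Pt n) + (X j).im • (I • Pi.single j 1)) := by
      funext l
      rw [Finset.sum_apply, Finset.sum_eq_single l]
      · simp
      · intro m _ hm
        simp [Pi.single_eq_of_ne hm.symm]
      · simp
    rw [hX, map_sum, zero_apply]
    refine Finset.sum_eq_zero fun j _ => ?_
    have h3 := congrArg re (h2 j)
    have h4 := congrArg im (h2 j)
    simp [hbdef] at h3 h4
    rw [map_add, map_smul, map_smul, h3, h4]; simp
  obtain ⟨M, hM⟩ := (Metric.isBounded_iff_subset_ball (0 : Pt n)).1 hb.closure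
  set W : Set (Pt n) := (U ∩ (V ∩ S ⁻¹' {0}ᶜ)) ∩ Metric.ball 0 M with hW
  have hWo : IsOpen W := (hU.inter (hSc.continuousOn.isOpen_inter_preimage hV
    isOpen_compl_singleton)).inter Metric.isOpen_ball
  have hWf : frontier Ω ⊆ W := fun p hp =>
    ⟨⟨hfU hp, hfV hp, hS0 p hp⟩, hM (frontier_subset_closure hp)⟩
  have hWU : W ⊆ U := fun z hz => hz.1.1
  have hWV : W ⊆ V := fun z hz => hz.1.2.1
  have hqn : ContDiffOn ℝ 2 (fun z => ∑ j, β j z * (starRingEnd ℂ) (b j z)) W :=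
    ContDiffOn.sum fun j _ => ((hβc j).mono hWU).mul ((hbcj j).mono hWV)
  have hqc : ContDiffOn ℝ 2 q W :=
    (hqn.mul ((hSc.mono hWV).inv fun z (hz : z ∈ W) => hz.1.2.2)).congr fun z _ => div_eq_mul_inv _ _
  obtain ⟨χ, hχ0, hχ1, -⟩ := exists_contMDiffMap_zero_one_nhds_of_isClosed (n := 2)
    (modelWithCornersSelf ℝ (Pt n)) (s := Wᶜ) (t := frontier Ω) hWo.isClosed_compl
    isClosed_frontier (disjoint_compl_left_iff_subset.2 hWf)
  have hχ : ContDiff ℝ 2 (χ : Pt n → ℝ) := contMDiff_iff_contDiff.1 χ.contMDiff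
  have hts : tsupport (χ : Pt n → ℝ) ⊆ W := by
    intro z hz
    by_contra hzW
    have := (eventually_nhdsSet_iff_forall.1 hχ0) z hzW
    exact (notMem_tsupport_iff_eventuallyEq.2 this) hz
  have hχc : HasCompactSupport (χ : Pt n → ℝ) :=
    Metric.isCompact_of_isClosed_isBounded (isClosed_tsupport _)
      (Metric.isBounded_ball.subset (hts.trans inter_subset_right))
  set G : Pt n → ℂ := fun z => f z - q z * (ρ z : ℂ) with hG
  have hGc : ContDiffOn ℝ 2 G W := ((hf.mono hWU).of_le (by norm_num)).sub
    (hqc.mul (ofRealCLM.contDiff.comp_contDiffOn ((hρ.mono hWV).of_le (by norm_num))))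
  set f₁ : Pt n → ℂ := fun z => (χ z : ℂ) * G z with hf₁
  have hloc : ∀ p ∈ frontier Ω, f₁ =ᶠ[𝓝 p] G := fun p hp => by
    filter_upwards [(eventually_nhdsSet_iff_forall.1 hχ1) p hp] with z hz
    simp [hf₁, hz]
  refine ⟨f₁, ?_, ?_, ?_, ?_⟩
  · rw [contDiff_iff_contDiffAt]
    intro z
    by_cases hz : z ∈ tsupport (χ : Pt n → ℝ)
    · exact (ofRealCLM.contDiff.comp hχ).contDiffAt.mul
        (hGc.contDiffAt (hWo.mem_nhds (hts hz)))
    · have h0 : f₁ =ᶠ[𝓝 z] fun _ => 0 := by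
        filter_upwards [notMem_tsupport_iff_eventuallyEq.1 hz] with w hw
        simp only [hf₁]; rw [hw]; simp
      exact contDiffAt_const.congr_of_eventuallyEq h0
  · refine HasCompactSupport.mul_right (f := fun z => (χ z : ℂ)) ?_
    exact hχc.comp_left (g := fun x : ℝ => (x : ℂ)) ofReal_zero
  · intro p hp
    rw [(hloc p hp).self_of_nhds]
    simp [hG, h.eq_zero hp]
  · intro p hp X
    rw [(hloc p hp).fderiv_eq]
    have hd1 : DifferentiableAt ℝ f p :=
      (hf.contDiffAt (hU.mem_nhds (hfU hp))).differentiableAt (by norm_num)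
    have hd2 : DifferentiableAt ℝ ρ p :=
      (hρ.contDiffAt (hV.mem_nhds (hfV hp))).differentiableAt (by norm_num)
    have hd3 : DifferentiableAt ℝ q p :=
      (hqc.contDiffAt (hWo.mem_nhds (hWf hp))).differentiableAt (by norm_num)
    have hd4 : HasFDerivAt (fun z => (ρ z : ℂ)) (ofRealCLM.comp (fderiv ℝ ρ p)) p :=
      ofRealCLM.hasFDerivAt.comp p hd2.hasFDerivAt
    have e := (hd1.hasFDerivAt.sub (hd3.hasFDerivAt.mul hd4)).fderiv
    obtain ⟨c, hc⟩ := exists_dbar_eq_mul (h.2.2.2.2 p hp) (hcr p hp)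
    have hqp : q p = c := by
      simp only [hq]
      rw [div_eq_iff (hS0 p hp)]
      simp only [hS, Finset.mul_sum]
      refine Finset.sum_congr rfl fun j _ => ?_
      rw [← mul_assoc]
      congr 1
      exact hc _
    have e2 : ∀ Y, fderiv ℝ G p Y = fderiv ℝ f p Y - c * (fderiv ℝ ρ p Y : ℂ) := by
      intro Y
      have : fderiv ℝ G p = _ := e
      rw [this]
      simp [h.eq_zero hp, hqp]
    rw [e2, e2]
    linear_combination hc X

theorem IsDefining.volume_frontier (h : IsDefining n 3 Ω ρ V) : volume (frontier Ω) = 0 :=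
  measure_levelSet_eq_zero volume isClosed_frontier.measurableSet (fun _ hz => h.eq_zero hz)
    h.2.2.2.2

/-- CR functions on a boundary with connected complement extend holomorphically. -/
theorem IsDefining.hartogs_bochner (hn : 2 ≤ n) (h : IsDefining n 3 Ω ρ V)
    (hb : Bornology.IsBounded Ω) (hext : IsPreconnected (closure Ω)ᶜ)
    (hU : IsOpen U) (hfU : frontier Ω ⊆ U) (hf : ContDiffOn ℝ 3 f U)
    (hcr : ∀ p ∈ frontier Ω, ∀ X, fderiv ℝ ρ p X = 0 → fderiv ℝ ρ p (I • X) = 0 →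
      fderiv ℝ f p (I • X) = I * fderiv ℝ f p X) :
    ∃ F : Pt n → ℂ, ContDiff ℝ 1 F ∧ (∀ z ∈ frontier Ω, F z = f z) ∧ DifferentiableOn ℂ F Ω := by
  obtain ⟨f₁, hf₁, hf₁c, hf₁f, hf₁0⟩ := h.exists_dbar_flat hb hU hfU hf hcr
  let i : Fin n := ⟨0, by omega⟩
  let j : Fin n := ⟨1, by omega⟩
  have hij : j ≠ i := by simp [i, j]
  obtain ⟨u, hu, hin, hout, R, hR⟩ :=
    exists_dbar_solution hij h.isOpen_domain h.volume_frontier hf₁ hf₁c hf₁0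
  have hud : ∀ z, DifferentiableAt ℝ u z := fun z => hu.differentiable (by norm_num) z
  have hfd : ∀ z, DifferentiableAt ℝ f₁ z := fun z => hf₁.differentiable (by norm_num) z
  obtain ⟨z₀, hz₀, hz₀R⟩ := exists_far_ext hb hij R
  have hdiff : DifferentiableOn ℂ u (closure Ω)ᶜ := fun z hz =>
    ((hud z).complex_of_real fun X => eq_I_smul_of_dbar
      (hout z (fun hzΩ => hz (subset_closure hzΩ)) X)).differentiableWithinAt
  have hnear : u =ᶠ[𝓝 z₀] 0 := by
    have ho : IsOpen {z : Pt n | ‖z i‖ + R < ‖z j‖} := isOpen_lt (by fun_prop) (by fun_prop)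
    filter_upwards [ho.mem_nhds hz₀R] with z hz
    exact hR z hz
  have hzero := eqOn_zero_of_isPreconnected isClosed_closure.isOpen_compl hext hdiff hz₀ hnear
  have hu0 : ∀ z ∈ frontier Ω, u z = 0 := fun z hz =>
    (hzero.closure hu.continuous continuous_const)
      (h.frontier_subset_closure_ext (by norm_num) hz)
  refine ⟨fun z => f₁ z - u z, (hf₁.of_le (by norm_num)).sub hu, fun z hz => ?_, fun z hz => ?_⟩
  · simp [hu0 z hz, hf₁f z hz]
  · refine (((hfd z).sub (hud z)).complex_of_real fun X =>
      eq_I_smul_of_dbar ?_).differentiableWithinAt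
    have e : fderiv ℝ (f₁ - u) z = _ := ((hfd z).hasFDerivAt.sub (hud z).hasFDerivAt).fderiv
    rw [e, sub_apply, sub_apply]
    linear_combination -(hin z hz X)

end HartogsBochner

/-! ### Derivatives of holomorphic maps are holomorphic -/

section HolomorphicDerivative

variable {E : Type*} [NormedAddCommGroup E] [NormedSpace ℂ E]

theorem differentiableOn_fderiv_apply_of_continuousOn {F : E → ℂ} {s : Set E} (hs : IsOpen s)
    (hF : DifferentiableOn ℂ F s) (hc : ContinuousOn (fderiv ℂ F) s) (X : E) :
    DifferentiableOn ℂ (fun z => fderiv ℂ F z X) s := by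
  intro z₀ hz₀
  apply DifferentiableAt.differentiableWithinAt
  set C : ℝ := ‖fderiv ℂ F z₀‖ + 1 with hC
  have hcb : ∀ᶠ z in 𝓝 z₀, ‖fderiv ℂ F z‖ < C :=
    (hc.continuousAt (hs.mem_nhds hz₀)).norm.eventually (gt_mem_nhds (by linarith))
  obtain ⟨ε, hε, hb⟩ := Metric.mem_nhds_iff.1 (inter_mem (hs.mem_nhds hz₀) hcb)
  set r : ℝ := ε / 2 / (‖X‖ + 1) with hr
  have hX1 : 0 < ‖X‖ + 1 := by positivity
  have hr0 : 0 < r := by positivity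
  have hmem : ∀ z ∈ Metric.ball z₀ (ε / 2), ∀ ζ ∈ Metric.closedBall (0 : ℂ) r,
      z + ζ • X ∈ Metric.ball z₀ ε := by
    intro z hz ζ hζ
    rw [Metric.mem_ball] at hz ⊢
    rw [mem_closedBall_zero_iff] at hζ
    have h1 : ‖ζ • X‖ ≤ r * (‖X‖ + 1) := by
      rw [norm_smul]; gcongr; linarith
    rw [hr, div_mul_cancel₀ _ hX1.ne'] at h1
    have h2 := dist_triangle (z + ζ • X) z z₀
    have h3 : dist (z + ζ • X) z = ‖ζ • X‖ := by simp [dist_eq_norm]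
    linarith
  have hcm : ∀ θ : ℝ, circleMap 0 r θ ∈ Metric.closedBall (0 : ℂ) r := fun θ =>
    circleMap_mem_closedBall 0 hr0.le θ
  set w : ℝ → ℂ := fun θ => deriv (circleMap 0 r) θ * (circleMap 0 r θ ^ 2)⁻¹ with hw
  have hne : ∀ θ, circleMap 0 r θ ^ 2 ≠ 0 := fun θ =>
    pow_ne_zero _ (by simpa using circleMap_ne_center hr0.ne' (c := 0) (θ := θ))
  have hcc : Continuous (circleMap 0 r) := continuous_circleMap 0 r
  have hwc : Continuous w := by
    have h1 : Continuous (deriv (circleMap 0 r)) := by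
      have : deriv (circleMap 0 r) = fun θ => circleMap 0 r θ * I := by
        ext θ; simp
      rw [this]; fun_prop
    exact h1.mul ((hcc.pow 2).inv₀ hne)
  have hformula : ∀ z ∈ Metric.ball z₀ (ε / 2), fderiv ℂ F z X =
      (2 * Real.pi * I : ℂ)⁻¹ * ∫ θ in (0 : ℝ)..2 * Real.pi,
        w θ * F (z + circleMap 0 r θ • X) := by
    intro z hz
    have hU : IsOpen ((fun ζ : ℂ => z + ζ • X) ⁻¹' Metric.ball z₀ ε) :=
      Metric.isOpen_ball.preimage (by fun_prop)
    have hd : DifferentiableOn ℂ (fun ζ : ℂ => F (z + ζ • X))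
        ((fun ζ : ℂ => z + ζ • X) ⁻¹' Metric.ball z₀ ε) :=
      (hF.mono fun y hy => (hb hy).1).comp (by fun_prop) fun y hy => hy
    have h1 := two_pi_I_inv_smul_circleIntegral_sub_sq_inv_smul_of_differentiable hU
      (fun ζ hζ => hmem z hz ζ hζ) hd (Metric.mem_ball_self hr0)
    have hzm : z ∈ s := (hb (Metric.ball_subset_ball (by linarith) hz)).1
    have h2 : HasDerivAt (fun ζ : ℂ => F (z + ζ • X)) (fderiv ℂ F z X) 0 := by
      have h3 : HasDerivAt (fun ζ : ℂ => z + ζ • X) X 0 := by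
        simpa using ((hasDerivAt_id (0 : ℂ)).smul_const X).const_add z
      have h4 : HasFDerivAt F (fderiv ℂ F z) (z + (0 : ℂ) • X) := by
        simpa using (hF.differentiableAt (hs.mem_nhds hzm)).hasFDerivAt
      exact h4.comp_hasDerivAt 0 h3
    rw [h2.deriv] at h1
    rw [← h1, smul_eq_mul]
    congr 1
    simp only [circleIntegral, sub_zero, smul_eq_mul, hw, mul_assoc]
  have hline : ∀ z ∈ Metric.ball z₀ (ε / 2), ContinuousOn (fun y => F y) (Metric.ball z₀ ε) :=
    fun z _ => hF.continuousOn.mono fun y hy => (hb hy).1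
  have hmap : ∀ z, Continuous fun θ : ℝ => z + circleMap 0 r θ • X := fun z => by fun_prop
  have hint : ∀ z ∈ Metric.ball z₀ (ε / 2),
      Continuous fun θ => w θ * F (z + circleMap 0 r θ • X) := fun z hz =>
    hwc.mul ((hline z hz).comp_continuous (hmap z) fun θ => hmem z hz _ (hcm θ))
  have hz₀' : z₀ ∈ Metric.ball z₀ (ε / 2) := Metric.mem_ball_self (by positivity)
  have hD : Continuous fun θ => w θ • fderiv ℂ F (z₀ + circleMap 0 r θ • X) :=
    hwc.smul ((hc.mono fun y hy => (hb hy).1).comp_continuous (hmap z₀)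
      fun θ => hmem z₀ hz₀' _ (hcm θ))
  have key := intervalIntegral.hasFDerivAt_integral_of_dominated_of_fderiv_le
    (μ := volume) (a := 0) (b := 2 * Real.pi)
    (F := fun z θ => w θ * F (z + circleMap 0 r θ • X))
    (F' := fun z θ => w θ • fderiv ℂ F (z + circleMap 0 r θ • X))
    (bound := fun θ => ‖w θ‖ * C) (x₀ := z₀) (Metric.ball_mem_nhds z₀ (half_pos hε))
    (by
      filter_upwards [Metric.ball_mem_nhds z₀ (half_pos hε)] with z hz
      exact (hint z hz).aestronglyMeasurable)
    ((hint z₀ hz₀').intervalIntegrable _ _) hD.aestronglyMeasurable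
    (ae_of_all _ fun θ _ z hz => by
      rw [norm_smul]
      gcongr
      exact (hb (hmem z hz _ (hcm θ))).2.le)
    ((hwc.norm.mul continuous_const).intervalIntegrable _ _)
    (ae_of_all _ fun θ _ z hz => by
      have h1 := (hF.differentiableAt (hs.mem_nhds (hb (hmem z hz _ (hcm θ))).1)).hasFDerivAt
      have h2 : HasFDerivAt (fun y : E => y + circleMap 0 r θ • X) (ContinuousLinearMap.id ℂ E) z :=
        (hasFDerivAt_id z).add_const _
      exact (h1.comp z h2).const_mul (w θ))
  refine (key.differentiableAt.const_mul ((2 * Real.pi * I : ℂ)⁻¹)).congr_of_eventuallyEq ?_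
  filter_upwards [Metric.ball_mem_nhds z₀ (half_pos hε)] with z hz
  exact hformula z hz

theorem ContDiff.continuousOn_fderiv_complex [FiniteDimensional ℂ E] {F : E → ℂ} {s : Set E}
    (h1 : ContDiff ℝ 1 F) (hF : DifferentiableOn ℂ F s) (hs : IsOpen s) :
    ContinuousOn (fderiv ℂ F) s := by
  rw [continuousOn_clm_apply]
  intro X
  have : Continuous fun z => fderiv ℝ F z X :=
    (h1.continuous_fderiv (by norm_num)).clm_apply continuous_const
  exact this.continuousOn.congr fun z hz =>
    ((hF.differentiableAt (hs.mem_nhds hz)).fderiv_real_apply X).symm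

/-- A real `C¹` function which is holomorphic on an open set has holomorphic derivatives there. -/
theorem ContDiff.differentiableOn_fderiv_apply [FiniteDimensional ℂ E] {F : E → ℂ} {s : Set E}
    (h1 : ContDiff ℝ 1 F) (hF : DifferentiableOn ℂ F s) (hs : IsOpen s) (X : E) :
    DifferentiableOn ℂ (fun z => fderiv ℝ F z X) s :=
  (differentiableOn_fderiv_apply_of_continuousOn hs hF (h1.continuousOn_fderiv_complex hF hs) X).congr
    fun _ hz => (hF.differentiableAt (hs.mem_nhds hz)).fderiv_real_apply X

end HolomorphicDerivative

/-! ### The Kontinuitätssatz argument -/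

section Kontinuitaetssatz

variable {n : ℕ}

/-- The squared Euclidean norm on `ℂⁿ`. -/
def sqSum (z : Pt n) : ℝ := ∑ j, normSq (z j)

theorem continuous_sqSum : Continuous (sqSum : Pt n → ℝ) := by
  unfold sqSum; fun_prop

theorem sqSum_pos {z : Pt n} (hz : z ≠ 0) : 0 < sqSum z := by
  obtain ⟨j, hj⟩ := Function.ne_iff.1 hz
  exact Finset.sum_pos' (fun j _ => normSq_nonneg _) ⟨j, Finset.mem_univ j, normSq_pos.2 hj⟩

theorem sqSum_smul (c : ℂ) (z : Pt n) : sqSum (c • z) = normSq c * sqSum z := by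
  simp [sqSum, Finset.mul_sum]

theorem sqSum_add_of_orthogonal {z w : Pt n} (h : ∑ j, z j * (starRingEnd ℂ) (w j) = 0) :
    sqSum (z + w) = sqSum z + sqSum w := by
  simp only [sqSum, Pi.add_apply, normSq_add, Finset.sum_add_distrib, ← Finset.mul_sum]
  rw [← re_sum, h]; simp

theorem exists_orthogonal (hn : 2 ≤ n) {d : Pt n} (hd : d ≠ 0) :
    ∃ w : Pt n, w ≠ 0 ∧ ∑ j, d j * (starRingEnd ℂ) (w j) = 0 := by
  have : Nontrivial (Fin n) := Fin.nontrivial_iff_two_le.2 hn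
  obtain ⟨i, hi⟩ := Function.ne_iff.1 hd
  obtain ⟨j, hj⟩ := exists_ne i
  refine ⟨Pi.single i ((starRingEnd ℂ) (d j)) - Pi.single j ((starRingEnd ℂ) (d i)),
    fun h => ?_, ?_⟩
  · have := congrFun h j
    simp [Pi.single_eq_of_ne hj] at this
    exact hi this
  · simp only [Pi.sub_apply, map_sub, mul_sub, Finset.sum_sub_distrib]
    rw [Finset.sum_eq_single i, Finset.sum_eq_single j]
    · simp [mul_comm]
    · intro k _ hk; simp [Pi.single_eq_of_ne hk]
    · simp
    · intro k _ hk; simp [Pi.single_eq_of_ne hk]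
    · simp

/-- A function satisfying the maximum principle on discs in `O \ K` cannot blow up along `K`:
near some point of `K` it is frequently dominated by its values on a fixed compact set. -/
theorem exists_frequently_le_of_disc (hn : 2 ≤ n) {K O : Set (Pt n)} (hK : IsCompact K)
    (hne : K.Nonempty) (hO : IsOpen O) (hKO : K ⊆ O) {ψ : Pt n → ℝ}
    (hψ : ∀ a w : Pt n, (∀ ζ : ℂ, ‖ζ‖ ≤ 1 → a + ζ • w ∈ O \ K) →
      ∃ ζ : ℂ, ‖ζ‖ = 1 ∧ ψ a ≤ ψ (a + ζ • w)) :
    ∃ p ∈ K, ∃ Q : Set (Pt n), IsCompact Q ∧ Q ⊆ O \ K ∧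
      ∃ᶠ z in 𝓝 p, z ∈ O \ K ∧ ∃ y ∈ Q, ψ z ≤ ψ y := by
  have : Nontrivial (Fin n) := Fin.nontrivial_iff_two_le.2 hn
  obtain ⟨a, ha⟩ : ∃ a, a ∉ K := by
    by_contra! h
    exact hK.ne_univ (eq_univ_of_forall h)
  obtain ⟨p, hp, hmax⟩ := hK.exists_isMaxOn hne
    (f := fun z => sqSum (z - a)) (continuous_sqSum.comp (by fun_prop)).continuousOn
  have hd : p - a ≠ 0 := sub_ne_zero.2 fun h => ha (h ▸ hp)
  obtain ⟨w₀, hw₀, horth₀⟩ := exists_orthogonal hn hd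
  obtain ⟨ε, hε, hεO⟩ := Metric.isOpen_iff.1 hO p (hKO hp)
  set δ : ℝ := ε / 4 / ‖w₀‖ with hδ
  have hw₀n : 0 < ‖w₀‖ := norm_pos_iff.2 hw₀
  have hδ0 : 0 < δ := by positivity
  set w : Pt n := (δ : ℂ) • w₀ with hw
  have hwn : ‖w‖ = ε / 4 := by
    rw [hw, norm_smul, norm_real, Real.norm_of_nonneg hδ0.le, hδ, div_mul_cancel₀ _ hw₀n.ne']
  have hwne : w ≠ 0 := smul_ne_zero (by exact_mod_cast hδ0.ne') hw₀
  have hdn : 0 < ‖p - a‖ := norm_pos_iff.2 hd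
  set t₀ : ℝ := ε / 4 / ‖p - a‖ with ht₀
  have ht₀0 : 0 < t₀ := by positivity
  set P : ℝ × ℂ → Pt n := fun x => p + (x.1 : ℂ) • (p - a) + x.2 • w with hP
  have hPc : Continuous P := by fun_prop
  have horth : ∀ (t : ℝ) (ζ : ℂ), ∑ j, (((1 + t : ℝ) : ℂ) • (p - a)) j *
      (starRingEnd ℂ) ((ζ • w) j) = 0 := by
    intro t ζ
    have : ∀ j, (((1 + t : ℝ) : ℂ) • (p - a)) j * (starRingEnd ℂ) ((ζ • w) j) =
        (((1 + t : ℝ) : ℂ) * (starRingEnd ℂ) ζ * (starRingEnd ℂ) (δ : ℂ)) *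
          ((p - a) j * (starRingEnd ℂ) (w₀ j)) := fun j => by
      simp only [hw, Pi.smul_apply, smul_eq_mul, map_mul]; ring
    simp only [this]
    rw [← Finset.mul_sum, horth₀, mul_zero]
  have hN : ∀ (t : ℝ) (ζ : ℂ), sqSum (P (t, ζ) - a) =
      (1 + t) ^ 2 * sqSum (p - a) + normSq ζ * sqSum w := by
    intro t ζ
    have : P (t, ζ) - a = ((1 + t : ℝ) : ℂ) • (p - a) + ζ • w := by
      simp only [hP]; push_cast; rw [add_smul, one_smul]; abel
    rw [this, sqSum_add_of_orthogonal (horth t ζ), sqSum_smul, sqSum_smul, normSq_ofReal]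
    ring
  have hPO : ∀ t ∈ Icc 0 t₀, ∀ ζ : ℂ, ‖ζ‖ ≤ 1 → P (t, ζ) ∈ O := by
    intro t ht ζ hζ
    refine hεO ?_
    have h1 : P (t, ζ) - p = (t : ℂ) • (p - a) + ζ • w := by simp only [hP]; abel
    rw [mem_ball_iff_norm, h1]
    have h2 : ‖(t : ℂ) • (p - a)‖ ≤ t₀ * ‖p - a‖ := by
      rw [norm_smul, norm_real, Real.norm_of_nonneg ht.1]; gcongr; exact ht.2
    have h3 : ‖ζ • w‖ ≤ 1 * ‖w‖ := by rw [norm_smul]; gcongr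
    rw [ht₀, div_mul_cancel₀ _ hdn.ne'] at h2
    linarith [norm_add_le ((t : ℂ) • (p - a)) (ζ • w)]
  have hPK : ∀ t : ℝ, 0 ≤ t → ∀ ζ : ℂ, (0 < t ∨ ζ ≠ 0) → P (t, ζ) ∉ K := by
    intro t ht ζ h hmem
    have h1 : sqSum (P (t, ζ) - a) ≤ sqSum (p - a) := hmax hmem
    rw [hN] at h1
    have h2 := sqSum_pos hd
    have h3 := sqSum_pos hwne
    have h4 : 0 ≤ normSq ζ * sqSum w := mul_nonneg (normSq_nonneg _) h3.le
    rcases h with h | h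
    · nlinarith [mul_pos h h2]
    · have : 0 < normSq ζ * sqSum w := mul_pos (normSq_pos.2 h) h3
      nlinarith [mul_nonneg ht h2.le, mul_nonneg (mul_nonneg ht ht) h2.le]
  refine ⟨p, hp, P '' (Icc 0 t₀ ×ˢ Metric.sphere 0 1),
    (isCompact_Icc.prod (isCompact_sphere _ _)).image hPc, ?_, ?_⟩
  · rintro _ ⟨⟨t, ζ⟩, ⟨ht, hζ⟩, rfl⟩
    have hζ1 : ‖ζ‖ = 1 := by simpa using hζ
    refine ⟨hPO t ht ζ hζ1.le, hPK t ht.1 ζ (Or.inr fun h => ?_)⟩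
    rw [h, norm_zero] at hζ1; exact zero_ne_one hζ1
  · have htend : Tendsto (fun t : ℝ => P (t, 0)) (𝓝[>] 0) (𝓝 p) := by
      have h1 : Continuous fun t : ℝ => P (t, 0) := by fun_prop
      have h2 := h1.tendsto 0
      have h3 : P (0, 0) = p := by simp [hP]
      rw [h3] at h2
      exact h2.mono_left nhdsWithin_le_nhds
    refine htend.frequently (Eventually.frequently ?_)
    filter_upwards [Ioo_mem_nhdsGT ht₀0] with t ht
    have hdisc : ∀ ζ : ℂ, ‖ζ‖ ≤ 1 → P (t, 0) + ζ • w ∈ O \ K := by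
      intro ζ hζ
      have : P (t, 0) + ζ • w = P (t, ζ) := by simp [hP]
      rw [this]
      exact ⟨hPO t ⟨ht.1.le, ht.2.le⟩ ζ hζ, hPK t ht.1.le ζ (Or.inl ht.1)⟩
    refine ⟨by simpa using hdisc 0 (by simp), ?_⟩
    obtain ⟨ζ, hζ, hle⟩ := hψ _ w hdisc
    refine ⟨P (t, 0) + ζ • w, ⟨(t, ζ), ⟨⟨ht.1.le, ht.2.le⟩, by simpa using hζ⟩, ?_⟩, hle⟩
    simp [hP]

end Kontinuitaetssatz

/-! ### Connectedness of the boundary and of the exterior -/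

theorem isPreconnected_norm_gt {E : Type*} [NormedAddCommGroup E] [NormedSpace ℝ E]
    (h : 1 < Module.rank ℝ E) (M : ℝ) (hM : 0 ≤ M) : IsPreconnected {z : E | M < ‖z‖} := by
  have : {z : E | M < ‖z‖} = (fun x : ℝ × E => x.1 • x.2) '' (Ioi M ×ˢ Metric.sphere 0 1) := by
    ext z
    constructor
    · intro hz
      have hz0 : 0 < ‖z‖ := hM.trans_lt hz
      refine ⟨(‖z‖, ‖z‖⁻¹ • z), ⟨hz, ?_⟩, ?_⟩
      · simp [norm_smul, hz0.ne']
      · simp [smul_smul, hz0.ne']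
    · rintro ⟨⟨t, x⟩, ⟨ht, hx⟩, rfl⟩
      have hx1 : ‖x‖ = 1 := by simpa using hx
      have ht' : M < t := ht
      show M < ‖t • x‖
      rwa [norm_smul, hx1, mul_one, Real.norm_of_nonneg (hM.trans ht'.le)]
  rw [this]
  exact (isPreconnected_Ioi.prod (isPreconnected_sphere h 0 1)).image _ (by fun_prop)

section Exterior

variable {n : ℕ} {s : ℕ∞} {Ω V : Set (Pt n)} {ρ : Pt n → ℝ}

theorem one_lt_rank_pt (hn : 2 ≤ n) : 1 < Module.rank ℝ (Pt n) := by
  rw [rank_real_of_complex, rank_fin_fun]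
  norm_cast
  omega

theorem not_isBounded_univ_pt (hn : 2 ≤ n) : ¬ Bornology.IsBounded (univ : Set (Pt n)) := by
  have : Nontrivial (Fin n) := Fin.nontrivial_iff_two_le.2 hn
  exact NormedSpace.unbounded_univ ℂ (Pt n)

/-- A set with bounded complement splits off only bounded pieces if it is disconnected. -/
theorem isPreconnected_of_bounded_pieces (hn : 2 ≤ n) {S : Set (Pt n)} (hSo : IsOpen S)
    (hb : Bornology.IsBounded Sᶜ)
    (H : ∀ A B : Set (Pt n), IsOpen A → IsOpen B → A ∪ B = S → Disjoint A B →
      Bornology.IsBounded B → B = ∅) : IsPreconnected S := by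
  obtain ⟨M, hM⟩ := (Metric.isBounded_iff_subset_closedBall (0 : Pt n)).1 hb
  have hfar : {z : Pt n | max M 0 < ‖z‖} ⊆ S := by
    intro z hz
    by_contra hzS
    have := hM hzS
    rw [mem_closedBall_zero_iff] at this
    exact absurd (lt_of_le_of_lt (le_max_left _ _) hz) (not_lt.2 this)
  have hpc := isPreconnected_norm_gt (one_lt_rank_pt hn) (max M 0) (le_max_right _ _)
  rw [isPreconnected_iff_subset_of_disjoint]
  intro u v hu hv hsub hdis
  have main : ∀ u v : Set (Pt n), IsOpen u → IsOpen v → S ⊆ u ∪ v → S ∩ (u ∩ v) = ∅ →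
      {z : Pt n | max M 0 < ‖z‖} ⊆ u → S ⊆ u := by
    intro u v hu hv hsub hdis hfu
    have h0 := H (S ∩ u) (S ∩ v) (hSo.inter hu) (hSo.inter hv)
      (by rw [← inter_union_distrib_left, inter_eq_left.2 hsub])
      (by rw [Set.disjoint_iff_inter_eq_empty, ← inter_inter_distrib_left, hdis])
      ((Metric.isBounded_closedBall (x := (0 : Pt n)) (r := max M 0)).subset fun z hz => by
        rw [mem_closedBall_zero_iff]
        by_contra! hlt
        have : z ∈ S ∩ (u ∩ v) := ⟨hz.1, hfu hlt, hz.2⟩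
        rw [hdis] at this; exact this)
    intro z hz
    rcases hsub hz with h | h
    · exact h
    · have : z ∈ S ∩ v := ⟨hz, h⟩
      rw [h0] at this; exact this.elim
  rcases (isPreconnected_iff_subset_of_disjoint.1 hpc) u v hu hv (hfar.trans hsub)
    (eq_empty_of_subset_empty fun z hz => by
      rw [← hdis]; exact ⟨hfar hz.1, hz.2⟩) with h | h
  · exact Or.inl (main u v hu hv hsub hdis h)
  · exact Or.inr (main v u hv hu (by rwa [union_comm]) (by rwa [inter_comm v u]) h)

theorem IsDefining.disjoint_closure_of_split (h : IsDefining n s Ω ρ V) (hs : 1 ≤ s)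
    {A B : Set (Pt n)} (hA : IsOpen A) (hB : IsOpen B) (hAB : A ∪ B = (closure Ω)ᶜ)
    (hd : Disjoint A B) : Disjoint (closure A) (closure B) := by
  rw [Set.disjoint_left]
  intro p hpA hpB
  have hnA : p ∉ A := fun hp => Set.disjoint_left.1 (hd.closure_right hA) hp hpB
  have hnB : p ∉ B := fun hp => Set.disjoint_left.1 (hd.closure_left hB) hpA hp
  have hcl : p ∈ closure Ω := by
    by_contra hp
    have : p ∈ A ∪ B := by rw [hAB]; exact hp
    exact this.elim hnA hnB
  have hnΩ : p ∉ Ω := fun hp => by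
    obtain ⟨z, hz, hzA⟩ := mem_closure_iff.1 hpA Ω h.isOpen_domain hp
    have : z ∈ (closure Ω)ᶜ := hAB ▸ Or.inl hzA
    exact this (subset_closure hz)
  have hp : p ∈ frontier Ω := ⟨hcl, by rwa [h.isOpen_domain.interior_eq]⟩
  obtain ⟨T, hT, hTe, -, δ, hδ, hTδ⟩ := h.exists_preconnected_ext hs hp
  obtain ⟨a, ha, haA⟩ := mem_closure_iff.1 hpA _ Metric.isOpen_ball (Metric.mem_ball_self hδ)
  obtain ⟨b, hb, hbB⟩ := mem_closure_iff.1 hpB _ Metric.isOpen_ball (Metric.mem_ball_self hδ)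
  have haT : a ∈ T := hTδ ⟨ha, hAB ▸ Or.inl haA⟩
  have hbT : b ∈ T := hTδ ⟨hb, hAB ▸ Or.inr hbB⟩
  obtain ⟨z, -, hz⟩ := hT A B hA hB (by rw [hAB]; exact hTe) ⟨a, haT, haA⟩ ⟨b, hbT, hbB⟩
  exact Set.disjoint_left.1 hd hz.1 hz.2

/-- If the boundary is connected then so is the exterior. -/
theorem IsDefining.isPreconnected_ext (hn : 2 ≤ n) (h : IsDefining n s Ω ρ V) (hs : 1 ≤ s)
    (hb : Bornology.IsBounded Ω) (hf : IsPreconnected (frontier Ω)) :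
    IsPreconnected (closure Ω)ᶜ := by
  refine isPreconnected_of_bounded_pieces hn isClosed_closure.isOpen_compl
    (by rw [compl_compl]; exact hb.closure) fun A B hA hB hAB hd hBb => ?_
  have hdc := h.disjoint_closure_of_split hs hA hB hAB hd
  have hcover : frontier Ω ⊆ closure A ∪ closure B := by
    rw [← closure_union, hAB]; exact h.frontier_subset_closure_ext hs
  have hclosed : ∀ A B : Set (Pt n), IsOpen A → A ∪ B = (closure Ω)ᶜ →
      Disjoint (closure A) (closure B) →
      frontier Ω ∩ closure A = ∅ → IsClosed A := by
    intro A B hA hAB hdc h0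
    refine isClosed_of_closure_subset fun z hz => ?_
    by_contra hzA
    have hzB : z ∉ B := fun hzB => Set.disjoint_left.1 hdc hz (subset_closure hzB)
    have hcl : z ∈ closure Ω := by
      by_contra hp
      have : z ∈ A ∪ B := by rw [hAB]; exact hp
      exact this.elim hzA hzB
    have hnΩ : z ∉ Ω := fun hp => by
      obtain ⟨w, hw, hwA⟩ := mem_closure_iff.1 hz Ω h.isOpen_domain hp
      have : w ∈ (closure Ω)ᶜ := hAB ▸ Or.inl hwA
      exact this (subset_closure hw)
    have : z ∈ frontier Ω ∩ closure A := ⟨⟨hcl, by rwa [h.isOpen_domain.interior_eq]⟩, hz⟩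
    rw [h0] at this; exact this
  rcases (frontier Ω ∩ closure A).eq_empty_or_nonempty with hA0 | hA0
  · rcases isClopen_iff.1 ⟨hclosed A B hA hAB hdc hA0, hA⟩ with h1 | h1
    · exfalso
      rw [h1, empty_union] at hAB
      refine not_isBounded_univ_pt hn ((hb.closure.union hBb).subset fun z _ => ?_)
      by_cases hz : z ∈ closure Ω
      · exact Or.inl hz
      · exact Or.inr (hAB ▸ hz)
    · rw [h1] at hd
      exact univ_disjoint.1 hd
  · rcases (frontier Ω ∩ closure B).eq_empty_or_nonempty with hB0 | hB0
    · rcases isClopen_iff.1 ⟨hclosed B A hB (by rwa [union_comm]) hdc.symm hB0, hB⟩ with h1 | h1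
      · exact h1
      · rw [h1] at hBb
        exact absurd hBb (not_isBounded_univ_pt hn)
    · obtain ⟨z, -, hz⟩ := isPreconnected_closed_iff.1 hf _ _ isClosed_closure isClosed_closure
        hcover hA0 hB0
      exact (Set.disjoint_left.1 hdc hz.1 hz.2).elim

/-- If the exterior of a bounded domain is connected then so is the boundary. -/
theorem IsDefining.isPreconnected_frontier (hn : 2 ≤ n) (h : IsDefining n 3 Ω ρ V)
    (hb : Bornology.IsBounded Ω) (hc : IsPreconnected Ω) (hext : IsPreconnected (closure Ω)ᶜ) :
    IsPreconnected (frontier Ω) := by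
  rw [isPreconnected_closed_iff]
  intro t t' ht ht' hsub hA hB
  by_contra hne
  rw [not_nonempty_iff_eq_empty] at hne
  obtain ⟨u, v, hu, hv, hAu, hBv, huv⟩ := normal_separation (isClosed_frontier.inter ht)
    (isClosed_frontier.inter ht') (by
      rw [Set.disjoint_iff_inter_eq_empty, ← inter_inter_distrib_left, hne])
  classical
  set f : Pt n → ℂ := u.indicator fun _ => 1 with hf
  have hfu : ∀ z ∈ u, f =ᶠ[𝓝 z] fun _ => 1 := fun z hz => by
    filter_upwards [hu.mem_nhds hz] with w hw
    simp [hf, hw]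
  have hfv : ∀ z ∈ v, f =ᶠ[𝓝 z] fun _ => 0 := fun z hz => by
    filter_upwards [hv.mem_nhds hz] with w hw
    exact indicator_of_notMem (fun hwu => Set.disjoint_left.1 huv hwu hw) _
  have hloc : ∀ z ∈ u ∪ v, ∃ c, f =ᶠ[𝓝 z] fun _ => c := fun z hz =>
    hz.elim (fun h => ⟨1, hfu z h⟩) fun h => ⟨0, hfv z h⟩
  have hfr : frontier Ω ⊆ u ∪ v := fun z hz =>
    (hsub hz).imp (fun h => hAu ⟨hz, h⟩) fun h => hBv ⟨hz, h⟩
  obtain ⟨F, hF1, hFf, hFh⟩ := h.hartogs_bochner hn hb hext (hu.union hv) hfr (f := f)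
    (fun z hz => by
      obtain ⟨c, hc⟩ := hloc z hz
      exact (contDiffAt_const.congr_of_eventuallyEq hc).contDiffWithinAt)
    (fun p hp X _ _ => by
      obtain ⟨c, hc⟩ := hloc p (hfr hp)
      have e : fderiv ℝ f p = 0 := by rw [hc.fderiv_eq]; exact fderiv_const_apply c
      simp [e])
  have : Nontrivial (Fin n) := Fin.nontrivial_iff_two_le.2 hn
  have hG : EqOn (fun z => F z * (1 - F z)) (fun _ => 0) (closure Ω) := by
    refine Complex.eqOn_closure_of_eqOn_frontier hb ?_ diffContOnCl_const fun z hz => ?_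
    · exact ⟨hFh.mul ((differentiableOn_const 1).sub hFh),
        (hF1.continuous.mul (continuous_const.sub hF1.continuous)).continuousOn⟩
    · simp only [hFf z hz]
      rcases hfr hz with h | h
      · simp [(hfu z h).self_of_nhds]
      · simp [(hfv z h).self_of_nhds]
  obtain ⟨a, haf, hat⟩ := hA
  obtain ⟨b, hbf, hbt⟩ := hB
  have hFa : F a = 1 := by rw [hFf a haf, (hfu a (hAu ⟨haf, hat⟩)).self_of_nhds]
  have hFb : F b = 0 := by rw [hFf b hbf, (hfv b (hBv ⟨hbf, hbt⟩)).self_of_nhds]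
  have hivt := hc.closure.intermediate_value (frontier_subset_closure hbf)
    (frontier_subset_closure haf)
    (f := fun z => (F z).re) (continuous_re.comp hF1.continuous).continuousOn
  obtain ⟨z, hz, hz2⟩ := hivt (show (1 / 2 : ℝ) ∈ Icc (F b).re (F a).re by
    rw [hFa, hFb]; norm_num)
  have := hG hz
  simp only [mul_eq_zero, sub_eq_zero] at this
  rcases this with h0 | h0
  · simp [h0] at hz2
  · simp [← h0] at hz2

end Exterior

/-! ### Wirtinger derivatives -/

section Wirtinger

variable {n : ℕ}

theorem map_eq_sum_single (L : Pt n →L[ℝ] ℂ) (X : Pt n) :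
    L X = ∑ j, ((X j).re * L (Pi.single j 1) + (X j).im * L (Pi.single j I)) := by
  have hX : X = ∑ j, ((X j).re • (Pi.single j 1 : Pt n) + (X j).im • (Pi.single j I : Pt n)) := by
    funext l
    rw [Finset.sum_apply, Finset.sum_eq_single l]
    · simp
    · intro m _ hm
      simp [Pi.single_eq_of_ne hm.symm]
    · simp
  conv_lhs => rw [hX]
  simp [map_sum]

theorem fderiv_eq_dZ_add_dZb (g : Pt n → ℂ) (z X : Pt n) :
    fderiv ℝ g z X = ∑ j, X j * dZ n g j z + ∑ j, (starRingEnd ℂ) (X j) * dZb n g j z := by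
  rw [map_eq_sum_single, ← Finset.sum_add_distrib]
  refine Finset.sum_congr rfl fun j _ => ?_
  have h1 : X j = (X j).re + (X j).im * I := (re_add_im _).symm
  have h2 : (starRingEnd ℂ) (X j) = (X j).re - (X j).im * I := by
    apply Complex.ext <;> simp
  rw [h2]; nth_rw 3 [h1]
  simp only [dZ, dZb]
  linear_combination (X j).im * fderiv ℝ g z (Pi.single j I) * I_mul_I

theorem fderiv_sub_I_mul (g : Pt n → ℂ) (z X : Pt n) :
    fderiv ℝ g z X - I * fderiv ℝ g z (I • X) = 2 * ∑ j, X j * dZ n g j z := by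
  rw [fderiv_eq_dZ_add_dZb, fderiv_eq_dZ_add_dZb]
  simp only [Pi.smul_apply, smul_eq_mul, map_mul, conj_I, mul_assoc, neg_mul,
    Finset.sum_neg_distrib, ← Finset.mul_sum]
  linear_combination (-∑ j, X j * dZ n g j z + ∑ j, (starRingEnd ℂ) (X j) * dZb n g j z) * I_mul_I

theorem fderiv_add_I_mul (g : Pt n → ℂ) (z X : Pt n) :
    fderiv ℝ g z X + I * fderiv ℝ g z (I • X) = 2 * ∑ j, (starRingEnd ℂ) (X j) * dZb n g j z := by
  rw [fderiv_eq_dZ_add_dZb, fderiv_eq_dZ_add_dZb]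
  simp only [Pi.smul_apply, smul_eq_mul, map_mul, conj_I, mul_assoc, neg_mul,
    Finset.sum_neg_distrib, ← Finset.mul_sum]
  linear_combination (∑ j, X j * dZ n g j z - ∑ j, (starRingEnd ℂ) (X j) * dZb n g j z) * I_mul_I

theorem fderiv_cR {φ : Pt n → ℝ} {z : Pt n} (hφ : DifferentiableAt ℝ φ z) (X : Pt n) :
    fderiv ℝ (cR n φ) z X = (fderiv ℝ φ z X : ℂ) := by
  have e : fderiv ℝ (cR n φ) z = _ := (ofRealCLM.hasFDerivAt.comp z hφ.hasFDerivAt).fderiv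
  rw [e]; rfl

theorem fderiv_real_eq {φ : Pt n → ℝ} {z : Pt n} (hφ : DifferentiableAt ℝ φ z) (X : Pt n) :
    fderiv ℝ φ z X = 2 * (∑ j, (starRingEnd ℂ) (X j) * dZb n (cR n φ) j z).re := by
  have h1 := congrArg re (fderiv_add_I_mul (cR n φ) z X)
  rw [fderiv_cR hφ, fderiv_cR hφ] at h1
  simpa using h1

theorem single_I (j : Fin n) : (Pi.single j I : Pt n) = I • Pi.single j 1 := by
  rw [← Pi.single_smul]; simp

end Wirtinger

/-! ### Strictly plurisubharmonic functions -/

section PSH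

variable {n : ℕ} {φ : Pt n → ℝ} {Ω : Set (Pt n)}

theorem StrictPSHOn.differentiableAt_dZb (h : StrictPSHOn n φ Ω) {z : Pt n} (hz : z ∈ Ω)
    (k : Fin n) : DifferentiableAt ℝ (fun w => dZb n (cR n φ) k w) z := by
  by_contra hnd
  have h1 := h z hz (Pi.single k 1) (by simp)
  have h2 : levi n φ z (Pi.single k 1) (Pi.single k 1) = 0 := by
    unfold levi
    refine Finset.sum_eq_zero fun i _ => Finset.sum_eq_zero fun j _ => ?_
    by_cases hj : j = k
    · subst hj
      simp [dZ, fderiv_zero_of_not_differentiableAt hnd]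
    · simp [Pi.single_eq_of_ne hj]
  rw [h2] at h1
  simp at h1

/-- The Levi form as the sum of second derivatives in two directions. -/
theorem levi_re_eq (z w : Pt n) :
    2 * (∑ k, (starRingEnd ℂ) (w k) * fderiv ℝ (fun y => dZb n (cR n φ) k y) z w).re +
      2 * (∑ k, (starRingEnd ℂ) ((I • w) k) *
        fderiv ℝ (fun y => dZb n (cR n φ) k y) z (I • w)).re = 4 * (levi n φ z w w).re := by
  rw [← mul_add, ← add_re, ← Finset.sum_add_distrib]
  have : ∀ k, (starRingEnd ℂ) (w k) * fderiv ℝ (fun y => dZb n (cR n φ) k y) z w +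
      (starRingEnd ℂ) ((I • w) k) * fderiv ℝ (fun y => dZb n (cR n φ) k y) z (I • w) =
      (starRingEnd ℂ) (w k) * (2 * ∑ j, w j * dZ n (fun y => dZb n (cR n φ) k y) j z) := by
    intro k
    rw [← fderiv_sub_I_mul]
    simp only [Pi.smul_apply, smul_eq_mul, map_mul, conj_I]
    ring
  simp only [this]
  have h2 : levi n φ z w w = ∑ k, (starRingEnd ℂ) (w k) *
      (∑ j, w j * dZ n (fun y => dZb n (cR n φ) k y) j z) := by
    unfold levi
    rw [Finset.sum_comm]
    refine Finset.sum_congr rfl fun k _ => ?_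
    rw [Finset.mul_sum]
    exact Finset.sum_congr rfl fun j _ => by ring
  rw [h2]
  have h3 : ∑ k, (starRingEnd ℂ) (w k) *
      (2 * ∑ j, w j * dZ n (fun y => dZb n (cR n φ) k y) j z) = 2 * ∑ k, (starRingEnd ℂ) (w k) *
      (∑ j, w j * dZ n (fun y => dZb n (cR n φ) k y) j z) := by
    rw [Finset.mul_sum]
    exact Finset.sum_congr rfl fun k _ => by ring
  rw [h3]
  simp
  ring

theorem not_isLocalMax_of_second_deriv_pos {g g' : ℝ → ℝ} {c : ℝ}
    (hg : ∀ᶠ t in 𝓝 0, HasDerivAt g (g' t) t) (hg' : HasDerivAt g' c 0) (hc : 0 < c) :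
    ¬ IsLocalMax g 0 := by
  intro hmax
  have hd : deriv g =ᶠ[𝓝 0] g' := hg.mono fun t ht => ht.deriv
  have h2 : deriv (deriv g) 0 = c := by rw [hd.deriv_eq]; exact hg'.deriv
  have hmin := isLocalMin_of_deriv_deriv_pos (by rw [h2]; exact hc) hmax.deriv_eq_zero
    hg.self_of_nhds.continuousAt
  have hconst : g =ᶠ[𝓝 0] fun _ => g 0 := by
    filter_upwards [hmax, hmin] with t h1 h2
    exact le_antisymm h1 h2
  have h3 : deriv (deriv g) 0 = 0 := by
    rw [(hconst.deriv).deriv_eq]; simp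
  exact hc.ne' (h2.symm.trans h3)

theorem StrictPSHOn.not_isLocalMax (h : StrictPSHOn n φ Ω) (hΩ : IsOpen Ω)
    (hφ : ∀ z ∈ Ω, DifferentiableAt ℝ φ z) {a w : Pt n} (ha : a ∈ Ω) (hw : w ≠ 0) :
    ¬ IsLocalMax (fun ζ : ℂ => φ (a + ζ • w)) 0 := by
  intro hmax
  have main : ∀ v : Pt n, 0 < 2 * (∑ k, (starRingEnd ℂ) (v k) *
      fderiv ℝ (fun y => dZb n (cR n φ) k y) a v).re →
      ¬ IsLocalMax (fun t : ℝ => φ (a + t • v)) 0 := by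
    intro v hv
    have hline : ∀ t : ℝ, HasDerivAt (fun t : ℝ => a + t • v) v t := fun t => by
      simpa using ((hasDerivAt_id t).smul_const v).const_add a
    refine not_isLocalMax_of_second_deriv_pos
      (g' := fun t => 2 * (∑ j, (starRingEnd ℂ) (v j) * dZb n (cR n φ) j (a + t • v)).re)
      ?_ ?_ hv
    · have hc : ContinuousAt (fun t : ℝ => a + t • v) 0 := (hline 0).continuousAt
      have : Ω ∈ 𝓝 (a + (0 : ℝ) • v) := by simpa using hΩ.mem_nhds ha
      filter_upwards [hc this] with t ht
      rw [← fderiv_real_eq (hφ _ ht)]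
      exact (hφ _ ht).hasFDerivAt.comp_hasDerivAt t (hline t)
    · have hsum : HasDerivAt
          (fun t : ℝ => ∑ j, (starRingEnd ℂ) (v j) * dZb n (cR n φ) j (a + t • v))
          (∑ k, (starRingEnd ℂ) (v k) * fderiv ℝ (fun y => dZb n (cR n φ) k y) a v) 0 := by
        refine HasDerivAt.fun_sum fun k _ => HasDerivAt.const_mul _ ?_
        have h1 : HasFDerivAt (fun y => dZb n (cR n φ) k y)
            (fderiv ℝ (fun y => dZb n (cR n φ) k y) a) (a + (0 : ℝ) • v) := by
          simpa using (h.differentiableAt_dZb ha k).hasFDerivAt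
        exact h1.comp_hasDerivAt 0 (hline 0)
      exact (reCLM.hasFDerivAt.comp_hasDerivAt 0 hsum).const_mul 2
  have hlm : ∀ c : ℂ, IsLocalMax (fun t : ℝ => φ (a + t • (c • w))) 0 := by
    intro c
    have ht : Tendsto (fun t : ℝ => (t : ℂ) * c) (𝓝 0) (𝓝 0) := by
      have : Continuous fun t : ℝ => (t : ℂ) * c := by fun_prop
      simpa using this.tendsto 0
    filter_upwards [ht.eventually hmax] with t h1
    simpa [mul_smul] using h1
  have hpos := h a ha w hw
  have hsum := levi_re_eq (φ := φ) a w
  have h1 := mt (main w) (not_not.2 (by simpa using hlm 1))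
  have h2 := mt (main (I • w)) (not_not.2 (hlm I))
  linarith

/-- The maximum principle on discs for strictly plurisubharmonic functions. -/
theorem StrictPSHOn.exists_le_on_circle (h : StrictPSHOn n φ Ω) (hΩ : IsOpen Ω)
    (hφ : ∀ z ∈ Ω, DifferentiableAt ℝ φ z) {a w : Pt n}
    (hd : ∀ ζ : ℂ, ‖ζ‖ ≤ 1 → a + ζ • w ∈ Ω) :
    ∃ ζ : ℂ, ‖ζ‖ = 1 ∧ φ a ≤ φ (a + ζ • w) := by
  by_cases hw : w = 0
  · exact ⟨1, by simp, by simp [hw]⟩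
  have hcont : ContinuousOn (fun ζ : ℂ => φ (a + ζ • w)) (Metric.closedBall 0 1) := by
    intro ζ hζ
    have h1 := (hφ _ (hd ζ (by simpa using hζ))).continuousAt
    have h2 : ContinuousAt (fun ζ : ℂ => a + ζ • w) ζ := by fun_prop
    exact (ContinuousAt.comp (f := fun ζ : ℂ => a + ζ • w) (g := φ) h1 h2).continuousWithinAt
  obtain ⟨ζ₀, hζ₀, hmax⟩ := (isCompact_closedBall (0 : ℂ) 1).exists_isMaxOn
    ⟨0, by simp⟩ hcont
  have hle : φ a ≤ φ (a + ζ₀ • w) := by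
    simpa using hmax (show (0 : ℂ) ∈ Metric.closedBall 0 1 by simp)
  refine ⟨ζ₀, ?_, hle⟩
  by_contra hne
  have hlt : ‖ζ₀‖ < 1 := lt_of_le_of_ne (by simpa using hζ₀) hne
  refine h.not_isLocalMax hΩ hφ (hd ζ₀ hlt.le) hw ?_
  have ht : Tendsto (fun ζ : ℂ => ζ₀ + ζ) (𝓝 0) (𝓝 ζ₀) := by
    have : Continuous fun ζ : ℂ => ζ₀ + ζ := by fun_prop
    simpa using this.tendsto 0
  have hnb : Metric.closedBall (0 : ℂ) 1 ∈ 𝓝 ζ₀ :=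
    mem_of_superset (Metric.isOpen_ball.mem_nhds (by simpa using hlt)) Metric.ball_subset_closedBall
  filter_upwards [ht hnb] with ζ hζ
  have := hmax hζ
  simpa [add_smul, add_assoc] using this

end PSH

/-! ### Domains with a strictly plurisubharmonic exhaustion have connected exterior -/

section PSHExterior

variable {n : ℕ} {s : ℕ∞} {Ω V : Set (Pt n)} {ρ : Pt n → ℝ}

theorem IsDefining.differentiableAt (h : IsDefining n s Ω ρ V) (hs : 1 ≤ s) {z : Pt n}
    (hz : z ∈ V) : DifferentiableAt ℝ ρ z :=
  (h.contDiffAt hz).differentiableAt (by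
    intro h0
    have hs' : (1 : WithTop ℕ∞) ≤ (s : WithTop ℕ∞) := by exact_mod_cast hs
    rw [h0] at hs'; exact absurd hs' (by simp))

theorem IsDefining.differentiableAt_rpow (h : IsDefining n s Ω ρ V) (hs : 1 ≤ s) (η : ℝ)
    {z : Pt n} (hz : z ∈ Ω) : DifferentiableAt ℝ (fun z => -((-ρ z) ^ η)) z := by
  have h1 := h.mem_iff.1 hz
  exact ((h.differentiableAt hs h1.1).neg.rpow_const (Or.inl (by
    have : -ρ z ≠ 0 := by linarith [h1.2]
    exact this))).neg

theorem IsDefining.isPreconnected_ext_of_psh (hn : 2 ≤ n) (h : IsDefining n s Ω ρ V) (hs : 1 ≤ s)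
    (hb : Bornology.IsBounded Ω) {η : ℝ} (hη : 0 < η)
    (hpsh : StrictPSHOn n (fun z => -((-ρ z) ^ η)) Ω) : IsPreconnected (closure Ω)ᶜ := by
  refine isPreconnected_of_bounded_pieces hn isClosed_closure.isOpen_compl
    (by rw [compl_compl]; exact hb.closure) fun A B hA hB hAB hd hBb => ?_
  by_contra hBne
  have hdc := h.disjoint_closure_of_split hs hA hB hAB hd
  have hK : IsCompact (closure B) := hBb.isCompact_closure
  have hOK : (closure A)ᶜ \ closure B = Ω := by
    rw [Set.sdiff_eq, ← compl_union, ← closure_union, hAB, closure_compl, compl_compl,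
      h.interior_closure hs]
  set φ : Pt n → ℝ := fun z => -((-ρ z) ^ η) with hφ
  have hφd : ∀ z ∈ Ω, DifferentiableAt ℝ φ z := fun z hz => h.differentiableAt_rpow hs η hz
  have hφneg : ∀ z ∈ Ω, φ z < 0 := fun z hz => by
    have : 0 < -ρ z := by linarith [(h.mem_iff.1 hz).2]
    simpa [hφ] using Real.rpow_pos_of_pos this η
  obtain ⟨p, hp, Q, hQ, hQs, hfreq⟩ := exists_frequently_le_of_disc hn hK
    (closure_nonempty_iff.2 (nonempty_iff_ne_empty.2 hBne)) isClosed_closure.isOpen_compl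
    (fun z hz hzA => Set.disjoint_left.1 hdc hzA hz) (ψ := φ) (fun a w hdisc =>
      hpsh.exists_le_on_circle h.isOpen_domain hφd (fun ζ hζ => hOK ▸ hdisc ζ hζ))
  rw [hOK] at hQs hfreq
  have hpcl : p ∈ closure Ω := mem_closure_iff_frequently.2 (hfreq.mono fun z hz => hz.1)
  have hpΩ : p ∉ Ω := fun hpΩ => by rw [← hOK] at hpΩ; exact hpΩ.2 hp
  have hpf : p ∈ frontier Ω := ⟨hpcl, by rwa [h.isOpen_domain.interior_eq]⟩
  obtain ⟨z₁, -, y₁, hy₁, -⟩ := hfreq.exists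
  obtain ⟨y₀, hy₀, hmax⟩ := hQ.exists_isMaxOn ⟨y₁, hy₁⟩
    (f := φ) fun z hz => (hφd z (hQs hz)).continuousAt.continuousWithinAt
  have hcont : ContinuousAt φ p :=
    ((h.continuousAt (h.2.1 hpcl)).neg.rpow_const (Or.inr hη.le)).neg
  have hφp : φ p = 0 := by simp [hφ, h.eq_zero hpf, Real.zero_rpow hη.ne']
  have hev : ∀ᶠ z in 𝓝 p, φ y₀ < φ z :=
    hcont.eventually (lt_mem_nhds (by rw [hφp]; exact hφneg y₀ (hQs hy₀)))
  obtain ⟨z, ⟨-, y, hy, hzy⟩, hlt⟩ := (hfreq.and_eventually hev).exists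
  exact absurd (hzy.trans (hmax hy)) (not_le.2 hlt)

end PSHExterior

/-! ### Tangential derivatives along the boundary -/

section Tangential

variable {n : ℕ} {s : ℕ∞} {Ω V : Set (Pt n)} {ρ : Pt n → ℝ}

theorem IsDefining.eventually_mem_frontier (h : IsDefining n s Ω ρ V) (hs : 1 ≤ s) {p : Pt n}
    (hp : p ∈ frontier Ω) : ∀ᶠ z in 𝓝 p, ρ z = 0 → z ∈ frontier Ω := by
  obtain ⟨N, hN⟩ := h.exists_normal hp
  obtain ⟨ε, hε, hV, hmono⟩ := h.exists_ball hs hp hN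
  filter_upwards [Metric.ball_mem_nhds p hε] with z hz h0
  refine ⟨?_, ?_⟩
  · exact h.mem_closure_of_nonpos hV hmono hz h0.le
  · rw [h.isOpen_domain.interior_eq, h.mem_iff]
    exact fun h1 => absurd h1.2 (by simp [h0])

theorem IsDefining.fderiv_real_eq_zero (h : IsDefining n s Ω ρ V) (hs : 1 ≤ s) {p : Pt n}
    (hp : p ∈ frontier Ω) {u : Pt n → ℝ} (hu : ContDiffAt ℝ 1 u p)
    (h0 : ∀ z ∈ frontier Ω, u z = 0) {X : Pt n} (hX : fderiv ℝ ρ p X = 0) :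
    fderiv ℝ u p X = 0 := by
  have hs' : (1 : WithTop ℕ∞) ≤ (s : WithTop ℕ∞) := by exact_mod_cast hs
  have hpV : p ∈ V := h.2.1 hp.1
  have hρ' := ((h.contDiffAt hpV).of_le hs').hasStrictFDerivAt one_ne_zero
  have hu' := hu.hasStrictFDerivAt one_ne_zero
  have hext : IsLocalExtrOn u {z | ρ z = ρ p} p := by
    refine Or.inl ?_
    have := h.eventually_mem_frontier hs hp
    filter_upwards [mem_nhdsWithin_of_mem_nhds this, self_mem_nhdsWithin] with z hz hz'
    rw [h0 p hp, h0 z (hz ((show ρ z = ρ p from hz').trans (h.eq_zero hp)))]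
  obtain ⟨a, b, hab, heq⟩ := hext.exists_multipliers_of_hasStrictFDerivAt_1d hρ' hu'
  have hb : b ≠ 0 := by
    rintro rfl
    have ha : a ≠ 0 := by rintro rfl; exact hab rfl
    rw [zero_smul, add_zero] at heq
    exact h.2.2.2.2 p hp ((smul_eq_zero.1 heq).resolve_left ha)
  have := DFunLike.congr_fun heq X
  simp [hX] at this
  exact this.resolve_left hb

theorem IsDefining.fderiv_eq_zero {E : Type*} [NormedAddCommGroup E] [NormedSpace ℝ E]
    (h : IsDefining n s Ω ρ V) (hs : 1 ≤ s) {p : Pt n}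
    (hp : p ∈ frontier Ω) {u : Pt n → E} (hu : ContDiffAt ℝ 1 u p)
    (h0 : ∀ z ∈ frontier Ω, u z = 0) {X : Pt n} (hX : fderiv ℝ ρ p X = 0) :
    fderiv ℝ u p X = 0 := by
  rw [SeparatingDual.eq_zero_iff_forall_dual_eq_zero (R := ℝ)]
  intro L
  have h1 := h.fderiv_real_eq_zero hs hp (u := fun z => L (u z))
    (L.contDiff.contDiffAt.comp p hu) (fun z hz => by simp [h0 z hz]) hX
  have e : fderiv ℝ (fun z => L (u z)) p = _ :=
    (L.hasFDerivAt.comp p (hu.differentiableAt one_ne_zero).hasFDerivAt).fderiv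
  rw [e] at h1
  exact h1

end Tangential

/-! ### CR maps in terms of real derivatives -/

section CR

variable {n : ℕ} {ρ : Pt n → ℝ} {p : Pt n}

theorem mem_T10_iff (hρ : DifferentiableAt ℝ ρ p) {X : Pt n} :
    X ∈ T10 n ρ p ↔ fderiv ℝ ρ p X = 0 ∧ fderiv ℝ ρ p (I • X) = 0 := by
  have h := fderiv_sub_I_mul (cR n ρ) p X
  rw [fderiv_cR hρ, fderiv_cR hρ] at h
  unfold T10
  rw [mem_ofPred_eq]
  constructor
  · intro h0
    rw [h0, mul_zero] at h
    have h1 := congrArg re h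
    have h2 := congrArg im h
    simp at h1 h2
    exact ⟨h1, h2⟩
  · rintro ⟨h1, h2⟩
    rw [h1, h2] at h
    simpa using h.symm

theorem fderiv_component {f : Pt n → Pt n} (hf : DifferentiableAt ℝ f p) (X : Pt n) (l : Fin n) :
    fderiv ℝ (fun z => f z l) p X = fderiv ℝ f p X l := by
  have e : fderiv ℝ (fun z => f z l) p = _ :=
    ((ContinuousLinearMap.proj (R := ℝ) (φ := fun _ : Fin n => ℂ) l).hasFDerivAt.comp p
      hf.hasFDerivAt).fderiv
  rw [e]; rfl

theorem push_fst_apply (f : Pt n → Pt n) (hf : DifferentiableAt ℝ f p) (L : Pt n) (l : Fin n) :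
    2 * (push n f p (L, 0)).1 l = fderiv ℝ f p L l - I * fderiv ℝ f p (I • L) l := by
  rw [← fderiv_component hf, ← fderiv_component hf, fderiv_sub_I_mul]
  simp [push, vecApp]

theorem push_snd_apply (f : Pt n → Pt n) (hf : DifferentiableAt ℝ f p) (L : Pt n) (l : Fin n) :
    2 * (push n f p (L, 0)).2 l =
      (starRingEnd ℂ) (fderiv ℝ f p L l + I * fderiv ℝ f p (I • L) l) := by
  have hl : DifferentiableAt ℝ (fun z => f z l) p := differentiableAt_pi.1 hf l
  have e : fderiv ℝ (fun z => (starRingEnd ℂ) (f z l)) p = _ :=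
    (conjCLE.toContinuousLinearMap.hasFDerivAt.comp p hl.hasFDerivAt).fderiv
  have e' : ∀ X, fderiv ℝ (fun z => (starRingEnd ℂ) (f z l)) p X =
      (starRingEnd ℂ) (fderiv ℝ f p X l) := fun X => by
    rw [e, ← fderiv_component hf]; rfl
  have h := fderiv_sub_I_mul (fun z => (starRingEnd ℂ) (f z l)) p L
  rw [e', e'] at h
  simp only [push, vecApp, Pi.zero_apply, zero_mul, Finset.sum_const_zero, add_zero]
  rw [← h]
  simp [map_add, map_mul, sub_eq_add_neg]

theorem push_eq_iff (f : Pt n → Pt n) (hf : DifferentiableAt ℝ f p) (L : Pt n) :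
    (push n f p (L, 0)).2 = 0 ↔ fderiv ℝ f p (I • L) = I • fderiv ℝ f p L := by
  rw [funext_iff, funext_iff]
  refine forall_congr' fun l => ?_
  have h := push_snd_apply f hf L l
  rw [Pi.zero_apply, Pi.smul_apply, smul_eq_mul]
  constructor
  · intro h0
    rw [h0, mul_zero, eq_comm, map_eq_zero] at h
    linear_combination (-I) * h + fderiv ℝ f p (I • L) l * I_mul_I
  · intro h0
    rw [h0] at h
    have h1 : fderiv ℝ f p L l + I * (I * fderiv ℝ f p L l) = 0 := by
      linear_combination fderiv ℝ f p L l * I_mul_I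
    rw [h1, map_zero] at h
    simpa using h

theorem push_fst_eq (f : Pt n → Pt n) (hf : DifferentiableAt ℝ f p) {L : Pt n}
    (h : fderiv ℝ f p (I • L) = I • fderiv ℝ f p L) :
    (push n f p (L, 0)).1 = fderiv ℝ f p L := by
  funext l
  have h1 := push_fst_apply f hf L l
  rw [h, Pi.smul_apply, smul_eq_mul] at h1
  linear_combination (1 / 2 : ℂ) * h1 - (1 / 2 : ℂ) * fderiv ℝ f p L l * I_mul_I

end CR

section CRDiffeo

variable {n : ℕ} {k : ℕ∞} {Ω₁ Ω₂ V₁ V₂ U₁ U₂ : Set (Pt n)} {ρ₁ ρ₂ : Pt n → ℝ} {f g : Pt n → Pt n}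

theorem IsCRDiffeo.contDiffAt (h : IsCRDiffeo n k Ω₁ Ω₂ ρ₁ ρ₂ f g U₁ U₂) {p : Pt n}
    (hp : p ∈ frontier Ω₁) : ContDiffAt ℝ k f p :=
  contDiffAt_pi.2 fun l => (h.2.2.2.2.1 l).contDiffAt (h.1.mem_nhds (h.2.2.1 hp))

theorem IsCRDiffeo.mem_frontier (h : IsCRDiffeo n k Ω₁ Ω₂ ρ₁ ρ₂ f g U₁ U₂) {p : Pt n}
    (hp : p ∈ frontier Ω₁) : f p ∈ frontier Ω₂ := by
  obtain ⟨-, -, -, -, -, -, h7, -⟩ := h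
  rw [← h7]; exact ⟨p, hp, rfl⟩

theorem IsCRDiffeo.image_symm (h : IsCRDiffeo n k Ω₁ Ω₂ ρ₁ ρ₂ f g U₁ U₂) :
    g '' frontier Ω₂ = frontier Ω₁ := by
  obtain ⟨-, -, -, -, -, -, h7, h8, -, -⟩ := h
  rw [← h7, image_image]
  refine Subset.antisymm ?_ fun p hp => ⟨p, hp, h8 p hp⟩
  rintro _ ⟨p, hp, rfl⟩
  simpa only [h8 p hp] using hp

/-- The differential of the inverse inverts the differential on tangent vectors. -/
theorem IsCRDiffeo.fderiv_fderiv (h : IsCRDiffeo n k Ω₁ Ω₂ ρ₁ ρ₂ f g U₁ U₂) (hk : 1 ≤ k)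
    {s : ℕ∞} (hs : 1 ≤ s) (hd : IsDefining n s Ω₁ ρ₁ V₁) {p : Pt n} (hp : p ∈ frontier Ω₁)
    {X : Pt n} (hX : fderiv ℝ ρ₁ p X = 0) : fderiv ℝ g (f p) (fderiv ℝ f p X) = X := by
  have hk' : (1 : WithTop ℕ∞) ≤ (k : WithTop ℕ∞) := by exact_mod_cast hk
  have hfp := (h.contDiffAt hp).of_le hk'
  have hgp : ContDiffAt ℝ 1 g (f p) := contDiffAt_pi.2 fun l =>
    ((h.2.2.2.2.2.1 l).contDiffAt (h.2.1.mem_nhds (h.2.2.2.1 (h.mem_frontier hp)))).of_le hk'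
  have h1 := hd.fderiv_eq_zero hs hp (u := fun z => g (f z) - z)
    ((hgp.comp p hfp).sub contDiffAt_id)
    (fun z hz => sub_eq_zero.2 (h.2.2.2.2.2.2.2.1 z hz)) hX
  have e : fderiv ℝ (fun z => g (f z) - z) p = _ :=
    (((hgp.differentiableAt one_ne_zero).hasFDerivAt.comp p
      (hfp.differentiableAt one_ne_zero).hasFDerivAt).sub (hasFDerivAt_id p)).fderiv
  rw [e] at h1
  exact sub_eq_zero.1 h1

/-- The complex linear form whose kernel is the holomorphic tangent space. -/
noncomputable def delForm (n : ℕ) (ρ : Pt n → ℝ) (p : Pt n) : Pt n →ₗ[ℂ] ℂ :=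
  ∑ j, dZ n (cR n ρ) j p • LinearMap.proj j

theorem delForm_apply (ρ : Pt n → ℝ) (p X : Pt n) :
    delForm n ρ p X = ∑ j, X j * dZ n (cR n ρ) j p := by
  simp [delForm, mul_comm]

theorem mem_ker_delForm {ρ : Pt n → ℝ} {p X : Pt n} :
    X ∈ LinearMap.ker (delForm n ρ p) ↔ X ∈ T10 n ρ p := by
  rw [LinearMap.mem_ker, delForm_apply]; rfl

theorem finrank_ker_delForm {ρ : Pt n → ℝ} {p : Pt n} (hd : DifferentiableAt ℝ ρ p)
    (h : fderiv ℝ ρ p ≠ 0) : Module.finrank ℂ (LinearMap.ker (delForm n ρ p)) + 1 = n := by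
  have hne : delForm n ρ p ≠ 0 := by
    intro h0
    refine h (ContinuousLinearMap.ext fun X => ?_)
    refine ((mem_T10_iff hd).1 (mem_ker_delForm.1 ?_)).1
    rw [h0]; simp
  rw [Module.Dual.finrank_ker_add_one_of_ne_zero hne]
  simp

theorem IsCRDiffeo.fderiv_mem_T10 (h : IsCRDiffeo n k Ω₁ Ω₂ ρ₁ ρ₂ f g U₁ U₂) (hk : 1 ≤ k)
    {p : Pt n} (hp : p ∈ frontier Ω₁) {X : Pt n} (hX : X ∈ T10 n ρ₁ p) :
    fderiv ℝ f p (I • X) = I • fderiv ℝ f p X ∧ fderiv ℝ f p X ∈ T10 n ρ₂ (f p) := by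
  have hk' : (1 : WithTop ℕ∞) ≤ (k : WithTop ℕ∞) := by exact_mod_cast hk
  have hfd := ((h.contDiffAt hp).of_le hk').differentiableAt one_ne_zero
  obtain ⟨h1, h2⟩ := h.2.2.2.2.2.2.2.2.2 p hp X hX
  rw [push_eq_iff f hfd] at h1
  rw [push_fst_eq f hfd h1] at h2
  exact ⟨h1, h2⟩

theorem IsCRDiffeo.symm (h : IsCRDiffeo n k Ω₁ Ω₂ ρ₁ ρ₂ f g U₁ U₂) (hk : 1 ≤ k)
    (hd₁ : IsDefining n k Ω₁ ρ₁ V₁) (hd₂ : IsDefining n k Ω₂ ρ₂ V₂) :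
    IsCRDiffeo n k Ω₂ Ω₁ ρ₂ ρ₁ g f U₂ U₁ := by
  refine ⟨h.2.1, h.1, h.2.2.2.1, h.2.2.1, h.2.2.2.2.2.1, h.2.2.2.2.1, h.image_symm,
    h.2.2.2.2.2.2.2.2.1, h.2.2.2.2.2.2.2.1, fun q hq M hM => ?_⟩
  have hk' : (1 : WithTop ℕ∞) ≤ (k : WithTop ℕ∞) := by exact_mod_cast hk
  obtain ⟨p, hp, rfl⟩ : q ∈ f '' frontier Ω₁ := by rwa [h.2.2.2.2.2.2.1]
  have hgd : DifferentiableAt ℝ g (f p) := (contDiffAt_pi.2 fun l =>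
    ((h.2.2.2.2.2.1 l).contDiffAt (h.2.1.mem_nhds (h.2.2.2.1 hq))).of_le hk').differentiableAt
      one_ne_zero
  have hρ₁ := hd₁.differentiableAt hk (hd₁.2.1 hp.1)
  have hρ₂ := hd₂.differentiableAt hk (hd₂.2.1 hq.1)
  let B : LinearMap.ker (delForm n ρ₁ p) →ₗ[ℂ] LinearMap.ker (delForm n ρ₂ (f p)) :=
    { toFun := fun X => ⟨fderiv ℝ f p X, mem_ker_delForm.2
        (h.fderiv_mem_T10 hk hp (mem_ker_delForm.1 X.2)).2⟩
      map_add' := fun X Y => Subtype.ext (by simp)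
      map_smul' := fun c X => Subtype.ext (by
        have hI := (h.fderiv_mem_T10 hk hp (mem_ker_delForm.1 X.2)).1
        have hc : ∀ Y : Pt n, c • Y = c.re • Y + c.im • (I • Y) := fun Y => by
          funext l
          simp only [Pi.smul_apply, Pi.add_apply, smul_eq_mul, real_smul]
          nth_rw 1 [← re_add_im c]; ring
        simp only [SetLike.val_smul, RingHom.id_apply]
        rw [hc, map_add, map_smul, map_smul, hI, ← hc]) }
  have hB : Function.Injective B := by
    intro X Y hXY
    have h1 : fderiv ℝ f p X = fderiv ℝ f p Y := congrArg Subtype.val hXY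
    have hX := ((mem_T10_iff hρ₁).1 (mem_ker_delForm.1 X.2)).1
    have hY := ((mem_T10_iff hρ₁).1 (mem_ker_delForm.1 Y.2)).1
    refine Subtype.ext ?_
    rw [← h.fderiv_fderiv hk hk hd₁ hp hX, h1, h.fderiv_fderiv hk hk hd₁ hp hY]
  have hfr : Module.finrank ℂ (LinearMap.ker (delForm n ρ₁ p)) =
      Module.finrank ℂ (LinearMap.ker (delForm n ρ₂ (f p))) := by
    have h1 := finrank_ker_delForm hρ₁ (hd₁.2.2.2.2 p hp)
    have h2 := finrank_ker_delForm hρ₂ (hd₂.2.2.2.2 _ hq)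
    omega
  obtain ⟨⟨X, hX⟩, hXM⟩ :=
    (LinearMap.injective_iff_surjective_of_finrank_eq_finrank hfr).1 hB ⟨M, mem_ker_delForm.2 hM⟩
  have hXM : fderiv ℝ f p X = M := congrArg Subtype.val hXM
  have hXT := mem_ker_delForm.1 hX
  obtain ⟨hX1, hX2⟩ := (mem_T10_iff hρ₁).1 hXT
  have hgM : fderiv ℝ g (f p) M = X := by rw [← hXM, h.fderiv_fderiv hk hk hd₁ hp hX1]
  have hgI : fderiv ℝ g (f p) (I • M) = I • fderiv ℝ g (f p) M := by
    rw [hgM, ← hXM, ← (h.fderiv_mem_T10 hk hp hXT).1, h.fderiv_fderiv hk hk hd₁ hp hX2]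
  refine ⟨(push_eq_iff g hgd M).2 hgI, ?_⟩
  rw [push_fst_eq g hgd hgI, hgM, h.2.2.2.2.2.2.2.1 p hp]
  exact hXT

end CRDiffeo

/-! ### Composition of plurisubharmonic functions with holomorphic maps -/

section LeviComp

variable {n : ℕ} {Ω Ω' : Set (Pt n)} {φ : Pt n → ℝ} {F : Pt n → Pt n}

theorem two_mul_levi_self (φ : Pt n → ℝ) (z w : Pt n) :
    2 * levi n φ z w w = ∑ k, (starRingEnd ℂ) (w k) *
      (fderiv ℝ (fun y => dZb n (cR n φ) k y) z w -
        I * fderiv ℝ (fun y => dZb n (cR n φ) k y) z (I • w)) := by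
  unfold levi
  rw [Finset.sum_comm, Finset.mul_sum]
  refine Finset.sum_congr rfl fun k _ => ?_
  rw [fderiv_sub_I_mul, Finset.mul_sum, Finset.mul_sum, Finset.mul_sum]
  exact Finset.sum_congr rfl fun j _ => by ring

theorem fderiv_real_apply_eq_sum {z : Pt n} (hF : DifferentiableAt ℂ F z) (X : Pt n) :
    fderiv ℝ F z X = ∑ k, X k • fderiv ℝ F z (Pi.single k 1) := by
  simp only [hF.fderiv_real_apply]
  conv_lhs => rw [pi_eq_sum_univ' X]
  simp [map_sum]

theorem dZb_comp {z : Pt n} (hF : DifferentiableAt ℂ F z) (hφ : DifferentiableAt ℝ φ (F z))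
    (k : Fin n) : dZb n (cR n fun w => φ (F w)) k z =
      ∑ l, (starRingEnd ℂ) (fderiv ℝ F z (Pi.single k 1) l) * dZb n (cR n φ) l (F z) := by
  have hFr : DifferentiableAt ℝ F z := hF.restrictScalars ℝ
  have hφc : DifferentiableAt ℝ (cR n φ) (F z) := ofRealCLM.differentiableAt.comp _ hφ
  have e : fderiv ℝ (cR n fun w => φ (F w)) z = _ :=
    (hφc.hasFDerivAt.comp z hFr.hasFDerivAt).fderiv
  have h := fderiv_add_I_mul (cR n φ) (F z) (fderiv ℝ F z (Pi.single k 1))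
  rw [dZb, e, single_I, ContinuousLinearMap.comp_apply, ContinuousLinearMap.comp_apply,
    hF.fderiv_real_smul, h]
  ring

theorem levi_comp (hΩ : IsOpen Ω) (hF1 : ContDiff ℝ 1 F) (hF : DifferentiableOn ℂ F Ω)
    (hFΩ : MapsTo F Ω Ω') (hφ : ∀ z ∈ Ω', DifferentiableAt ℝ φ z) {z : Pt n} (hz : z ∈ Ω)
    (hφ2 : ∀ l, DifferentiableAt ℝ (fun w => dZb n (cR n φ) l w) (F z)) (X : Pt n) :
    levi n (fun w => φ (F w)) z X X = levi n φ (F z) (fderiv ℝ F z X) (fderiv ℝ F z X) := by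
  have hFz : ∀ w ∈ Ω, DifferentiableAt ℂ F w := fun w hw => hF.differentiableAt (hΩ.mem_nhds hw)
  have hc : ∀ k l, DifferentiableAt ℂ (fun w => fderiv ℝ F w (Pi.single k 1) l) z := by
    intro k l
    have h1 : DifferentiableOn ℂ
        (fun w => fderiv ℝ (fun y => F y l) w (Pi.single k 1 : Pt n)) Ω :=
      (contDiff_pi.1 hF1 l).differentiableOn_fderiv_apply (differentiableOn_pi.1 hF l) hΩ _
    have h2 : (fun w => fderiv ℝ (fun y => F y l) w (Pi.single k 1 : Pt n)) =
        fun w => fderiv ℝ F w (Pi.single k 1) l := by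
      funext w
      exact fderiv_component (hF1.differentiable one_ne_zero w) _ l
    rw [h2] at h1
    exact h1.differentiableAt (hΩ.mem_nhds hz)
  have hFr : DifferentiableAt ℝ F z := (hFz z hz).restrictScalars ℝ
  have hD : ∀ k Y, fderiv ℝ (fun y => dZb n (cR n fun w => φ (F w)) k y) z Y =
      ∑ l, ((starRingEnd ℂ) (fderiv ℝ F z (Pi.single k 1) l) *
          fderiv ℝ (fun y => dZb n (cR n φ) l y) (F z) (fderiv ℝ F z Y) +
        dZb n (cR n φ) l (F z) * (starRingEnd ℂ)
          (fderiv ℝ (fun w => fderiv ℝ F w (Pi.single k 1) l) z Y)) := by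
    intro k Y
    have hev : (fun y => dZb n (cR n fun w => φ (F w)) k y) =ᶠ[𝓝 z] fun y =>
        ∑ l, (starRingEnd ℂ) (fderiv ℝ F y (Pi.single k 1) l) * dZb n (cR n φ) l (F y) := by
      filter_upwards [hΩ.mem_nhds hz] with y hy
      exact dZb_comp (hFz y hy) (hφ _ (hFΩ hy)) k
    rw [hev.fderiv_eq]
    have hd : HasFDerivAt (fun y =>
        ∑ l, (starRingEnd ℂ) (fderiv ℝ F y (Pi.single k 1) l) * dZb n (cR n φ) l (F y)) _ z :=
      HasFDerivAt.fun_sum (u := Finset.univ) fun l _ =>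
        (conjCLE.toContinuousLinearMap.hasFDerivAt.comp z
          ((hc k l).restrictScalars ℝ).hasFDerivAt).mul
        ((hφ2 l).hasFDerivAt.comp z hFr.hasFDerivAt)
    rw [hd.fderiv]
    simp
  have h2 : 2 * levi n (fun w => φ (F w)) z X X =
      2 * levi n φ (F z) (fderiv ℝ F z X) (fderiv ℝ F z X) := by
    rw [two_mul_levi_self, two_mul_levi_self]
    have hk : ∀ k, fderiv ℝ (fun y => dZb n (cR n fun w => φ (F w)) k y) z X -
        I * fderiv ℝ (fun y => dZb n (cR n fun w => φ (F w)) k y) z (I • X) =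
        ∑ l, (starRingEnd ℂ) (fderiv ℝ F z (Pi.single k 1) l) *
          (fderiv ℝ (fun y => dZb n (cR n φ) l y) (F z) (fderiv ℝ F z X) -
           I * fderiv ℝ (fun y => dZb n (cR n φ) l y) (F z) (I • fderiv ℝ F z X)) := by
      intro k
      rw [hD, hD, Finset.mul_sum, ← Finset.sum_sub_distrib]
      refine Finset.sum_congr rfl fun l _ => ?_
      rw [(hFz z hz).fderiv_real_smul, (hc k l).fderiv_real_smul, smul_eq_mul, map_mul, conj_I]
      linear_combination dZb n (cR n φ) l (F z) * (starRingEnd ℂ)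
        (fderiv ℝ (fun w => fderiv ℝ F w (Pi.single k 1) l) z X) * I_mul_I
    simp only [hk, Finset.mul_sum]
    rw [Finset.sum_comm]
    refine Finset.sum_congr rfl fun l _ => ?_
    simp only [← mul_assoc, ← Finset.sum_mul]
    congr 1
    rw [fderiv_real_apply_eq_sum (hFz z hz) X, Finset.sum_apply, map_sum]
    simp
  exact mul_left_cancel₀ two_ne_zero h2

theorem StrictPSHOn.comp (h : StrictPSHOn n φ Ω') (hΩ : IsOpen Ω) (hF1 : ContDiff ℝ 1 F)
    (hF : DifferentiableOn ℂ F Ω) (hFΩ : MapsTo F Ω Ω')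
    (hφ : ∀ z ∈ Ω', DifferentiableAt ℝ φ z)
    (hinj : ∀ z ∈ Ω, Function.Injective (fderiv ℝ F z)) :
    StrictPSHOn n (fun w => φ (F w)) Ω := by
  intro z hz X hX
  rw [levi_comp hΩ hF1 hF hFΩ hφ hz fun l => h.differentiableAt_dZb (hFΩ hz) l]
  refine h _ (hFΩ hz) _ fun h0 => hX (hinj z hz ?_)
  rw [h0, map_zero]

end LeviComp

/-! ### Holomorphic functions without zeros on the boundary -/

/-- In dimension at least two, a holomorphic function on a bounded open set with no zeros on the
boundary has no zeros. -/
theorem ne_zero_of_ne_zero_frontier {n : ℕ} (hn : 2 ≤ n) {Ω : Set (Pt n)} (hΩ : IsOpen Ω)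
    (hb : Bornology.IsBounded Ω) {J : Pt n → ℂ} (hJc : Continuous J)
    (hJ : DifferentiableOn ℂ J Ω) (hfr : ∀ z ∈ frontier Ω, J z ≠ 0) : ∀ z ∈ Ω, J z ≠ 0 := by
  by_contra! hex
  obtain ⟨z₀, hz₀, hJ₀⟩ := hex
  set K : Set (Pt n) := closure Ω ∩ J ⁻¹' {0} with hKdef
  have hK : IsCompact K :=
    hb.isCompact_closure.inter_right (isClosed_singleton.preimage hJc)
  have hKΩ : K ⊆ Ω := fun z hz => by
    by_contra hzΩ
    exact hfr z ⟨hz.1, by rwa [hΩ.interior_eq]⟩ hz.2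
  have hne : ∀ z ∈ Ω \ K, J z ≠ 0 := fun z hz h0 => hz.2 ⟨subset_closure hz.1, h0⟩
  obtain ⟨p, hp, Q, hQ, hQs, hfreq⟩ := exists_frequently_le_of_disc hn hK
    ⟨z₀, subset_closure hz₀, hJ₀⟩ hΩ hKΩ (ψ := fun z => ‖(J z)⁻¹‖) fun a w hdisc => by
      have hd : DiffContOnCl ℂ (fun ζ : ℂ => (J (a + ζ • w))⁻¹) (Metric.ball 0 1) := by
        refine DifferentiableOn.diffContOnCl fun ζ hζ => ?_
        rw [closure_ball 0 one_ne_zero, mem_closedBall_zero_iff] at hζ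
        have h1 : DifferentiableAt ℂ J (a + ζ • w) :=
          hJ.differentiableAt (hΩ.mem_nhds (hdisc ζ hζ).1)
        have h2 : DifferentiableAt ℂ (fun ζ : ℂ => a + ζ • w) ζ := by fun_prop
        exact ((DifferentiableAt.comp (f := fun ζ : ℂ => a + ζ • w) ζ h1 h2).inv
          (hne _ (hdisc ζ hζ))).differentiableWithinAt
      obtain ⟨ζ, hζ, hmax⟩ := Complex.exists_mem_frontier_isMaxOn_norm Metric.isBounded_ball
        (Metric.nonempty_ball.2 one_pos) hd
      rw [frontier_ball 0 one_ne_zero, mem_sphere_zero_iff_norm] at hζ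
      refine ⟨ζ, hζ, ?_⟩
      simpa using hmax (subset_closure (Metric.mem_ball_self one_pos))
  obtain ⟨z₁, -, y₁, hy₁, -⟩ := hfreq.exists
  obtain ⟨y₀, hy₀, hmin⟩ := hQ.exists_isMinOn ⟨y₁, hy₁⟩ (f := fun z => ‖J z‖)
    hJc.norm.continuousOn
  have hpos : 0 < ‖J y₀‖ := norm_pos_iff.2 (hne y₀ (hQs hy₀))
  have hp0 : ‖J p‖ = 0 := by simpa using hp.2
  have hev : ∀ᶠ z in 𝓝 p, ‖J z‖ < ‖J y₀‖ :=
    hJc.norm.continuousAt.eventually (gt_mem_nhds (hp0.trans_lt hpos))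
  obtain ⟨z, ⟨hz, y, hy, hzy⟩, hlt⟩ := (hfreq.and_eventually hev).exists
  have h1 : ‖J y‖ ≤ ‖J z‖ := by
    simp only [norm_inv] at hzy
    exact (inv_le_inv₀ (norm_pos_iff.2 (hne z hz)) (norm_pos_iff.2 (hne y (hQs hy)))).1 hzy
  exact absurd ((hmin hy).trans h1) (not_le.2 hlt)

/-! ### Extension of CR diffeomorphisms -/

section Extension

variable {n : ℕ} {k : ℕ∞} {Ω Ω₁ Ω₂ V₁ V₂ U₁ U₂ : Set (Pt n)} {ρ₁ ρ₂ : Pt n → ℝ}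
  {f g F : Pt n → Pt n}

theorem IsCRDiffeo.exists_extension (hn : 2 ≤ n) (hk : 3 ≤ k)
    (h : IsCRDiffeo n k Ω₁ Ω₂ ρ₁ ρ₂ f g U₁ U₂) (hd : IsDefining n 3 Ω₁ ρ₁ V₁)
    (hb : Bornology.IsBounded Ω₁) (hext : IsPreconnected (closure Ω₁)ᶜ) :
    ∃ F : Pt n → Pt n, ContDiff ℝ 1 F ∧ (∀ z ∈ frontier Ω₁, F z = f z) ∧
      DifferentiableOn ℂ F Ω₁ := by
  have hk1 : 1 ≤ k := le_trans (by norm_num) hk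
  have hk3 : (3 : WithTop ℕ∞) ≤ (k : WithTop ℕ∞) := WithTop.coe_le_coe.2 hk
  have hk1' : (1 : WithTop ℕ∞) ≤ (k : WithTop ℕ∞) := by exact_mod_cast hk1
  have main : ∀ l, ∃ Fl : Pt n → ℂ, ContDiff ℝ 1 Fl ∧ (∀ z ∈ frontier Ω₁, Fl z = f z l) ∧
      DifferentiableOn ℂ Fl Ω₁ := fun l => by
    refine hd.hartogs_bochner hn hb hext h.1 h.2.2.1 ((h.2.2.2.2.1 l).of_le hk3)
      fun p hp X h1 h2 => ?_
    have hρ := hd.differentiableAt (by norm_num) (hd.2.1 hp.1)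
    have hfd := ((h.contDiffAt hp).of_le hk1').differentiableAt one_ne_zero
    have := (h.fderiv_mem_T10 hk1 hp ((mem_T10_iff hρ).2 ⟨h1, h2⟩)).1
    rw [fderiv_component hfd, fderiv_component hfd, this]
    rfl
  choose F hF1 hFf hFh using main
  exact ⟨fun z l => F l z, contDiff_pi.2 hF1, fun z hz => funext fun l => hFf l z hz,
    differentiableOn_pi.2 hFh⟩

theorem fderiv_I_smul_of_mem_closure (hΩ : IsOpen Ω) (hF1 : ContDiff ℝ 1 F)
    (hF : DifferentiableOn ℂ F Ω) {z : Pt n} (hz : z ∈ closure Ω) (X : Pt n) :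
    fderiv ℝ F z (I • X) = I • fderiv ℝ F z X := by
  have hc : Continuous (fderiv ℝ F) := hF1.continuous_fderiv one_ne_zero
  have hcl : IsClosed {z | fderiv ℝ F z (I • X) = I • fderiv ℝ F z X} :=
    isClosed_eq (by fun_prop) (by fun_prop)
  exact closure_minimal (fun w hw => (hF.differentiableAt (hΩ.mem_nhds hw)).fderiv_real_smul I X)
    hcl hz

theorem IsCRDiffeo.injective_fderiv_extension (h : IsCRDiffeo n k Ω₁ Ω₂ ρ₁ ρ₂ f g U₁ U₂)
    (hk : 1 ≤ k) (hd : IsDefining n k Ω₁ ρ₁ V₁) (hF1 : ContDiff ℝ 1 F)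
    (hFf : ∀ z ∈ frontier Ω₁, F z = f z) (hF : DifferentiableOn ℂ F Ω₁) {p : Pt n}
    (hp : p ∈ frontier Ω₁) : Function.Injective (fderiv ℝ F p) := by
  have hk' : (1 : WithTop ℕ∞) ≤ (k : WithTop ℕ∞) := by exact_mod_cast hk
  have hfp := (h.contDiffAt hp).of_le hk'
  have htan : ∀ X, fderiv ℝ ρ₁ p X = 0 → fderiv ℝ F p X = 0 → X = 0 := by
    intro X hX hX0
    have h1 := hd.fderiv_eq_zero hk hp (u := fun z => F z - f z) (hF1.contDiffAt.sub hfp)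
      (fun z hz => sub_eq_zero.2 (hFf z hz)) hX
    have e : fderiv ℝ (fun z => F z - f z) p = _ :=
      ((hF1.differentiable one_ne_zero p).hasFDerivAt.sub
        (hfp.differentiableAt one_ne_zero).hasFDerivAt).fderiv
    rw [e, sub_apply, hX0, zero_sub, neg_eq_zero] at h1
    rw [← h.fderiv_fderiv hk hk hd hp hX, h1, map_zero]
  rw [injective_iff_map_eq_zero]
  intro X hX
  have hIX : fderiv ℝ F p (I • X) = 0 := by
    rw [fderiv_I_smul_of_mem_closure hd.isOpen_domain hF1 hF hp.1, hX, smul_zero]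
  by_cases h0 : fderiv ℝ ρ₁ p X = 0
  · exact htan X h0 hX
  have hcomb : ∀ Y, fderiv ℝ F p Y = 0 → fderiv ℝ ρ₁ p Y • X - fderiv ℝ ρ₁ p X • Y = 0 :=
    fun Y hY => htan _ (by rw [map_sub, map_smul, map_smul, smul_eq_mul, smul_eq_mul]; ring)
      (by rw [map_sub, map_smul, map_smul, hX, hY]; simp)
  have hY := hcomb _ hIX
  have hY' : ((fderiv ℝ ρ₁ p (I • X) : ℂ) - fderiv ℝ ρ₁ p X * I) • X = 0 := by
    rw [← hY]
    funext l
    simp [sub_mul, mul_assoc]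
  refine (smul_eq_zero.1 hY').resolve_left fun hc => h0 ?_
  simpa using congrArg im hc

theorem injective_fderiv_iff_det {z : Pt n} (hI : ∀ X, fderiv ℝ F z (I • X) = I • fderiv ℝ F z X) :
    Function.Injective (fderiv ℝ F z) ↔
      (Matrix.of fun l k => fderiv ℝ F z (Pi.single k 1) l).det ≠ 0 := by
  set A := (fderiv ℝ F z).toComplex hI with hA
  have hM : LinearMap.toMatrix' (A : Pt n →ₗ[ℂ] Pt n) =
      Matrix.of fun l k => fderiv ℝ F z (Pi.single k 1) l := by
    ext l k
    rw [LinearMap.toMatrix'_apply]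
    rfl
  rw [← hM, LinearMap.det_toMatrix', ← isUnit_iff_ne_zero, ← LinearMap.isUnit_iff_isUnit_det,
    LinearMap.isUnit_iff_ker_eq_bot, LinearMap.ker_eq_bot]
  rfl

theorem injective_fderiv_of_frontier (hn : 2 ≤ n) (hΩ : IsOpen Ω) (hb : Bornology.IsBounded Ω)
    (hF1 : ContDiff ℝ 1 F) (hF : DifferentiableOn ℂ F Ω)
    (hfr : ∀ p ∈ frontier Ω, Function.Injective (fderiv ℝ F p)) {z : Pt n} (hz : z ∈ closure Ω) :
    Function.Injective (fderiv ℝ F z) := by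
  have hI : ∀ z ∈ closure Ω, ∀ X, fderiv ℝ F z (I • X) = I • fderiv ℝ F z X :=
    fun z hz => fderiv_I_smul_of_mem_closure hΩ hF1 hF hz
  have hzΩ : z ∈ Ω ∨ z ∈ frontier Ω := by
    by_cases h : z ∈ Ω
    · exact Or.inl h
    · exact Or.inr ⟨hz, by rwa [hΩ.interior_eq]⟩
  rcases hzΩ with hzΩ | hzΩ
  swap
  · exact hfr z hzΩ
  have hcf : Continuous (fderiv ℝ F) := hF1.continuous_fderiv one_ne_zero
  refine (injective_fderiv_iff_det (hI z hz)).2 ?_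
  refine ne_zero_of_ne_zero_frontier hn hΩ hb
    (J := fun z => (Matrix.of fun l k => fderiv ℝ F z (Pi.single k 1) l).det) ?_ ?_
    (fun p hp => (injective_fderiv_iff_det (hI p hp.1)).1 (hfr p hp)) z hzΩ
  · refine Continuous.matrix_det (continuous_matrix fun l k => ?_)
    exact (continuous_apply l).comp (hcf.clm_apply continuous_const)
  · simp only [Matrix.det_apply, Matrix.of_apply]
    refine DifferentiableOn.fun_sum fun σ _ => DifferentiableOn.const_smul ?_ _
    have hentry : ∀ i ∈ Finset.univ,
        DifferentiableOn ℂ (fun z => fderiv ℝ F z (Pi.single i 1) (σ i)) Ω := fun i _ => ?_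
    · exact fun w hw => (HasFDerivWithinAt.finsetProd fun i hi =>
        (hentry i hi w hw).hasFDerivWithinAt).differentiableWithinAt
    have h1 := (contDiff_pi.1 hF1 (σ i)).differentiableOn_fderiv_apply
      (differentiableOn_pi.1 hF (σ i)) hΩ (Pi.single i 1)
    refine h1.congr fun w _ => ?_
    exact (fderiv_component (hF1.differentiable one_ne_zero w) _ _).symm

end Extension

/-! ### Pulling back defining functions -/

section Pullback

variable {n : ℕ} {s : ℕ∞} {Ω Ω₁ Ω₂ V V₁ : Set (Pt n)} {ρ ρ₁ : Pt n → ℝ} {F : Pt n → Pt n}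

theorem mapsTo_of_frontier (hn : 2 ≤ n) (hΩ₁ : IsOpen Ω₁) (hb₁ : Bornology.IsBounded Ω₁)
    (hb₂ : Bornology.IsBounded Ω₂) (hext : IsPreconnected (closure Ω₂)ᶜ)
    (hint : interior (closure Ω₂) = Ω₂) (hF1 : ContDiff ℝ 1 F)
    (hFf : MapsTo F (frontier Ω₁) (frontier Ω₂))
    (hsurj : ∀ z ∈ Ω₁, Function.Surjective (fderiv ℝ F z)) : MapsTo F Ω₁ Ω₂ := by
  have hopen : IsOpen (F '' Ω₁) := by
    rw [isOpen_iff_mem_nhds]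
    rintro _ ⟨z, hz, rfl⟩
    have h1 := (hF1.contDiffAt (x := z)).hasStrictFDerivAt one_ne_zero
    rw [← h1.map_nhds_eq_of_surj (LinearMap.range_eq_top.2 (hsurj z hz))]
    exact image_mem_map (hΩ₁.mem_nhds hz)
  have hcomp : IsCompact (F '' closure Ω₁) := hb₁.isCompact_closure.image hF1.continuous
  have hsub : F '' Ω₁ ⊆ closure Ω₂ := by
    by_contra hne
    obtain ⟨w, hw, hwe⟩ := not_subset.1 hne
    obtain ⟨v, hv⟩ : ∃ v, v ∉ F '' closure Ω₁ ∪ closure Ω₂ := by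
      by_contra! hall
      exact not_isBounded_univ_pt hn
        ((hcomp.isBounded.union hb₂.closure).subset fun v _ => hall v)
    rw [mem_union, not_or] at hv
    obtain ⟨x, -, hx1, hx2⟩ := hext _ _ hopen hcomp.isClosed.isOpen_compl (fun x hx => by
      by_cases hxc : x ∈ F '' closure Ω₁
      · obtain ⟨y, hy, rfl⟩ := hxc
        by_cases hyΩ : y ∈ Ω₁
        · exact Or.inl ⟨y, hyΩ, rfl⟩
        · exact absurd (hFf ⟨hy, by rwa [hΩ₁.interior_eq]⟩).1 hx
      · exact Or.inr hxc) ⟨w, hwe, hw⟩ ⟨v, hv.2, hv.1⟩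
    exact hx2 (image_mono subset_closure hx1)
  rw [mapsTo_iff_image_subset, ← hint]
  exact interior_maximal hsub hopen

theorem IsDefining.eventually_mem_of_neg (h : IsDefining n s Ω ρ V) (hs : 1 ≤ s) {p : Pt n}
    (hp : p ∈ frontier Ω) {u : Pt n → ℝ} (hu : ContDiffAt ℝ 1 u p)
    (h0 : ∀ z ∈ frontier Ω, u z = 0) (hneg : ∀ z ∈ Ω, u z < 0) (hdu : fderiv ℝ u p ≠ 0) :
    ∀ᶠ z in 𝓝 p, u z < 0 → z ∈ Ω := by
  obtain ⟨N, hN⟩ := h.exists_normal hp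
  obtain ⟨ε, hε, hV, hinc⟩ := h.exists_ball hs hp hN
  have hin : ∀ t : ℝ, 0 < t → p + (-t) • N ∈ Metric.ball p ε → p + (-t) • N ∈ Ω := by
    intro t ht hb
    have h1 := hinc _ hb t ht (by simpa [add_assoc, ← add_smul] using hε)
    rw [add_assoc, ← add_smul, neg_add_cancel, zero_smul, add_zero, h.eq_zero hp] at h1
    exact h.mem_iff.2 ⟨hV hb, h1⟩
  have hNu0 : fderiv ℝ u p N ≠ 0 := by
    intro hc
    refine hdu (ContinuousLinearMap.ext fun X => ?_)
    have h1 := h.fderiv_real_eq_zero hs hp hu h0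
      (X := X - (fderiv ℝ ρ p X / fderiv ℝ ρ p N) • N)
      (by rw [map_sub, map_smul, smul_eq_mul, div_mul_cancel₀ _ hN.ne', sub_self])
    rw [map_sub, map_smul, hc, smul_zero, sub_zero] at h1
    simpa using h1
  have hNu : 0 < fderiv ℝ u p N := by
    refine lt_of_le_of_ne (le_of_not_gt fun hlt => ?_) hNu0.symm
    obtain ⟨δ, hδ, hδε, hinc'⟩ := exists_ball_strictMono hu (N := -N)
      (by rw [map_neg]; linarith) (Metric.ball_mem_nhds p hε)
    obtain ⟨τ, hτ, hb⟩ := exists_smul_mem_ball (Metric.mem_ball_self hδ : p ∈ Metric.ball p δ) N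
    have hb' := hb (-τ) (by rw [abs_neg, abs_of_pos hτ])
    have h1 := hinc' p (Metric.mem_ball_self hδ) τ hτ (by simpa using hb')
    rw [smul_neg, ← neg_smul, h0 p hp] at h1
    exact absurd (hneg _ (hin τ hτ (hδε hb'))) (not_lt.2 h1.le)
  obtain ⟨δ, hδ, hδs, hinc'⟩ := exists_ball_strictMono hu hNu
    (inter_mem (Metric.ball_mem_nhds p hε) (h.eventually_mem_frontier hs hp))
  obtain ⟨τ, hτ, hb⟩ := exists_smul_mem_ball (Metric.mem_ball_self hδ : p ∈ Metric.ball p δ) N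
  have hbτ := hb (-τ) (by rw [abs_neg, abs_of_pos hτ])
  have hτΩ := hin τ hτ (hδs hbτ).1
  have hc : ContinuousAt (fun z : Pt n => z + (-τ) • N) p := by fun_prop
  filter_upwards [Metric.ball_mem_nhds p hδ,
    hc ((Metric.isOpen_ball.inter h.isOpen_domain).mem_nhds ⟨hbτ, hτΩ⟩)] with z hz hzτ huz
  by_contra hzΩ
  have hzV : z ∈ V := hV (hδs hz).1
  have hρz : 0 ≤ ρ z := le_of_not_gt fun hlt => hzΩ (h.mem_iff.2 ⟨hzV, hlt⟩)
  have hseg : ∀ t ∈ Icc (0 : ℝ) τ, z + (-t) • N ∈ Metric.ball p δ := by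
    intro t ht
    refine (convex_ball p δ).segment_subset hz hzτ.1 ⟨1 - t / τ, t / τ, ?_,
      div_nonneg ht.1 hτ.le, by ring, ?_⟩
    · rw [sub_nonneg, div_le_one hτ]; exact ht.2
    · rw [smul_add, smul_smul, mul_neg, div_mul_cancel₀ _ hτ.ne', ← add_assoc, ← add_smul]
      simp
  have hcont : ContinuousOn (fun t : ℝ => ρ (z + (-t) • N)) (Icc 0 τ) := fun t ht => by
    have h1 := h.continuousAt (hV (hδs (hseg t ht)).1)
    have h2 : ContinuousAt (fun t : ℝ => z + (-t) • N) t := by fun_prop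
    exact (ContinuousAt.comp (f := fun t : ℝ => z + (-t) • N) h1 h2).continuousWithinAt
  obtain ⟨t, ht, ht0⟩ := intermediate_value_Icc' hτ.le hcont
    (show (0 : ℝ) ∈ Icc _ _ from ⟨(h.mem_iff.1 hzτ.2).2.le, by simpa using hρz⟩)
  have hfr := (hδs (hseg t ht)).2 ht0
  have hu0 := h0 _ hfr
  rcases ht.1.eq_or_lt with rfl | htpos
  · simp only [neg_zero, zero_smul, add_zero] at hu0
    exact huz.ne hu0
  · have h1 := hinc' _ (hseg t ht) t htpos (by simpa [add_assoc, ← add_smul] using hz)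
    rw [add_assoc, ← add_smul, neg_add_cancel, zero_smul, add_zero, hu0] at h1
    exact lt_asymm huz h1

/-- Pullback of a defining function by a map that is a submersion along the boundary. -/
theorem IsDefining.exists_pullback (h₁ : IsDefining n s Ω₁ ρ₁ V₁) (hs : 1 ≤ s)
    (h : IsDefining n 1 Ω₂ ρ V) (hF1 : ContDiff ℝ 1 F) (hF : MapsTo F Ω₁ Ω₂)
    (hFf : MapsTo F (frontier Ω₁) (frontier Ω₂))
    (hsurj : ∀ z ∈ frontier Ω₁, Function.Surjective (fderiv ℝ F z)) :
    ∃ V', IsDefining n 1 Ω₁ (fun z => ρ (F z)) V' := by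
  have hΩ₁ := h₁.isOpen_domain
  have hFc := hF1.continuous
  have hcd : ∀ z, F z ∈ V → ContDiffAt ℝ 1 (fun z => ρ (F z)) z := fun z hz =>
    ContDiffAt.comp z (h.contDiffAt hz) hF1.contDiffAt
  have hder : ∀ p ∈ frontier Ω₁, fderiv ℝ (fun z => ρ (F z)) p ≠ 0 := by
    intro p hp h0
    have e : fderiv ℝ (fun z => ρ (F z)) p = _ :=
      ((h.differentiableAt le_rfl (h.2.1 (hFf hp).1)).hasFDerivAt.comp p
        (hF1.differentiable one_ne_zero p).hasFDerivAt).fderiv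
    refine h.2.2.2.2 _ (hFf hp) (ContinuousLinearMap.ext fun Y => ?_)
    obtain ⟨X, rfl⟩ := hsurj p hp Y
    rw [e] at h0
    exact DFunLike.congr_fun h0 X
  have hneg : ∀ z ∈ Ω₁, ρ (F z) < 0 := fun z hz => (h.mem_iff.1 (hF hz)).2
  have hΩV : ∀ z ∈ Ω₁, F z ∈ V := fun z hz => (h.mem_iff.1 (hF hz)).1
  have hsub : Ω₁ ⊆ interior {z | F z ∈ V ∧ (ρ (F z) < 0 → z ∈ Ω₁)} :=
    interior_maximal (fun z hz => ⟨hΩV z hz, fun _ => hz⟩) hΩ₁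
  refine ⟨interior {z | F z ∈ V ∧ (ρ (F z) < 0 → z ∈ Ω₁)}, isOpen_interior, ?_, ?_, ?_, hder⟩
  · intro p hp
    by_cases hpΩ : p ∈ Ω₁
    · exact hsub hpΩ
    have hpf : p ∈ frontier Ω₁ := ⟨hp, by rwa [hΩ₁.interior_eq]⟩
    have hpV : F p ∈ V := h.2.1 (hFf hpf).1
    rw [mem_interior_iff_mem_nhds]
    filter_upwards [hFc.continuousAt (h.1.mem_nhds hpV),
      h₁.eventually_mem_of_neg hs hpf (hcd p hpV) (fun z hz => h.eq_zero (hFf hz)) hneg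
        (hder p hpf)] with z h1 h2
    exact ⟨h1, h2⟩
  · exact fun z hz => (hcd z (interior_subset hz).1).contDiffWithinAt
  · ext z
    exact ⟨fun hz => ⟨hsub hz, hneg z hz⟩, fun hz => (interior_subset hz.1).2 hz.2⟩

end Pullback

/-! ### Invariance of the index -/

section Index

variable {n : ℕ} {k : ℕ∞} {Ω Ω₁ Ω₂ V₁ V₂ U₁ U₂ : Set (Pt n)} {ρ ρ₁ ρ₂ : Pt n → ℝ}
  {f g : Pt n → Pt n}

theorem DFexp_nonneg (ρ : Pt n → ℝ) (Ω : Set (Pt n)) : 0 ≤ DFexp n ρ Ω :=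
  Real.sSup_nonneg fun _ hη => hη.1.le

theorem DFexp_le_one (ρ : Pt n → ℝ) (Ω : Set (Pt n)) : DFexp n ρ Ω ≤ 1 :=
  Real.sSup_le (fun _ hη => hη.2.1.le) zero_le_one

theorem DFindex_nonneg (Ω : Set (Pt n)) : 0 ≤ DFindex n Ω :=
  Real.sSup_nonneg fun _ ⟨ρ, _, _, he⟩ => he ▸ DFexp_nonneg ρ Ω

theorem IsDefining.DFexp_le_DFindex {V : Set (Pt n)} (h : IsDefining n 1 Ω ρ V) :
    DFexp n ρ Ω ≤ DFindex n Ω :=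
  le_csSup ⟨1, by rintro _ ⟨ρ, _, _, rfl⟩; exact DFexp_le_one ρ Ω⟩ ⟨ρ, V, h, rfl⟩

theorem IsDefining.of_le {s t : ℕ∞} {V : Set (Pt n)} (h : IsDefining n t Ω ρ V) (hst : s ≤ t) :
    IsDefining n s Ω ρ V :=
  ⟨h.1, h.2.1, h.2.2.1.of_le (WithTop.coe_le_coe.2 hst), h.2.2.2⟩

theorem IsCRDiffeo.DFindex_le (hn : 2 ≤ n) (hk : 3 ≤ k)
    (hd₁ : IsDefining n k Ω₁ ρ₁ V₁) (hd₂ : IsDefining n k Ω₂ ρ₂ V₂)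
    (hb₁ : Bornology.IsBounded Ω₁) (hb₂ : Bornology.IsBounded Ω₂) (hc₂ : IsPreconnected Ω₂)
    (h : IsCRDiffeo n k Ω₁ Ω₂ ρ₁ ρ₂ f g U₁ U₂) : DFindex n Ω₂ ≤ DFindex n Ω₁ := by
  have hk1 : 1 ≤ k := le_trans (by norm_num) hk
  have hΩ₁ := hd₁.isOpen_domain
  refine Real.sSup_le ?_ (DFindex_nonneg Ω₁)
  rintro _ ⟨ρ, V, hρ, rfl⟩
  refine Real.sSup_le (fun η hη => ?_) (DFindex_nonneg Ω₁)
  have hext₂ := hρ.isPreconnected_ext_of_psh hn le_rfl hb₂ hη.1 hη.2.2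
  have hfr₂ := (hd₂.of_le hk).isPreconnected_frontier hn hb₂ hc₂ hext₂
  have hfr₁ : IsPreconnected (frontier Ω₁) := by
    have hsymm := h.symm hk1 hd₁ hd₂
    rw [← h.image_symm]
    exact hfr₂.image g fun q hq => (hsymm.contDiffAt hq).continuousAt.continuousWithinAt
  have hext₁ := hd₁.isPreconnected_ext hn hk1 hb₁ hfr₁
  obtain ⟨F, hF1, hFf, hF⟩ := h.exists_extension hn hk (hd₁.of_le hk) hb₁ hext₁
  have hinj : ∀ z ∈ closure Ω₁, Function.Injective (fderiv ℝ F z) := fun z hz =>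
    injective_fderiv_of_frontier hn hΩ₁ hb₁ hF1 hF
      (fun p hp => h.injective_fderiv_extension hk1 hd₁ hF1 hFf hF hp) hz
  have hsurj : ∀ z ∈ closure Ω₁, Function.Surjective (fderiv ℝ F z) := fun z hz =>
    LinearMap.injective_iff_surjective (f := (fderiv ℝ F z : Pt n →ₗ[ℝ] Pt n)).1 (hinj z hz)
  have hFfr : MapsTo F (frontier Ω₁) (frontier Ω₂) := fun p hp => by
    rw [hFf p hp]; exact h.mem_frontier hp
  have hFΩ : MapsTo F Ω₁ Ω₂ := mapsTo_of_frontier hn hΩ₁ hb₁ hb₂ hext₂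
    (hρ.interior_closure le_rfl) hF1 hFfr fun z hz => hsurj z (subset_closure hz)
  obtain ⟨V', hV'⟩ := hd₁.exists_pullback hk1 hρ hF1 hFΩ hFfr fun z hz => hsurj z hz.1
  refine le_trans ?_ hV'.DFexp_le_DFindex
  refine le_csSup ⟨1, fun _ hη => hη.2.1.le⟩ ⟨hη.1, hη.2.1, ?_⟩
  exact hη.2.2.comp hΩ₁ hF1 hF hFΩ (fun z hz => hρ.differentiableAt_rpow le_rfl η hz)
    fun z hz => hinj z (subset_closure hz)

end Index

end

/-- Theorem 1.2, DF part: the Diederich–Fornaess index is invariant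
under CR-diffeomorphisms of the boundaries. -/
theorem DFindex_CR_invariant
    (n k : ℕ) (hn : 2 ≤ n) (hk : 3 ≤ k)
    (Ω₁ Ω₂ : Set (Pt n))
    (h1o : IsOpen Ω₁) (h1c : IsConnected Ω₁) (h1b : Bornology.IsBounded Ω₁)
    (h2o : IsOpen Ω₂) (h2c : IsConnected Ω₂) (h2b : Bornology.IsBounded Ω₂)
    (ρ₁ : Pt n → ℝ) (V₁ : Set (Pt n)) (hρ₁ : IsDefining n (k : ℕ∞) Ω₁ ρ₁ V₁)
    (ρ₂ : Pt n → ℝ) (V₂ : Set (Pt n)) (hρ₂ : IsDefining n (k : ℕ∞) Ω₂ ρ₂ V₂)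
    (f g : Pt n → Pt n) (U₁ U₂ : Set (Pt n))
    (hcr : IsCRDiffeo n (k : ℕ∞) Ω₁ Ω₂ ρ₁ ρ₂ f g U₁ U₂) :
    DFindex n Ω₁ = DFindex n Ω₂ := by
  have hk' : (3 : ℕ∞) ≤ (k : ℕ∞) := by exact_mod_cast hk
  have hk1 : (1 : ℕ∞) ≤ (k : ℕ∞) := le_trans (by norm_num) hk'
  exact le_antisymm
    ((hcr.symm hk1 hρ₁ hρ₂).DFindex_le hn hk' hρ₂ hρ₁ h2b h1b h1c.isPreconnected)
    (hcr.DFindex_le hn hk' hρ₁ hρ₂ h1b h2b h2c.isPreconnected)
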